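/- For k ≥ 3, let 𝒪_k be the graph obtained from the star tree with one central vertex of valency k by attaching a 3-cycle to each of its k leaves, and let T be any finite tree of diameter at least 3. Then the pure graph 2-braid group PB₂(𝒪_k) is quasi-isometric to the free product A(T) * ℤ. -/

import Mathlib

/-!
**Statement 18.**  For `k ≥ 3`, the pure graph 2-braid group `PB₂(𝒪_k)` of the
special cactus `𝒪_k` (a star with `k` legs, a 3-cycle attached to each leaf) is
quasi-isometric to `A(T) * ℤ` for any finite tree `T` of diameter at least 3.
-/

noncomputable section

open Metric Pointwise

/-- The word length of `g` with respect to a generating set `S` (symmetrized). -/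
noncomputable def wordLength {G : Type*} [Group G] (S : Set G) (g : G) : ℕ :=
  sInf {n : ℕ | ∃ l : List G, l.length = n ∧ (∀ x ∈ l, x ∈ S ∨ x⁻¹ ∈ S) ∧ l.prod = g}

/-- The (left-invariant) word metric on `G` determined by a generating set `S`;
this is the distance in the Cayley graph of `G` with respect to `S`. -/
noncomputable def wordDist {G : Type*} [Group G] (S : Set G) (g h : G) : ℝ :=
  (wordLength S (g⁻¹ * h) : ℝ)

/-- Two groups are quasi-isometric: their Cayley graphs with respect to (some,
equivalently any) finite generating sets are quasi-isometric metric spaces. -/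
def QuasiIsometricGroups (G H : Type*) [Group G] [Group H] : Prop :=
  ∃ (S : Finset G) (T : Finset H) (lam eps : ℝ) (f : G → H),
    Subgroup.closure (S : Set G) = ⊤ ∧ Subgroup.closure (T : Set H) = ⊤ ∧
    1 ≤ lam ∧ 0 ≤ eps ∧
    (∀ x y : G, (1 / lam) * wordDist (S : Set G) x y - eps ≤ wordDist (T : Set H) (f x) (f y)) ∧
    (∀ x y : G, wordDist (T : Set H) (f x) (f y) ≤ lam * wordDist (S : Set G) x y + eps) ∧
    (∀ z : H, ∃ x : G, wordDist (T : Set H) z (f x) ≤ eps)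

/-- The commutator relators of a right-angled Artin group. -/
def raagRels {V : Type} (Λ : SimpleGraph V) : Set (FreeGroup V) :=
  {r | ∃ v w : V, Λ.Adj v w ∧
      r = FreeGroup.of v * FreeGroup.of w * (FreeGroup.of v)⁻¹ * (FreeGroup.of w)⁻¹}

/-- The right-angled Artin group `A(Λ)` of a simplicial graph `Λ`:  it is generated
by the vertices of `Λ`, with a commuting relation for each edge of `Λ`. -/
def RAAG {V : Type} (Λ : SimpleGraph V) : Type := PresentedGroup (raagRels Λ)

instance {V : Type} (Λ : SimpleGraph V) : Group (RAAG Λ) :=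
  inferInstanceAs (Group (PresentedGroup (raagRels Λ)))

/-- The standard generator of `A(Λ)` corresponding to a vertex `v`. -/
def raagOf {V : Type} (Λ : SimpleGraph V) (v : V) : RAAG Λ :=
  PresentedGroup.of (rels := raagRels Λ) v

/-- The point of the geometric realization of a graph lying on the closed cell
spanned by `u` and `v`, at parameter `t`. -/
def cellPt {V : Type} [DecidableEq V] (u v : V) (t : ℝ) : V → ℝ :=
  fun w => (if w = u then t else 0) + (if w = v then 1 - t else 0)

/-- `u` and `v` span a closed cell of `Γ` (a vertex or a closed edge). -/
def IsClosedCell {V : Type} (Γ : SimpleGraph V) (u v : V) : Prop := u = v ∨ Γ.Adj u v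

/-- The ordered discrete configuration space `D₂(Γ)` of two points on the (geometric
realization of the) graph `Γ`: the union of the products of pairs of disjoint closed
cells of `Γ`, realized inside `(V → ℝ) × (V → ℝ)`.  The pure graph 2-braid group is
`PB₂(Γ) = π₁(D₂(Γ))`. -/
def D2Config {V : Type} [DecidableEq V] (Γ : SimpleGraph V) : Set ((V → ℝ) × (V → ℝ)) :=
  {p | ∃ u v u' v' : V, IsClosedCell Γ u v ∧ IsClosedCell Γ u' v' ∧
        u ≠ u' ∧ u ≠ v' ∧ v ≠ u' ∧ v ≠ v' ∧
        ∃ t t' : ℝ, t ∈ Set.Icc (0:ℝ) 1 ∧ t' ∈ Set.Icc (0:ℝ) 1 ∧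
          p = (cellPt u v t, cellPt u' v' t')}

/-- Vertices of the graph `𝒪_k`. -/
abbrev OkV (k : ℕ) : Type := Unit ⊕ (Fin k × Fin 3)

/-- Edge relation of `𝒪_k`. -/
def OkRel (k : ℕ) : OkV k → OkV k → Prop
  | Sum.inl _, Sum.inr (_, j) => j = 0
  | Sum.inr (i, j), Sum.inr (i', j') => i = i' ∧ j ≠ j'
  | _, _ => False

/-- The special cactus `𝒪_k`: a star tree with central vertex of valency `k`, with a
3-cycle attached to each of its `k` leaves. -/
def OkGraph (k : ℕ) : SimpleGraph (OkV k) := SimpleGraph.fromRel (OkRel k)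

set_option linter.unusedSectionVars false
set_option linter.unusedVariables false
inductive Near {α : Type*} (R : α → α → Prop) : ℕ → α → α → Prop
  | refl (n : ℕ) (x : α) : Near R n x x
  | step {n : ℕ} {x y z : α} : R x y ∨ R y x → Near R n y z → Near R (n + 1) x z

namespace Near
variable {α : Type*} {β : Type*} {R : α → α → Prop} {R' : β → β → Prop}

theorem mono {n m : ℕ} {x y : α} (h : Near R n x y) (hnm : n ≤ m) : Near R m x y := by
  induction h generalizing m with
  | refl n x => exact Near.refl _ _
  | step h1 _ ih =>
    obtain ⟨m, rfl⟩ : ∃ m', m = m' + 1 := ⟨m - 1, by omega⟩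
    exact Near.step h1 (ih (by omega))

theorem trans {n m : ℕ} {x y z : α} (h : Near R n x y) (h' : Near R m y z) :
    Near R (n + m) x z := by
  induction h with
  | refl n x => exact h'.mono (by omega)
  | step h1 _ ih => exact (Near.step h1 (ih h')).mono (by omega)

theorem one {x y : α} (h : R x y) : Near R 1 x y := Near.step (Or.inl h) (Near.refl 0 _)
theorem one' {x y : α} (h : R x y) : Near R 1 y x := Near.step (Or.inr h) (Near.refl 0 _)

theorem symm {n : ℕ} {x y : α} (h : Near R n x y) : Near R n y x := by
  induction h with
  | refl n x => exact Near.refl _ _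
  | step h1 _ ih => exact ih.trans (Near.step h1.symm (Near.refl 0 _))

theorem map {K n : ℕ} {f : α → β} (hf : ∀ x y, R x y → Near R' K (f x) (f y)) {x y : α}
    (h : Near R n x y) : Near R' (K * n) (f x) (f y) := by
  induction h with
  | refl n x => exact Near.refl _ _
  | step h1 _ ih =>
    have := (h1.elim (hf _ _) (fun h => (hf _ _ h).symm)).trans ih
    exact this.mono (by ring_nf; omega)
end Near

def CE {α : Type*} {β : Type*} (R : α → α → Prop) (R' : β → β → Prop) : Prop :=
  ∃ (f : α → β) (g : β → α) (K : ℕ), (∀ x y, R x y → Near R' K (f x) (f y)) ∧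
    (∀ x y, R' x y → Near R K (g x) (g y)) ∧ (∀ x, Near R K (g (f x)) x) ∧
    (∀ y, Near R' K (f (g y)) y)

namespace CE
variable {α : Type*} {β : Type*} {γ : Type*} {R : α → α → Prop} {R' : β → β → Prop}
  {R'' : γ → γ → Prop}

theorem symm (h : CE R R') : CE R' R := by
  obtain ⟨f, g, K, h1, h2, h3, h4⟩ := h
  exact ⟨g, f, K, h2, h1, h4, h3⟩

theorem trans (h : CE R R') (h' : CE R' R'') : CE R R'' := by
  obtain ⟨f, g, K, h1, h2, h3, h4⟩ := h
  obtain ⟨f', g', K', h1', h2', h3', h4'⟩ := h'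
  refine ⟨f' ∘ f, g ∘ g', K * K' + K + K', ?_, ?_, ?_, ?_⟩
  · intro x y h
    exact (Near.map h1' (h1 x y h)).mono (by nlinarith)
  · intro x y h
    exact (Near.map h2 (h2' x y h)).mono (by nlinarith)
  · intro x
    exact ((Near.map h2 (h3' (f x))).trans (h3 x)).mono (by omega)
  · intro x
    exact ((Near.map h1' (h4 (g' x))).trans (h4' x)).mono (by nlinarith)
end CE

/-- Cayley graph relation. -/
def Cay {G : Type*} [Group G] (S : Set G) (x y : G) : Prop := ∃ s ∈ S, y = x * s

section Cay
variable {G : Type*} [Group G] {H : Type*} [Group H]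

theorem Near.lmul {S : Set G} {n : ℕ} {x y : G} (g : G) (h : Near (Cay S) n x y) :
    Near (Cay S) n (g * x) (g * y) := by
  have := Near.map (R := Cay S) (R' := Cay S) (K := 1) (f := fun x => g * x) (by
    rintro x y ⟨s, hs, rfl⟩
    exact Near.one ⟨s, hs, by simp [mul_assoc]⟩) h
  simpa using this

theorem near_of_closure {S : Set G} {g : G} (h : g ∈ Subgroup.closure S) :
    ∃ n, Near (Cay S) n 1 g := by
  induction h using Subgroup.closure_induction with
  | mem x hx => exact ⟨1, Near.one ⟨x, hx, by simp⟩⟩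
  | one => exact ⟨0, Near.refl _ _⟩
  | mul x y _ _ hx hy =>
    obtain ⟨n, hn⟩ := hx
    obtain ⟨m, hm⟩ := hy
    exact ⟨n + m, hn.trans (by simpa using hm.lmul x)⟩
  | inv x _ hx =>
    obtain ⟨n, hn⟩ := hx
    exact ⟨n, by simpa using (hn.lmul x⁻¹).symm⟩

theorem near_gen {S : Set G} (hS : Subgroup.closure S = ⊤) (F : Finset G) :
    ∃ K, ∀ s ∈ F, ∀ x, Near (Cay S) K x (x * s) := by
  choose n hn using fun g : G => near_of_closure (S := S) (g := g) (by rw [hS]; trivial)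
  refine ⟨F.sup n, fun s hs x => ?_⟩
  simpa using ((hn s).lmul x).mono (Finset.le_sup hs)

theorem cay_change (S S' : Finset G) (hS : Subgroup.closure (S : Set G) = ⊤)
    (hS' : Subgroup.closure (S' : Set G) = ⊤) : CE (Cay (S : Set G)) (Cay (S' : Set G)) := by
  obtain ⟨K, hK⟩ := near_gen hS S'
  obtain ⟨K', hK'⟩ := near_gen hS' S
  refine ⟨id, id, K + K', ?_, ?_, fun x => Near.refl _ _, fun x => Near.refl _ _⟩
  · rintro x y ⟨s, hs, rfl⟩
    exact (hK' s hs x).mono (by omega)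
  · rintro x y ⟨s, hs, rfl⟩
    exact (hK s hs x).mono (by omega)

theorem near_length {S : Set G} {n : ℕ} {x y : G} (h : Near (Cay S) n x y) :
    wordLength S (x⁻¹ * y) ≤ n := by
  have : ∃ l : List G, l.length ≤ n ∧ (∀ x ∈ l, x ∈ S ∨ x⁻¹ ∈ S) ∧ l.prod = x⁻¹ * y := by
    induction h with
    | refl n x => exact ⟨[], by simp⟩
    | @step n x y z h1 _ ih =>
      obtain ⟨l, hl, h2, h3⟩ := ih
      refine ⟨(x⁻¹ * y) :: l, by simpa using hl, ?_, by simp [h3, mul_assoc]⟩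
      intro s hs
      rcases List.mem_cons.1 hs with rfl | hs
      · rcases h1 with ⟨t, ht, rfl⟩ | ⟨t, ht, rfl⟩
        · left; simpa using ht
        · right; simpa using ht
      · exact h2 s hs
  obtain ⟨l, hl, h2, h3⟩ := this
  exact le_trans (Nat.sInf_le ⟨l, rfl, h2, h3⟩) hl

theorem near_of_list {S : Set G} (l : List G) (hl : ∀ x ∈ l, x ∈ S ∨ x⁻¹ ∈ S) (x : G) :
    Near (Cay S) l.length x (x * l.prod) := by
  induction l generalizing x with
  | nil => simpa using Near.refl _ _
  | cons a l ih =>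
    have h1 := ih (fun y hy => hl y (List.mem_cons_of_mem _ hy)) (x * a)
    rw [List.prod_cons, ← mul_assoc]
    refine Near.step ?_ h1
    rcases hl a (by simp) with h | h
    · exact Or.inl ⟨a, h, rfl⟩
    · exact Or.inr ⟨a⁻¹, h, by simp⟩

theorem near_wordLength {S : Set G} (hS : Subgroup.closure S = ⊤) (x y : G) :
    Near (Cay S) (wordLength S (x⁻¹ * y)) x y := by
  have hne : {n : ℕ | ∃ l : List G, l.length = n ∧ (∀ x ∈ l, x ∈ S ∨ x⁻¹ ∈ S) ∧
      l.prod = x⁻¹ * y}.Nonempty := by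
    obtain ⟨l, h1, h2⟩ := Submonoid.exists_list_of_mem_closure (s := S ∪ S⁻¹) (x := x⁻¹ * y) (by
      rw [← Subgroup.closure_toSubmonoid, hS]; trivial)
    exact ⟨l.length, l, rfl, fun z hz => by simpa using h1 z hz, h2⟩
  obtain ⟨l, h1, h2, h3⟩ := Nat.sInf_mem hne
  have := near_of_list l h2 x
  rw [h1, h3, mul_inv_cancel_left] at this
  exact this

/-- coarse equivalence of groups -/
def CEG (G : Type*) (H : Type*) [Group G] [Group H] : Prop :=
  ∃ (S : Finset G) (T : Finset H), Subgroup.closure (S : Set G) = ⊤ ∧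
    Subgroup.closure (T : Set H) = ⊤ ∧ CE (Cay (S : Set G)) (Cay (T : Set H))

theorem CEG.symm (h : CEG G H) : CEG H G := by
  obtain ⟨S, T, h1, h2, h3⟩ := h
  exact ⟨T, S, h2, h1, h3.symm⟩

theorem CEG.trans {L : Type*} [Group L] (h : CEG G H) (h' : CEG H L) : CEG G L := by
  obtain ⟨S, T, h1, h2, h3⟩ := h
  obtain ⟨T', U, h1', h2', h3'⟩ := h'
  exact ⟨S, U, h1, h2', h3.trans ((cay_change T T' h2 h1').trans h3')⟩

theorem CEG.qi (h : CEG G H) : QuasiIsometricGroups G H := by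
  obtain ⟨S, T, hS, hT, f, g, K, h1, h2, h3, h4⟩ := h
  refine ⟨S, T, K + 1, 2 * K, f, hS, hT, by simp, by positivity, ?_, ?_, ?_⟩
  · intro x y
    have ha := near_length (((h3 x).symm.trans (Near.map h2
      (near_wordLength hT (f x) (f y)))).trans (h3 y))
    have hb : wordDist (S : Set G) x y ≤ K + K * wordDist (T : Set H) (f x) (f y) + K := by
      unfold wordDist; exact_mod_cast ha
    have hc : (0 : ℝ) ≤ wordDist (T : Set H) (f x) (f y) := by unfold wordDist; positivity
    have hK : (0 : ℝ) ≤ K := by positivity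
    rw [sub_le_iff_le_add, one_div, inv_mul_le_iff₀ (by positivity)]
    nlinarith
  · intro x y
    have ha := near_length (Near.map h1 (near_wordLength hS x y))
    have hb : wordDist (T : Set H) (f x) (f y) ≤ K * wordDist (S : Set G) x y := by
      unfold wordDist; exact_mod_cast ha
    have hc : (0 : ℝ) ≤ wordDist (S : Set G) x y := by unfold wordDist; positivity
    have hK : (0 : ℝ) ≤ K := by positivity
    nlinarith
  · intro z
    refine ⟨g z, ?_⟩
    have ha := near_length (h4 z).symm
    have hb : wordDist (T : Set H) z (f (g z)) ≤ K := by
      unfold wordDist; exact_mod_cast ha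
    have hK : (0 : ℝ) ≤ K := by positivity
    linarith

theorem closure_map_equiv (e : G ≃* H) {S : Set G} (hS : Subgroup.closure S = ⊤) :
    Subgroup.closure (e '' S) = ⊤ := by
  have := MonoidHom.map_closure e.toMonoidHom S
  rw [hS, Subgroup.map_top_of_surjective _ e.surjective] at this
  exact this.symm

theorem CEG.of_equiv (e : G ≃* H) (hG : Group.FG G) : CEG G H := by
  classical
  obtain ⟨S, hS⟩ := hG.out
  refine ⟨S, S.image e, hS, by simpa using closure_map_equiv e hS, e, e.symm, 1, ?_, ?_,
    by simp [Near.refl], by simp [Near.refl]⟩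
  · rintro x y ⟨s, hs, rfl⟩
    exact Near.one ⟨e s, by simpa using hs, by simp⟩
  · rintro x y ⟨s, hs, rfl⟩
    refine Near.one ⟨e.symm s, ?_, by simp⟩
    simp at hs
    obtain ⟨a, ha, rfl⟩ := hs
    simpa using ha
end Cay

structure Sig (A : Type) [Group A] (Fm : Type) where
  pt : Fm → A → A
  h1 : ∀ τ a, pt τ (pt τ a) = pt τ a
  h2 : ∀ τ a, pt τ ((pt τ a)⁻¹ * a) = 1
  h3 : ∀ τ a c, pt τ c = 1 → pt τ (a * c) = pt τ a
  u : Fm → A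
  ucomm : ∀ τ c, pt τ c = 1 → u τ * c = c * u τ
  upt : ∀ τ (n : ℕ), pt τ (u τ ^ n) = u τ ^ n
  une : ∀ τ (n : ℕ), 0 < n → u τ ^ n ≠ 1

structure Dat (Fm : Type) where
  S : Type
  E : Type
  ft : Fintype E
  s0 : S
  rev : E → E
  src : E → S
  tgt : E → S
  fam : E → Fm
  rev_rev : ∀ ε, rev (rev ε) = ε
  src_rev : ∀ ε, src (rev ε) = tgt ε
  fam_rev : ∀ ε, fam (rev ε) = fam ε

attribute [instance] Dat.ft

abbrev stdDat (Fm : Type) [Fintype Fm] : Dat Fm where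
  S := Unit
  E := Fm
  ft := inferInstance
  s0 := ()
  rev := id
  src _ := ()
  tgt _ := ()
  fam := id
  rev_rev _ := rfl
  src_rev _ := rfl
  fam_rev _ := rfl

section words
variable {A : Type} [Group A] {Fm : Type} (σ : Sig A Fm) (D : Dat Fm)

theorem Sig.pt_one (τ : Fm) : σ.pt τ 1 = 1 := by simpa using σ.upt τ 0

theorem Sig.pow_inj (τ : Fm) {n m : ℕ} (h : σ.u τ ^ n = σ.u τ ^ m) : n = m := by
  by_contra hne
  rcases Nat.lt_or_gt_of_ne hne with hlt | hlt
  · obtain ⟨d, rfl⟩ := Nat.exists_eq_add_of_lt hlt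
    rw [add_assoc, pow_add, left_eq_mul] at h
    exact σ.une τ _ (by omega) h
  · obtain ⟨d, rfl⟩ := Nat.exists_eq_add_of_lt hlt
    rw [add_assoc, pow_add, mul_eq_left] at h
    exact σ.une τ _ (by omega) h

theorem Sig.pow_comm (τ : Fm) (n : ℕ) {c : A} (h : σ.pt τ c = 1) :
    σ.u τ ^ n * c = c * σ.u τ ^ n := by
  have : Commute (σ.u τ) c := σ.ucomm τ c h
  exact this.pow_left n

def typ : List (A × D.E) → D.S
  | [] => D.s0
  | p :: _ => D.tgt p.2

def lastE : List (A × D.E) → Option D.E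
  | [] => none
  | p :: _ => some p.2

def Valid : List (A × D.E) → Prop
  | [] => True
  | p :: w => Valid w ∧ D.src p.2 = typ D w ∧ σ.pt (D.fam p.2) p.1 = p.1 ∧
      ¬ (p.1 = 1 ∧ lastE D w = some (D.rev p.2))

inductive StepR (X : Set A) : List (A × D.E) × A → List (A × D.E) × A → Prop
  | mul (w : List (A × D.E)) (a x : A) : Valid σ D w → x ∈ X → StepR X (w, a) (w, a * x)
  | down (j : A) (ε : D.E) (w : List (A × D.E)) (c : A) : Valid σ D ((j, ε) :: w) →
      σ.pt (D.fam ε) c = 1 → StepR X (w, j * c) ((j, ε) :: w, c)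

abbrev MM : Type := {m : List (A × D.E) × A // Valid σ D m.1}

def Step (X : Set A) (m m' : MM σ D) : Prop := StepR σ D X m.1 m'.1

variable {σ D}
theorem StepR.valid {X : Set A} {m m' : List (A × D.E) × A} (h : StepR σ D X m m') :
    Valid σ D m.1 ∧ Valid σ D m'.1 := by
  cases h with
  | mul w a x h => exact ⟨h, h⟩
  | down j ε w c h => exact ⟨h.1, h⟩

theorem near_raw {X : Set A} {n : ℕ} {m m' : List (A × D.E) × A}
    (h : Near (StepR σ D X) n m m') (hm : Valid σ D m.1) (hm' : Valid σ D m'.1) :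
    Near (Step σ D X) n ⟨m, hm⟩ ⟨m', hm'⟩ := by
  induction h with
  | refl n x => exact Near.refl _ _
  | @step n x y z h1 _ ih =>
    have hy : Valid σ D y.1 := by
      rcases h1 with h | h
      · exact h.valid.2
      · exact h.valid.1
    exact Near.step (R := Step σ D X) (x := ⟨x, hm⟩) (y := ⟨y, hy⟩) h1 (ih hy hm')

theorem near_cay {X : Set A} {n : ℕ} {a b : A} (h : Near (Cay X) n a b) {w : List (A × D.E)}
    (hw : Valid σ D w) : Near (StepR σ D X) n (w, a) (w, b) := by
  have := Near.map (R' := StepR σ D X) (K := 1) (f := fun a => (w, a)) (by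
    rintro x y ⟨s, hs, rfl⟩
    exact Near.one (StepR.mul w x s hw hs)) h
  simpa using this

theorem near_down {X : Set A} {j : A} {ε : D.E} {w : List (A × D.E)} {c : A}
    (h : Valid σ D ((j, ε) :: w)) (hc : σ.pt (D.fam ε) c = 1) :
    Near (StepR σ D X) 1 (w, j * c) ((j, ε) :: w, c) := Near.one (StepR.down j ε w c h hc)
end words

section GW
open Classical
variable {A : Type} [Group A] {Fm : Type} [Fintype Fm] (σ : Sig A Fm) (D : Dat Fm)

def bK : ℕ := 3 * Fintype.card D.E

def io (τ : Fm) (n : ℕ) : A := σ.u τ ^ (n + 1)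

def idx (τ : Fm) (j : A) : ℕ :=
  if h : ∃ n < 2 * bK D, j = io σ τ n then h.choose else 2 * bK D

variable {σ} in
theorem io_inj {τ : Fm} {n m : ℕ} (h : io σ τ n = io σ τ m) : n = m := by
  have := σ.pow_inj τ h; omega

theorem io_ne (τ : Fm) (n : ℕ) : io σ τ n ≠ 1 := σ.une τ _ (by omega)

theorem pt_io (τ : Fm) (n : ℕ) : σ.pt τ (io σ τ n) = io σ τ n := σ.upt τ _

theorem idx_io (τ : Fm) {n : ℕ} (h : n < 2 * bK D) : idx σ D τ (io σ τ n) = n := by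
  have hh : ∃ m < 2 * bK D, io σ τ n = io σ τ m := ⟨n, h, rfl⟩
  rw [idx, dif_pos hh]
  exact (io_inj hh.choose_spec.2).symm

variable {σ D} in
theorem idx_lt {τ : Fm} {j : A} (h : idx σ D τ j < 2 * bK D) : io σ τ (idx σ D τ j) = j := by
  unfold idx at h ⊢
  split_ifs at h ⊢ with hh
  · exact hh.choose_spec.2.symm
  · omega

def Ch (w : List (A × D.E)) (τ : Fm) (j : A) : List (List (A × D.E)) :=
  ((Finset.univ.filter (fun ε : D.E => D.src ε = typ D w ∧ D.fam ε = τ ∧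
    ¬ (j = 1 ∧ lastE D w = some (D.rev ε)))).toList).map (fun ε => (j, ε) :: w)

variable {D} in
theorem mem_Ch {w : List (A × D.E)} {τ : Fm} {j : A} {P : List (A × D.E)} :
    P ∈ Ch D w τ j ↔ ∃ ε : D.E, P = (j, ε) :: w ∧ D.src ε = typ D w ∧ D.fam ε = τ ∧
    ¬ (j = 1 ∧ lastE D w = some (D.rev ε)) := by
  simp only [Ch, List.mem_map, Finset.mem_toList, Finset.mem_filter, Finset.mem_univ, true_and]
  constructor
  · rintro ⟨ε, h, rfl⟩
    exact ⟨ε, rfl, h⟩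
  · rintro ⟨ε, rfl, h⟩
    exact ⟨ε, h, rfl⟩

theorem Ch_nodup (w : List (A × D.E)) (τ : Fm) (j : A) : (Ch D w τ j).Nodup := by
  unfold Ch
  refine List.Nodup.map ?_ (Finset.nodup_toList _)
  intro a b h
  simpa using h

theorem Ch_length (w : List (A × D.E)) (τ : Fm) (j : A) :
    (Ch D w τ j).length ≤ Fintype.card D.E := by
  simp only [Ch, List.length_map, Finset.length_toList]
  exact Finset.card_le_univ _

def FStep (R : List (A × D.E)) (ex : List (List (A × D.E))) (j : A) (τ : Fm) :
    List (A × D.E) × List (List (A × D.E)) :=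
  if idx σ D τ j < ex.length then (ex.getD (idx σ D τ j) [], Ch D (ex.getD (idx σ D τ j) []) τ 1)
  else ((Ch D R τ j).headD [], (Ch D R τ j).tail ++
    ((if bK D ≤ idx σ D τ j ∧ idx σ D τ j < 2 * bK D ∧ idx σ D τ j - bK D < ex.length then
      Ch D R τ (io σ τ (idx σ D τ j - bK D)) else []) ++ Ch D ((Ch D R τ j).headD []) τ 1))

def FF : List (A × Fm) → List (A × D.E) × List (List (A × D.E))
  | [] => ([], [])
  | (j, τ) :: u => FStep σ D (FF u).1 (if lastE (stdDat Fm) u = some τ then (FF u).2 else []) j τ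

def exx (u : List (A × Fm)) (τ : Fm) : List (List (A × D.E)) :=
  if lastE (stdDat Fm) u = some τ then (FF σ D u).2 else []

theorem FF_cons (j : A) (τ : Fm) (u : List (A × Fm)) :
    FF σ D ((j, τ) :: u) = FStep σ D (FF σ D u).1 (exx σ D u τ) j τ := rfl

/-- children classification -/
theorem FF_lt {j : A} {τ : Fm} {u : List (A × Fm)} (h : idx σ D τ j < (exx σ D u τ).length) :
    (FF σ D ((j, τ) :: u)).1 = (exx σ D u τ)[idx σ D τ j] ∧
    (FF σ D ((j, τ) :: u)).2 = Ch D (exx σ D u τ)[idx σ D τ j] τ 1 := by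
  rw [FF_cons, FStep, if_pos h]
  simp [h]

theorem FF_ge {j : A} {τ : Fm} {u : List (A × Fm)} (h : ¬ idx σ D τ j < (exx σ D u τ).length)
    (hne : Ch D (FF σ D u).1 τ j ≠ []) :
    ∃ N t, Ch D (FF σ D u).1 τ j = N :: t ∧ (FF σ D ((j, τ) :: u)).1 = N ∧
    (FF σ D ((j, τ) :: u)).2 = t ++
    ((if bK D ≤ idx σ D τ j ∧ idx σ D τ j < 2 * bK D ∧ idx σ D τ j - bK D <
        (exx σ D u τ).length then
      Ch D (FF σ D u).1 τ (io σ τ (idx σ D τ j - bK D)) else []) ++ Ch D N τ 1) := by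
  rw [FF_cons, FStep, if_neg h]
  obtain ⟨N, t, hNt⟩ := List.exists_cons_of_ne_nil hne
  exact ⟨N, t, hNt, by simp [hNt], by simp [hNt]⟩

def lfam (w : List (A × D.E)) : Option Fm := (lastE D w).map D.fam

/-- every (type, family) has an outgoing edge -/
def Full : Prop := ∀ (s : D.S) (τ : Fm), ∃ ε : D.E, D.src ε = s ∧ D.fam ε = τ

variable {σ D}
theorem Ch_valid {w : List (A × D.E)} {τ : Fm} {j : A} (hw : Valid σ D w) (hj : σ.pt τ j = j)
    {P : List (A × D.E)} (h : P ∈ Ch D w τ j) : Valid σ D P ∧ lfam D P = some τ := by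
  obtain ⟨ε, rfl, h1, rfl, h3⟩ := mem_Ch.1 h
  exact ⟨⟨hw, h1, hj, h3⟩, rfl⟩

theorem Ch_ne (hD : Full D) {w : List (A × D.E)} {τ : Fm} {j : A}
    (h : ¬ (j = 1 ∧ lfam D w = some τ)) : Ch D w τ j ≠ [] := by
  obtain ⟨ε, h1, h2⟩ := hD (typ D w) τ
  have : ((j, ε) :: w) ∈ Ch D w τ j := mem_Ch.2 ⟨ε, rfl, h1, h2, by
    rintro ⟨h3, h4⟩
    exact h ⟨h3, by simp [lfam, h4, D.fam_rev, h2]⟩⟩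
  exact List.ne_nil_of_mem this

theorem mem_Ch_self {w : List (A × D.E)} {ε : D.E} {j : A} (h : Valid σ D ((j, ε) :: w)) :
    ((j, ε) :: w) ∈ Ch D w (D.fam ε) j := mem_Ch.2 ⟨ε, rfl, h.2.1, rfl, h.2.2.2⟩

variable (σ D) in
structure GInv (u : List (A × Fm)) : Prop where
  v : Valid σ D (FF σ D u).1
  l : lfam D (FF σ D u).1 = lastE (stdDat Fm) u
  ev : ∀ P ∈ (FF σ D u).2, Valid σ D P ∧ lfam D P = lastE (stdDat Fm) u
  len : (FF σ D u).2.length ≤ bK D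
  nd : (FF σ D u).2.Nodup

theorem exx_len {u : List (A × Fm)} {τ : Fm} (h : GInv σ D u) :
    (exx σ D u τ).length ≤ bK D := by
  unfold exx
  split_ifs
  · exact h.len
  · simp

theorem exx_mem {u : List (A × Fm)} {τ : Fm} {P : List (A × D.E)} (h : P ∈ exx σ D u τ) :
    lastE (stdDat Fm) u = some τ ∧ P ∈ (FF σ D u).2 := by
  unfold exx at h
  split_ifs at h with h1
  · exact ⟨h1, h⟩
  · simp at h

theorem std_red {j : A} {τ : Fm} {u : List (A × Fm)} (hD : Full D) (hi : GInv σ D u)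
    (hu : Valid σ (stdDat Fm) ((j, τ) :: u)) : Ch D (FF σ D u).1 τ j ≠ [] := by
  refine Ch_ne hD ?_
  rintro ⟨h1, h2⟩
  rw [hi.l] at h2
  exact hu.2.2.2 ⟨h1, h2⟩

theorem tail_ne {w : List (A × D.E)} {τ τ' : Fm} {j j' : A} {P N : List (A × D.E)}
    (hN : N ∈ Ch D w τ' j') (h : P ∈ Ch D N τ j) (h' : P.tail = w) : False := by
  obtain ⟨ε, rfl, _⟩ := mem_Ch.1 h
  obtain ⟨ε', rfl, _⟩ := mem_Ch.1 hN
  have := congrArg List.length h'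
  simp at this

theorem ginv (hD : Full D) (u : List (A × Fm)) (hu : Valid σ (stdDat Fm) u) : GInv σ D u := by
  induction u with
  | nil => exact ⟨trivial, rfl, by simp [FF], by simp [FF], by simp [FF]⟩
  | cons p u ih =>
    obtain ⟨j, τ⟩ := p
    have hi := ih hu.1
    have hj : σ.pt τ j = j := hu.2.2.1
    by_cases h : idx σ D τ j < (exx σ D u τ).length
    · obtain ⟨h1, h2⟩ := FF_lt σ D h
      have hm := exx_mem (List.getElem_mem h)
      obtain ⟨hv, hl⟩ := hi.ev _ hm.2
      rw [hm.1] at hl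
      refine ⟨by rw [h1]; exact hv, by rw [h1, hl]; rfl, ?_, ?_, ?_⟩
      · intro P hP
        rw [h2] at hP
        exact Ch_valid hv (σ.pt_one τ) hP
      · rw [h2]; exact (Ch_length D _ _ _).trans (by unfold bK; omega)
      · rw [h2]; exact Ch_nodup D _ _ _
    · obtain ⟨N, t, hc, h1, h2⟩ := FF_ge σ D h (std_red hD hi hu)
      have hN : N ∈ Ch D (FF σ D u).1 τ j := by rw [hc]; simp
      have ht : ∀ P ∈ t, P ∈ Ch D (FF σ D u).1 τ j := fun P hP => by rw [hc]; simp [hP]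
      have hNv := Ch_valid hi.v hj hN
      have hnd := Ch_nodup D (FF σ D u).1 τ j
      have hln := Ch_length D (FF σ D u).1 τ j
      rw [hc] at hnd hln
      refine ⟨by rw [h1]; exact hNv.1, by rw [h1, hNv.2]; rfl, ?_, ?_, ?_⟩
      · intro P hP
        rw [h2, List.mem_append, List.mem_append] at hP
        rcases hP with hP | hP | hP
        · exact Ch_valid hi.v hj (ht P hP)
        · split_ifs at hP
          · exact Ch_valid hi.v (pt_io σ τ _) hP
          · simp at hP
        · exact Ch_valid hNv.1 (σ.pt_one τ) hP
      · rw [h2]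
        have a1 := Ch_length D N τ (1 : A)
        have a2 := Ch_length D (FF σ D u).1 τ (io σ τ (idx σ D τ j - bK D))
        simp only [List.length_append, List.length_cons] at hln ⊢
        unfold bK at a2 ⊢
        split_ifs <;> simp <;> omega
      · rw [h2]
        refine List.Nodup.append (List.nodup_cons.1 hnd).2 (List.Nodup.append ?_ ?_ ?_) ?_
        · split_ifs
          · exact Ch_nodup D _ _ _
          · simp
        · exact Ch_nodup D _ _ _
        · intro P hP hP'
          split_ifs at hP
          · obtain ⟨ε, rfl, _⟩ := mem_Ch.1 hP
            exact tail_ne hN hP' rfl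
          · simp at hP
        · intro P hP hP'
          obtain ⟨ε, rfl, _⟩ := mem_Ch.1 (ht P hP)
          rcases List.mem_append.1 hP' with hP' | hP'
          · split_ifs at hP' with hif
            · obtain ⟨ε', h3, _⟩ := mem_Ch.1 hP'
              simp only [List.cons.injEq, Prod.mk.injEq, and_true] at h3
              have h4 := idx_lt hif.2.1
              rw [h3.1] at h4
              have h5 := io_inj h4
              rw [← h3.1] at h5
              have := exx_len (τ := τ) hi
              omega
            · simp at hP'
          · exact tail_ne hN hP' rfl

/-- location -/
def loc (σ : Sig A Fm) (D : Dat Fm) (u : List (A × Fm)) : List (A × D.E) → List (A × Fm)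
  | [] => []
  | (j, ε) :: w =>
    if j = 1 ∧ lastE (stdDat Fm) u = some (D.fam ε) then
      (io σ (D.fam ε) ((FF σ D u).2.idxOf ((j, ε) :: w)), D.fam ε) :: u
    else if idx σ D (D.fam ε) j < (exx σ D u (D.fam ε)).length then
      (io σ (D.fam ε) ((FF σ D ((io σ (D.fam ε) (idx σ D (D.fam ε) j + bK D), D.fam ε) :: u)).2.idxOf
        ((j, ε) :: w)), D.fam ε) :: (io σ (D.fam ε) (idx σ D (D.fam ε) j + bK D), D.fam ε) :: u
    else if (FF σ D ((j, D.fam ε) :: u)).1 = (j, ε) :: w then (j, D.fam ε) :: u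
    else (io σ (D.fam ε) ((FF σ D ((j, D.fam ε) :: u)).2.idxOf ((j, ε) :: w)), D.fam ε) ::
      (j, D.fam ε) :: u

theorem std_valid_io {u : List (A × Fm)} (hu : Valid σ (stdDat Fm) u) (τ : Fm) (n : ℕ) :
    Valid σ (stdDat Fm) ((io σ τ n, τ) :: u) :=
  ⟨hu, rfl, pt_io σ τ n, fun h => io_ne σ τ n h.1⟩

/-- one-letter extension by slot -/
theorem FF_slot {u : List (A × Fm)} {τ : Fm} (hi : GInv σ D u)
    (hl : lastE (stdDat Fm) u = some τ) {P : List (A × D.E)} (hP : P ∈ (FF σ D u).2) :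
    (FF σ D ((io σ τ ((FF σ D u).2.idxOf P), τ) :: u)).1 = P := by
  have hlt : (FF σ D u).2.idxOf P < (FF σ D u).2.length := List.idxOf_lt_length_iff.2 hP
  have hK := hi.len
  have hex : exx σ D u τ = (FF σ D u).2 := if_pos hl
  have hidx : idx σ D τ (io σ τ ((FF σ D u).2.idxOf P)) = (FF σ D u).2.idxOf P :=
    idx_io σ D τ (by omega)
  obtain ⟨h1, _⟩ := FF_lt σ D (u := u) (τ := τ) (j := io σ τ ((FF σ D u).2.idxOf P))
    (by rw [hidx, hex]; exact hlt)
  rw [h1]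
  simp [hidx, hex]

variable (σ D) in
/-- the structure of `loc` : either one letter or two letters -/
theorem loc_cases (hD : Full D) {u : List (A × Fm)} (hu : Valid σ (stdDat Fm) u) {j : A} {ε : D.E}
    (hP : Valid σ D ((j, ε) :: (FF σ D u).1)) :
    (j = 1 ∧ lastE (stdDat Fm) u = some (D.fam ε) ∧ ((j, ε) :: (FF σ D u).1) ∈ (FF σ D u).2 ∧
      loc σ D u ((j, ε) :: (FF σ D u).1) = (io σ (D.fam ε) ((FF σ D u).2.idxOf
        ((j, ε) :: (FF σ D u).1)), D.fam ε) :: u) ∨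
    (∃ n < bK D, j = io σ (D.fam ε) n ∧
      ((j, ε) :: (FF σ D u).1) ∈ (FF σ D ((io σ (D.fam ε) (n + bK D), D.fam ε) :: u)).2 ∧
      loc σ D u ((j, ε) :: (FF σ D u).1) =
        (io σ (D.fam ε) ((FF σ D ((io σ (D.fam ε) (n + bK D), D.fam ε) :: u)).2.idxOf
          ((j, ε) :: (FF σ D u).1)), D.fam ε) :: (io σ (D.fam ε) (n + bK D), D.fam ε) :: u) ∨
    (Valid σ (stdDat Fm) ((j, D.fam ε) :: u) ∧
      (FF σ D ((j, D.fam ε) :: u)).1 = (j, ε) :: (FF σ D u).1 ∧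
      loc σ D u ((j, ε) :: (FF σ D u).1) = (j, D.fam ε) :: u) ∨
    (Valid σ (stdDat Fm) ((j, D.fam ε) :: u) ∧
      ((j, ε) :: (FF σ D u).1) ∈ (FF σ D ((j, D.fam ε) :: u)).2 ∧
      loc σ D u ((j, ε) :: (FF σ D u).1) =
        (io σ (D.fam ε) ((FF σ D ((j, D.fam ε) :: u)).2.idxOf ((j, ε) :: (FF σ D u).1)), D.fam ε)
          :: (j, D.fam ε) :: u) := by
  have hi := ginv hD u hu
  set w := (FF σ D u).1 with hw
  set τ := D.fam ε with hτ
  have hmem := mem_Ch_self hP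
  rw [← hτ] at hmem
  have hpj : σ.pt τ j = j := hP.2.2.1
  by_cases h1 : j = 1 ∧ lastE (stdDat Fm) u = some τ
  · left
    refine ⟨h1.1, h1.2, ?_, by rw [loc, ← hτ, if_pos h1]⟩
    obtain ⟨h1, h2⟩ := h1
    subst h1
    cases u with
    | nil => simp [lastE] at h2
    | cons p u' =>
      obtain ⟨j', τ'⟩ := p
      have : τ' = τ := Option.some.inj h2
      subst this
      by_cases h : idx σ D τ j' < (exx σ D u' τ).length
      · obtain ⟨h1, h2⟩ := FF_lt σ D h
        rw [h2, ← h1]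
        exact hmem
      · obtain ⟨N, t, hc, h1, h2⟩ := FF_ge σ D h (std_red hD (ginv hD u' hu.1) hu)
        rw [h2, List.mem_append, List.mem_append, ← h1]
        exact Or.inr (Or.inr hmem)
  · right
    have hex := exx_len (τ := τ) hi
    by_cases h2 : idx σ D τ j < (exx σ D u τ).length
    · left
      have hji : io σ τ (idx σ D τ j) = j := idx_lt (by omega)
      refine ⟨idx σ D τ j, by omega, hji.symm, ?_, by rw [loc, ← hτ, if_neg h1, if_pos h2]⟩
      have hii : idx σ D τ (io σ τ (idx σ D τ j + bK D)) = idx σ D τ j + bK D :=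
        idx_io σ D τ (by omega)
      obtain ⟨N, t, hc, h3, h4⟩ := FF_ge σ D (u := u) (τ := τ)
        (j := io σ τ (idx σ D τ j + bK D)) (by rw [hii]; omega)
        (std_red hD hi (std_valid_io hu τ _))
      rw [h4, List.mem_append, List.mem_append]
      right; left
      rw [hii, if_pos (by refine ⟨?_, ?_, ?_⟩ <;> omega), Nat.add_sub_cancel, hji]
      exact hmem
    · right
      have hv : Valid σ (stdDat Fm) ((j, τ) :: u) := ⟨hu, rfl, hpj, h1⟩
      by_cases h3 : (FF σ D ((j, τ) :: u)).1 = (j, ε) :: w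
      · left
        exact ⟨hv, h3, by rw [loc, ← hτ, if_neg h1, if_neg h2, if_pos h3]⟩
      · right
        refine ⟨hv, ?_, by rw [loc, ← hτ, if_neg h1, if_neg h2, if_neg h3]⟩
        obtain ⟨N, t, hc, h4, h5⟩ := FF_ge σ D h2 (std_red hD hi hv)
        rw [hw, hc] at hmem
        rcases List.mem_cons.1 hmem with h6 | h6
        · exact absurd (h4.trans h6.symm) h3
        · rw [h5, List.mem_append]
          exact Or.inl h6

theorem FF_loc (hD : Full D) {u : List (A × Fm)} (hu : Valid σ (stdDat Fm) u) {j : A} {ε : D.E}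
    (hP : Valid σ D ((j, ε) :: (FF σ D u).1)) :
    (FF σ D (loc σ D u ((j, ε) :: (FF σ D u).1))).1 = (j, ε) :: (FF σ D u).1 ∧
    Valid σ (stdDat Fm) (loc σ D u ((j, ε) :: (FF σ D u).1)) := by
  rcases loc_cases σ D hD hu hP with ⟨h1, h2, h3, h4⟩ | ⟨n, h1, h2, h3, h4⟩ | ⟨h1, h2, h3⟩ |
    ⟨h1, h2, h3⟩
  · exact ⟨by rw [h4]; exact FF_slot (ginv hD u hu) h2 h3, h4 ▸ std_valid_io hu _ _⟩
  · have := std_valid_io (σ := σ) hu (D.fam ε) (n + bK D)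
    exact ⟨by rw [h4]; exact FF_slot (ginv hD _ this) rfl h3, h4 ▸ std_valid_io this _ _⟩
  · exact ⟨by rw [h3]; exact h2, h3 ▸ h1⟩
  · exact ⟨by rw [h3]; exact FF_slot (ginv hD _ h1) rfl h2, h3 ▸ std_valid_io h1 _ _⟩

/-- origin lemma -/
theorem origin (hD : Full D) {v : List (A × Fm)} (hv : Valid σ (stdDat Fm) v) (hne : v ≠ []) :
    ∃ o, o.length < v.length ∧ Valid σ (stdDat Fm) o ∧
      (∃ j ε, (FF σ D v).1 = (j, ε) :: (FF σ D o).1) ∧ v = loc σ D o (FF σ D v).1 := by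
  obtain ⟨⟨j, τ⟩, u, rfl⟩ := List.exists_cons_of_ne_nil hne
  have hu := hv.1
  have hi := ginv hD u hu
  by_cases h : idx σ D τ j < (exx σ D u τ).length
  · obtain ⟨h1, -⟩ := FF_lt σ D h
    obtain ⟨hl, hP⟩ := exx_mem (List.getElem_mem h)
    have hji : io σ τ (idx σ D τ j) = j := idx_lt (by have := exx_len (τ := τ) hi; omega)
    have hidx : (FF σ D u).2.idxOf ((exx σ D u τ)[idx σ D τ j]) = idx σ D τ j := by
      have hex : exx σ D u τ = (FF σ D u).2 := if_pos hl
      simp only [hex]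
      rw [List.Nodup.idxOf_getElem hi.nd]
    rw [h1]
    set P := (exx σ D u τ)[idx σ D τ j] with hPd
    have case1 : P ∈ Ch D (FF σ D u).1 τ 1 → ∃ o : List (A × Fm), o.length < ((j, τ) :: u).length ∧
        Valid σ (stdDat Fm) o ∧ (∃ j ε, P = (j, ε) :: (FF σ D o).1) ∧
        (j, τ) :: u = loc σ D o P := by
      intro hc
      obtain ⟨ε, h3, h4, rfl, h6⟩ := mem_Ch.1 hc
      refine ⟨u, by simp only [List.length_cons]; omega, hu, ⟨1, ε, h3⟩, ?_⟩
      rw [h3, loc, if_pos ⟨rfl, hl⟩, ← h3, hidx, hji]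
    cases u with
    | nil => simp [lastE] at hl
    | cons p u' =>
      obtain ⟨j', τ'⟩ := p
      have : τ' = τ := Option.some.inj hl
      subst this
      have hi' := ginv hD u' hu.1
      by_cases h' : idx σ D τ' j' < (exx σ D u' τ').length
      · obtain ⟨h3, h4⟩ := FF_lt σ D h'
        apply case1
        rw [h3, ← h4]
        exact hP
      · obtain ⟨N, t, hc, h3, h4⟩ := FF_ge σ D h' (std_red hD hi' hu)
        have hP' := hP
        rw [h4, List.mem_append, List.mem_append] at hP'
        have hnd := Ch_nodup D (FF σ D u').1 τ' j'
        rw [hc] at hnd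
        rcases hP' with hP' | hP' | hP'
        · have hPc : P ∈ Ch D (FF σ D u').1 τ' j' := by rw [hc]; simp [hP']
          obtain ⟨ε, h5, h6, rfl, h8⟩ := mem_Ch.1 hPc
          refine ⟨u', by simp only [List.length_cons]; omega, hu.1, ⟨j', ε, h5⟩, ?_⟩
          rw [h5, loc, if_neg (show ¬ (j' = 1 ∧ lastE (stdDat Fm) u' = some (D.fam ε)) from hu.2.2.2), if_neg h', if_neg, ← h5, hidx, hji]
          rw [h3, ← h5]
          rintro rfl
          exact (List.nodup_cons.1 hnd).1 hP'
        · split_ifs at hP' with hif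
          · obtain ⟨ε, h5, h6, rfl, h8⟩ := mem_Ch.1 hP'
            refine ⟨u', by simp only [List.length_cons]; omega, hu.1, ⟨_, ε, h5⟩, ?_⟩
            have hii : idx σ D (D.fam ε) (io σ (D.fam ε) (idx σ D (D.fam ε) j' - bK D)) =
              idx σ D (D.fam ε) j' - bK D := idx_io σ D _ (by omega)
            have hj' : io σ (D.fam ε) (idx σ D (D.fam ε) j') = j' := idx_lt hif.2.1
            rw [h5, loc, if_neg (fun h => io_ne σ _ _ h.1), if_pos (by rw [hii]; exact hif.2.2),
              ← h5, hii, Nat.sub_add_cancel hif.1, hj', hidx, hji]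
          · simp at hP'
        · rw [← h3] at hP'
          exact case1 hP'
  · obtain ⟨N, t, hc, h1, h2⟩ := FF_ge σ D h (std_red hD hi hv)
    have hN : N ∈ Ch D (FF σ D u).1 τ j := by rw [hc]; simp
    obtain ⟨ε, h3, h4, rfl, h6⟩ := mem_Ch.1 hN
    refine ⟨u, by simp only [List.length_cons]; omega, hu, ⟨j, ε, by rw [h1, h3]⟩, ?_⟩
    rw [h1, h3, loc, if_neg (show ¬ (j = 1 ∧ lastE (stdDat Fm) u = some (D.fam ε)) from hv.2.2.2), if_neg h, if_pos (h1.trans h3)]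

variable (σ D) in
def GG : List (A × D.E) → List (A × Fm)
  | [] => []
  | p :: w => loc σ D (GG w) (p :: w)

theorem FG (hD : Full D) (w : List (A × D.E)) (hw : Valid σ D w) :
    (FF σ D (GG σ D w)).1 = w ∧ Valid σ (stdDat Fm) (GG σ D w) := by
  induction w with
  | nil => exact ⟨rfl, trivial⟩
  | cons p w ih =>
    obtain ⟨h1, h2⟩ := ih hw.1
    obtain ⟨j, ε⟩ := p
    have := FF_loc hD h2 (j := j) (ε := ε) (by rw [h1]; exact hw)
    rw [h1] at this
    exact this

theorem GF (hD : Full D) (n : ℕ) (v : List (A × Fm)) (hn : v.length ≤ n)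
    (hv : Valid σ (stdDat Fm) v) : GG σ D (FF σ D v).1 = v := by
  induction n generalizing v with
  | zero =>
    have : v = [] := List.length_eq_zero_iff.1 (by omega)
    subst this; rfl
  | succ n ih =>
    by_cases hne : v = []
    · subst hne; rfl
    · obtain ⟨o, h1, h2, ⟨j, ε, h3⟩, h4⟩ := origin hD hv hne
      have h5 := ih o (by omega) h2
      rw [h3, GG, h5, ← h3]
      exact h4.symm

/-- bounded powers -/
theorem near_pow {X : Set A} (hX : Subgroup.closure X = ⊤) (σ : Sig A Fm) (n : ℕ) :
    ∃ B, ∀ (τ : Fm) (m : ℕ), m ≤ n → ∀ c, Near (Cay X) B c (c * σ.u τ ^ m) := by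
  obtain ⟨B, hB⟩ := near_gen hX
    ((Finset.univ ×ˢ Finset.range (n + 1)).image (fun p : Fm × ℕ => σ.u p.1 ^ p.2))
  refine ⟨B, fun τ m hm c => hB _ ?_ c⟩
  exact Finset.mem_image.2 ⟨(τ, m), by simp; omega, rfl⟩

theorem near_io {X : Set A} {B n : ℕ} (hB : ∀ (τ : Fm) (m : ℕ), m ≤ n → ∀ c, Near (Cay X) B c
    (c * σ.u τ ^ m)) {D' : Dat Fm} {w : List (A × D'.E)} (hw : Valid σ D' w) {τ : Fm} {m : ℕ}
    (hm : m < n) {c : A} (hc : σ.pt τ c = 1) :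
    Near (StepR σ D' X) B (w, c) (w, io σ τ m * c) := by
  rw [io, σ.pow_comm τ _ hc]
  exact near_cay (hB τ _ hm c) hw

theorem exx_near (hD : Full D) {X : Set A} {B : ℕ} (hB : ∀ (τ : Fm) (m : ℕ), m ≤ 2 * bK D →
    ∀ c, Near (Cay X) B c (c * σ.u τ ^ m)) {u : List (A × Fm)} (hu : Valid σ (stdDat Fm) u)
    {τ : Fm} {c : A} (hc : σ.pt τ c = 1) (hl : lastE (stdDat Fm) u = some τ)
    {P : List (A × D.E)} (hP : P ∈ (FF σ D u).2) :
    Near (StepR σ D X) (2 * B + 2) (P, c) ((FF σ D u).1, c) := by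
  cases u with
  | nil => simp [lastE] at hl
  | cons p u =>
    obtain ⟨j, τ'⟩ := p
    have : τ' = τ := Option.some.inj hl
    subst this
    have hi := ginv hD u hu.1
    have hii := ginv hD _ hu
    have down : ∀ {w : List (A × D.E)} {j : A} {P : List (A × D.E)}, Valid σ D w →
        σ.pt τ' j = j → P ∈ Ch D w τ' j → Near (StepR σ D X) 1 (w, j * c) (P, c) := by
      intro w j P hw hj hP
      have hv := (Ch_valid hw hj hP).1
      obtain ⟨ε, rfl, -, rfl, -⟩ := mem_Ch.1 hP
      exact near_down hv hc
    have case1 : P ∈ Ch D (FF σ D ((j, τ') :: u)).1 τ' 1 →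
        Near (StepR σ D X) (2 * B + 2) (P, c) ((FF σ D ((j, τ') :: u)).1, c) := by
      intro h
      have := (down hii.v (σ.pt_one _) h).symm
      rw [one_mul] at this
      exact this.mono (by omega)
    by_cases h : idx σ D τ' j < (exx σ D u τ').length
    · obtain ⟨h3, h4⟩ := FF_lt σ D h
      apply case1
      rw [h3, ← h4]
      exact hP
    · obtain ⟨N, t, hcc, h3, h4⟩ := FF_ge σ D h (std_red hD hi hu)
      have hN : N ∈ Ch D (FF σ D u).1 τ' j := by rw [hcc]; simp
      rw [h4, List.mem_append, List.mem_append] at hP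
      rcases hP with hP | hP | hP
      · have hPc : P ∈ Ch D (FF σ D u).1 τ' j := by rw [hcc]; simp [hP]
        rw [h3]
        exact ((down hi.v hu.2.2.1 hPc).symm.trans (down hi.v hu.2.2.1 hN)).mono (by omega)
      · split_ifs at hP with hif
        · have hj : io σ τ' (idx σ D τ' j) = j := idx_lt hif.2.1
          have e1 := near_io hB hi.v (m := idx σ D τ' j) hif.2.1 hc
          have e2 := near_io hB hi.v (m := idx σ D τ' j - bK D) (by omega) hc
          rw [hj] at e1
          rw [h3]
          exact ((((down hi.v (pt_io σ _ _) hP).symm.trans e2.symm).trans e1).trans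
            (down hi.v hu.2.2.1 hN)).mono (by omega)
        · simp at hP
      · rw [← h3] at hP
        exact case1 hP

theorem GW (hD : Full D) {X : Set A} (hX : Subgroup.closure X = ⊤) :
    CE (Step σ D X) (Step σ (stdDat Fm) X) := by
  obtain ⟨B, hB⟩ := near_pow hX σ (2 * bK D)
  refine ⟨fun m => ⟨(GG σ D m.1.1, m.1.2), (FG hD _ m.2).2⟩,
    fun m => ⟨((FF σ D m.1.1).1, m.1.2), (ginv hD _ m.2).v⟩, 4 * B + 4, ?_, ?_, ?_, ?_⟩
  · rintro ⟨m, hm⟩ ⟨m', hm'⟩ h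
    refine near_raw ?_ _ _
    unfold Step at h
    simp only at h
    have hm0 := hm
    cases h with
    | mul w a x h1 h2 =>
      exact (Near.one (StepR.mul _ a x (FG hD w h1).2 h2)).mono (by omega)
    | down j ε w c h1 h2 =>
      obtain ⟨g1, g2⟩ := FG hD w h1.1
      have hgg : GG σ D ((j, ε) :: w) = loc σ D (GG σ D w) ((j, ε) :: (FF σ D (GG σ D w)).1) := by
        rw [g1]; rfl
      rw [hgg]
      have hi := ginv hD _ g2
      have slot : ∀ {v : List (A × Fm)} {P : List (A × D.E)}, Valid σ (stdDat Fm) v →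
          lastE (stdDat Fm) v = some (D.fam ε) → P ∈ (FF σ D v).2 →
          Near (StepR σ (stdDat Fm) X) (B + 1) (v, c) ((io σ (D.fam ε) ((FF σ D v).2.idxOf P),
            D.fam ε) :: v, c) := by
        intro v P hv hl hP
        have hlt : (FF σ D v).2.idxOf P < (FF σ D v).2.length := List.idxOf_lt_length_iff.2 hP
        have hK := (ginv hD v hv).len
        have e1 := near_io hB hv (m := (FF σ D v).2.idxOf P) (by omega) h2
        exact e1.trans (near_down (D := stdDat Fm) (std_valid_io hv _ _) h2)
      rcases loc_cases σ D hD g2 (j := j) (ε := ε) (by rw [g1]; exact h1) with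
        ⟨k1, k2, k3, k4⟩ | ⟨n, k1, k2, k3, k4⟩ | ⟨k1, k2, k3⟩ | ⟨k1, k2, k3⟩
      · rw [k4]
        subst k1
        simp only [one_mul]
        exact (slot g2 k2 k3).mono (by omega)
      · rw [k4]
        have e0 := std_valid_io (σ := σ) g2 (D.fam ε) (n + bK D)
        have e1 := slot e0 rfl k3
        have e2 := near_down (X := X) (D := stdDat Fm) e0 h2
        have e3 := near_io hB g2 (m := n + bK D) (by omega) h2
        have e4 := near_io hB g2 (m := n) (by omega) h2
        rw [← k2] at e4
        exact (((e4.symm.trans e3).trans e2).trans e1).mono (by omega)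
      · rw [k3]
        exact (near_down (D := stdDat Fm) k1 h2).mono (by omega)
      · rw [k3]
        exact ((near_down (D := stdDat Fm) k1 h2).trans (slot k1 rfl k2)).mono (by omega)
  · rintro ⟨m, hm⟩ ⟨m', hm'⟩ h
    refine near_raw ?_ _ _
    unfold Step at h
    simp only at h
    cases h with
    | mul w a x h1 h2 =>
      exact (Near.one (StepR.mul _ a x (ginv hD w h1).v h2)).mono (by omega)
    | down j τ u c h1 h2 =>
      have hi := ginv hD u h1.1
      have h2' : σ.pt τ c = 1 := h2
      by_cases h : idx σ D τ j < (exx σ D u τ).length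
      · obtain ⟨k1, -⟩ := FF_lt σ D h
        obtain ⟨hl, hP⟩ := exx_mem (List.getElem_mem h)
        have hex := exx_len (τ := τ) hi
        have hji : io σ τ (idx σ D τ j) = j := idx_lt (by omega)
        have e1 := near_io hB hi.v (m := idx σ D τ j) (by omega) h2'
        rw [hji] at e1
        have e2 := exx_near hD hB h1.1 h2' hl hP
        simp only [k1]
        exact (e1.symm.trans e2.symm).mono (by omega)
      · obtain ⟨N, t, hc, k1, -⟩ := FF_ge σ D h (std_red hD hi h1)
        have hN : N ∈ Ch D (FF σ D u).1 τ j := by rw [hc]; simp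
        have hv := (Ch_valid hi.v h1.2.2.1 hN).1
        simp only [k1]
        obtain ⟨ε, rfl, -, rfl, -⟩ := mem_Ch.1 hN
        exact (near_down hv h2').mono (by omega)
  · rintro ⟨⟨w, a⟩, hm⟩
    simp only [(FG hD w hm).1]
    exact Near.refl _ _
  · rintro ⟨⟨w, a⟩, hm⟩
    simp only [GF hD _ w le_rfl hm]
    exact Near.refl _ _
end GW

section cross
open Classical
variable {A : Type} [Group A] {Fm : Type} (σ : Sig A Fm) (D : Dat Fm)

def cr (ε : D.E) : List (A × D.E) × A → List (A × D.E) × A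
  | ([], a) => ([(σ.pt (D.fam ε) a, ε)], (σ.pt (D.fam ε) a)⁻¹ * a)
  | (p :: w, a) => if σ.pt (D.fam ε) a = 1 ∧ p.2 = D.rev ε then (w, p.1 * a) else
      ((σ.pt (D.fam ε) a, ε) :: p :: w, (σ.pt (D.fam ε) a)⁻¹ * a)

theorem tgt_rev (ε : D.E) : D.tgt (D.rev ε) = D.src ε := by
  rw [← D.src_rev, D.rev_rev]

variable {σ D} in
theorem cr_cases {ε : D.E} {m : List (A × D.E) × A} (hm : Valid σ D m.1)
    (ht : typ D m.1 = D.src ε) :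
    (∃ j w a, σ.pt (D.fam ε) a = 1 ∧ m = ((j, D.rev ε) :: w, a) ∧ cr σ D ε m = (w, j * a)) ∨
    (Valid σ D ((σ.pt (D.fam ε) m.2, ε) :: m.1) ∧
      cr σ D ε m = ((σ.pt (D.fam ε) m.2, ε) :: m.1, (σ.pt (D.fam ε) m.2)⁻¹ * m.2)) := by
  obtain ⟨w, a⟩ := m
  cases w with
  | nil => exact Or.inr ⟨⟨hm, ht.symm, σ.h1 _ _, by simp [lastE]⟩, rfl⟩
  | cons p w =>
    by_cases h : σ.pt (D.fam ε) a = 1 ∧ p.2 = D.rev ε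
    · exact Or.inl ⟨p.1, w, a, h.1, by simp [← h.2], by rw [cr, if_pos h]⟩
    · refine Or.inr ⟨⟨hm, ht.symm, σ.h1 _ _, ?_⟩, by rw [cr, if_neg h]⟩
      simpa [lastE] using h

variable {σ D} in
theorem cr_valid {ε : D.E} {m : List (A × D.E) × A} (hm : Valid σ D m.1)
    (ht : typ D m.1 = D.src ε) :
    Valid σ D (cr σ D ε m).1 ∧ typ D (cr σ D ε m).1 = D.tgt ε := by
  rcases cr_cases hm ht with ⟨j, w, a, h1, rfl, h3⟩ | ⟨h1, h2⟩
  · rw [h3]; exact ⟨hm.1, by rw [← D.src_rev]; exact hm.2.1.symm⟩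
  · rw [h2]; exact ⟨h1, rfl⟩

variable {σ D} in
theorem cr_near {ε : D.E} {m : List (A × D.E) × A} (hm : Valid σ D m.1)
    (ht : typ D m.1 = D.src ε) (X : Set A) : Near (StepR σ D X) 1 m (cr σ D ε m) := by
  rcases cr_cases hm ht with ⟨j, w, a, h1, rfl, h3⟩ | ⟨h1, h2⟩
  · rw [h3]; exact (near_down hm (by rw [D.fam_rev]; exact h1)).symm
  · rw [h2]
    have := near_down (X := X) h1 (σ.h2 _ m.2)
    rwa [mul_inv_cancel_left] at this

variable {σ D} in
theorem cr_cr {ε : D.E} {m : List (A × D.E) × A} (hm : Valid σ D m.1)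
    (ht : typ D m.1 = D.src ε) : cr σ D (D.rev ε) (cr σ D ε m) = m := by
  rcases cr_cases hm ht with ⟨j, w, a, h1, rfl, h3⟩ | ⟨h1, h2⟩
  · rw [h3]
    have hj : σ.pt (D.fam (D.rev ε)) (j * a) = j := by
      rw [σ.h3 _ _ _ (by rw [D.fam_rev]; exact h1)]; exact hm.2.2.1
    rcases cr_cases (ε := D.rev ε) (m := (w, j * a)) hm.1 hm.2.1.symm with
      ⟨j', w', a', k1, k2, k3⟩ | ⟨k1, k2⟩
    · simp only [Prod.mk.injEq] at k2
      rw [k2.2] at hj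
      rw [hj] at k1
      exact absurd ⟨k1, by rw [k2.1]; rfl⟩ hm.2.2.2
    · rw [k2]; simp [hj]
  · rw [h2]
    rw [cr, if_pos ⟨by rw [D.fam_rev]; exact σ.h2 _ _, (D.rev_rev ε).symm⟩]
    simp

variable {σ D} in
theorem cr_mul {ε : D.E} {m : List (A × D.E) × A} {c : A} (hc : σ.pt (D.fam ε) c = 1) :
    cr σ D ε (m.1, m.2 * c) = ((cr σ D ε m).1, (cr σ D ε m).2 * c) := by
  obtain ⟨w, a⟩ := m
  cases w with
  | nil => simp [cr, σ.h3 _ _ _ hc, mul_assoc]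
  | cons p w =>
    simp only [cr, σ.h3 _ _ _ hc]
    split_ifs <;> simp [mul_assoc]

abbrev Mt (s : D.S) : Type := {m : MM σ D // typ D m.1.1 = s}

def crM (ε : D.E) (s s' : D.S) (h : D.src ε = s) (h' : D.tgt ε = s') (m : Mt σ D s) : Mt σ D s' :=
  ⟨⟨cr σ D ε m.1.1, (cr_valid m.1.2 (m.2.trans h.symm)).1⟩,
    (cr_valid m.1.2 (m.2.trans h.symm)).2.trans h'⟩

theorem Mt_ext {s : D.S} {m m' : Mt σ D s} (h : m.1.1 = m'.1.1) : m = m' :=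
  Subtype.ext (Subtype.ext h)

def crE (ε : D.E) (s s' : D.S) (h : D.src ε = s) (h' : D.tgt ε = s') :
    Mt σ D s ≃ Mt σ D s' where
  toFun := crM σ D ε s s' h h'
  invFun := crM σ D (D.rev ε) s' s (by rw [D.src_rev, h']) (by rw [tgt_rev, h])
  left_inv m := Mt_ext σ D (cr_cr m.1.2 (m.2.trans h.symm))
  right_inv m := by
    apply Mt_ext
    have := cr_cr (ε := D.rev ε) m.1.2 (by rw [m.2, D.src_rev, h'])
    rw [D.rev_rev] at this
    exact this

def muE (s : D.S) (a : A) : Mt σ D s ≃ Mt σ D s where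
  toFun m := ⟨⟨(m.1.1.1, m.1.1.2 * a), m.1.2⟩, m.2⟩
  invFun m := ⟨⟨(m.1.1.1, m.1.1.2 * a⁻¹), m.1.2⟩, m.2⟩
  left_inv m := Mt_ext σ D (by simp)
  right_inv m := Mt_ext σ D (by simp)

theorem crE_mu (ε : D.E) (s s' : D.S) (h : D.src ε = s) (h' : D.tgt ε = s') (m : Mt σ D s) (c : A)
    (hc : σ.pt (D.fam ε) c = 1) :
    crE σ D ε s s' h h' (muE σ D s c m) = muE σ D s' c (crE σ D ε s s' h h' m) :=
  Mt_ext σ D (cr_mul (m := m.1.1) hc)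

theorem crE_near (ε : D.E) (s s' : D.S) (h : D.src ε = s) (h' : D.tgt ε = s') (m : Mt σ D s)
    (X : Set A) : Near (Step σ D X) 1 m.1 (crE σ D ε s s' h h' m).1 :=
  near_raw (cr_near m.1.2 (m.2.trans h.symm) X) _ _

theorem crE_near' (ε : D.E) (s s' : D.S) (h : D.src ε = s) (h' : D.tgt ε = s') (m : Mt σ D s')
    (X : Set A) : Near (Step σ D X) 1 m.1 ((crE σ D ε s s' h h').symm m).1 := by
  have := crE_near σ D ε s s' h h' ((crE σ D ε s s' h h').symm m) X
  rw [Equiv.apply_symm_apply] at this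
  exact this.symm
end cross

structure PreDat (Fm : Type) where
  S : Type
  J : Type
  fS : Fintype S
  fJ : Fintype J
  s0 : S
  src : J → S
  tgt : J → S
  fam : J → Fm

attribute [instance] PreDat.fS PreDat.fJ

abbrev PreDat.dat {Fm : Type} (P : PreDat Fm) (φ : Fm) : Dat Fm where
  S := P.S
  E := (P.J ⊕ P.S) × Bool
  ft := inferInstance
  s0 := P.s0
  rev ε := (ε.1, !ε.2)
  src ε := match ε with
    | (Sum.inl j, true) => P.src j
    | (Sum.inl j, false) => P.tgt j
    | (Sum.inr _, true) => P.s0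
    | (Sum.inr s, false) => s
  tgt ε := match ε with
    | (Sum.inl j, true) => P.tgt j
    | (Sum.inl j, false) => P.src j
    | (Sum.inr s, true) => s
    | (Sum.inr _, false) => P.s0
  fam ε := match ε.1 with
    | Sum.inl j => P.fam j
    | Sum.inr _ => φ
  rev_rev ε := by simp
  src_rev := by rintro ⟨_ | _, _ | _⟩ <;> rfl
  fam_rev := by rintro ⟨_ | _, _ | _⟩ <;> rfl

structure Rz {A : Type} [Group A] {Fm : Type} (σ : Sig A Fm) (P : PreDat Fm) (𝔾 : Type)
    [Group 𝔾] where
  i : P.S → A →* 𝔾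
  e : P.J → 𝔾
  z : 𝔾
  rel : ∀ j c, σ.pt (P.fam j) c = 1 → i (P.src j) c * e j = e j * i (P.tgt j) c
  gen : ∀ H : Subgroup 𝔾, (∀ s a, i s a ∈ H) → (∀ j, e j ∈ H) → z ∈ H → H = ⊤
  lift : ∀ (K : Type) [Group K] (i' : P.S → A →* K) (e' : P.J → K) (z' : K),
    (∀ j c, σ.pt (P.fam j) c = 1 → i' (P.src j) c * e' j = e' j * i' (P.tgt j) c) →
    ∃ f : 𝔾 →* K, (∀ s a, f (i s a) = i' s a) ∧ (∀ j, f (e j) = e' j) ∧ f z = z'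

section L
open Classical
variable {A : Type} [Group A] {Fm : Type} [Fintype Fm] {σ : Sig A Fm} {P : PreDat Fm} {𝔾 : Type}
    [Group 𝔾] (r : Rz σ P 𝔾) (φ : Fm)

def Rz.v (ε : (P.J ⊕ P.S) × Bool) : 𝔾 := match ε with
    | (Sum.inl j, true) => r.z⁻¹ * r.e j * r.z
    | (Sum.inl j, false) => r.z⁻¹ * (r.e j)⁻¹ * r.z
    | (Sum.inr _, true) => r.z
    | (Sum.inr _, false) => r.z⁻¹

def Rz.t (s : P.S) (a : A) : 𝔾 := r.z⁻¹ * r.i s a * r.z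

theorem Rz.t_mul (s : P.S) (a b : A) : r.t s (a * b) = r.t s a * r.t s b := by
  simp [Rz.t, mul_assoc]

theorem Rz.v_rev (ε : (P.dat φ).E) : r.v ((P.dat φ).rev ε) = (r.v ε)⁻¹ := by
  rcases ε with ⟨_ | _, _ | _⟩ <;> simp [Rz.v, PreDat.dat, mul_assoc]

theorem Rz.vrel (hφ : ∀ a, σ.pt φ a = a) (ε : (P.dat φ).E) (c : A)
    (hc : σ.pt ((P.dat φ).fam ε) c = 1) :
    r.t ((P.dat φ).src ε) c * r.v ε = r.v ε * r.t ((P.dat φ).tgt ε) c := by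
  rcases ε with ⟨j | s, b⟩
  · have h := r.rel j c hc
    cases b
    · have h' : r.i (P.tgt j) c * (r.e j)⁻¹ = (r.e j)⁻¹ * r.i (P.src j) c := by
        rw [mul_inv_eq_iff_eq_mul, mul_assoc, h, inv_mul_cancel_left]
      show r.z⁻¹ * r.i (P.tgt j) c * r.z * (r.z⁻¹ * (r.e j)⁻¹ * r.z) =
        r.z⁻¹ * (r.e j)⁻¹ * r.z * (r.z⁻¹ * r.i (P.src j) c * r.z)
      calc _ = r.z⁻¹ * (r.i (P.tgt j) c * (r.e j)⁻¹) * r.z := by group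
        _ = _ := by rw [h']; group
    · show r.z⁻¹ * r.i (P.src j) c * r.z * (r.z⁻¹ * (r.e j) * r.z) =
        r.z⁻¹ * (r.e j) * r.z * (r.z⁻¹ * r.i (P.tgt j) c * r.z)
      calc _ = r.z⁻¹ * (r.i (P.src j) c * (r.e j)) * r.z := by group
        _ = _ := by rw [h]; group
  · have : c = 1 := by rw [← hc]; exact (hφ c).symm
    subst this
    simp [Rz.t]

def Rz.pw : List (A × (P.dat φ).E) → 𝔾
  | [] => 1
  | p :: w => Rz.pw w * r.t (typ (P.dat φ) w) p.1 * r.v p.2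

def Rz.p (m : List (A × (P.dat φ).E) × A) : 𝔾 := r.pw φ m.1 * r.t (typ (P.dat φ) m.1) m.2

theorem Rz.p_mul (w : List (A × (P.dat φ).E)) (a b : A) :
    r.p φ (w, a * b) = r.p φ (w, a) * r.t (typ (P.dat φ) w) b := by
  simp only [Rz.p]
  rw [r.t_mul, mul_assoc]

theorem Rz.p_down (hφ : ∀ a, σ.pt φ a = a) (w : List (A × (P.dat φ).E)) (j : A) (ε : (P.dat φ).E)
    (c : A) (h : Valid σ (P.dat φ) ((j, ε) :: w)) (hc : σ.pt ((P.dat φ).fam ε) c = 1) :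
    r.p φ ((j, ε) :: w, c) = r.p φ (w, j * c) * r.v ε := by
  have h1 : (P.dat φ).src ε = typ (P.dat φ) w := h.2.1
  have h2 := r.vrel φ hφ ε c hc
  rw [h1] at h2
  simp only [Rz.p, Rz.pw]
  rw [r.t_mul, mul_assoc, mul_assoc, mul_assoc, mul_assoc, h2]
  rfl

theorem Rz.p_cr (hφ : ∀ a, σ.pt φ a = a) (ε : (P.dat φ).E) {m : List (A × (P.dat φ).E) × A}
    (hm : Valid σ (P.dat φ) m.1) (ht : typ (P.dat φ) m.1 = (P.dat φ).src ε) :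
    r.p φ (cr σ (P.dat φ) ε m) = r.p φ m * r.v ε := by
  rcases cr_cases hm ht with ⟨j, w, a, h1, rfl, h3⟩ | ⟨h1, h2⟩
  · rw [h3, r.p_down φ hφ _ _ _ _ hm (by rw [Dat.fam_rev]; exact h1), r.v_rev]
    simp
  · rw [h2, r.p_down φ hφ _ _ _ _ h1 (σ.h2 _ _), mul_inv_cancel_left]

abbrev Rz.N (_ : Rz σ P 𝔾) (φ : Fm) (s : P.S) : Type := Mt σ (P.dat φ) s

def Rz.lk (s : P.S) : r.N φ P.s0 ≃ r.N φ s := crE σ (P.dat φ) (Sum.inr s, true) P.s0 s rfl rfl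
def Rz.st (j : P.J) : r.N φ (P.src j) ≃ r.N φ (P.tgt j) :=
  crE σ (P.dat φ) (Sum.inl j, true) _ _ rfl rfl
def Rz.mu (s : P.S) (a : A) : r.N φ s ≃ r.N φ s := muE σ (P.dat φ) s a

theorem Rz.exists_act : ∃ f : 𝔾 →* (Equiv.Perm (r.N φ P.s0))ᵐᵒᵖ,
    (∀ s a, f (r.i s a) = MulOpposite.op ((r.lk φ s).trans ((r.mu φ s a).trans (r.lk φ s).symm))) ∧
    (∀ j, f (r.e j) = MulOpposite.op ((r.lk φ (P.src j)).trans ((r.st φ j).trans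
      (r.lk φ (P.tgt j)).symm))) ∧ f r.z = MulOpposite.op (r.lk φ P.s0) := by
  have key := r.lift (Equiv.Perm (r.N φ P.s0))ᵐᵒᵖ
    (fun s => MonoidHom.mk' (fun a => MulOpposite.op
      ((r.lk φ s).trans ((r.mu φ s a).trans (r.lk φ s).symm))) (by
        intro a b
        rw [← MulOpposite.op_mul]
        congr 1
        ext m : 1
        simp only [Equiv.trans_apply, Equiv.Perm.mul_apply, Equiv.apply_symm_apply]
        congr 1
        exact Mt_ext _ _ (by simp [Rz.mu, muE, mul_assoc])))
    (fun j => MulOpposite.op ((r.lk φ (P.src j)).trans ((r.st φ j).trans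
      (r.lk φ (P.tgt j)).symm))) (MulOpposite.op (r.lk φ P.s0)) (by
        intro j c hc
        simp only [MonoidHom.mk'_apply]
        rw [← MulOpposite.op_mul, ← MulOpposite.op_mul]
        congr 1
        ext m : 1
        simp only [Equiv.trans_apply, Equiv.Perm.mul_apply, Equiv.apply_symm_apply]
        congr 1
        exact crE_mu σ (P.dat φ) (Sum.inl j, true) _ _ rfl rfl _ c hc)
  obtain ⟨f, h1, h2, h3⟩ := key
  exact ⟨f, fun s a => by rw [h1]; rfl, h2, h3⟩

theorem Rz.p_crE (hφ : ∀ a, σ.pt φ a = a) (ε : (P.dat φ).E) (s s' : P.S)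
    (h : (P.dat φ).src ε = s) (h' : (P.dat φ).tgt ε = s') (m : r.N φ s) :
    r.p φ (crE σ (P.dat φ) ε s s' h h' m).1.1 = r.p φ m.1.1 * r.v ε :=
  r.p_cr φ hφ ε m.1.2 (m.2.trans h.symm)

theorem Rz.p_lk (hφ : ∀ a, σ.pt φ a = a) (s : P.S) (m : r.N φ P.s0) :
    r.p φ (r.lk φ s m).1.1 = r.p φ m.1.1 * r.z :=
  r.p_crE φ hφ (Sum.inr s, true) P.s0 s rfl rfl m

theorem Rz.p_lk' (hφ : ∀ a, σ.pt φ a = a) (s : P.S) (m : r.N φ s) :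
    r.p φ ((r.lk φ s).symm m).1.1 = r.p φ m.1.1 * r.z⁻¹ := by
  have := r.p_lk φ hφ s ((r.lk φ s).symm m)
  rw [Equiv.apply_symm_apply] at this
  rw [this]; group

theorem Rz.fg (r : Rz σ P 𝔾) (X : Finset A) (hX : Subgroup.closure (X : Set A) = ⊤) :
    ∃ T : Finset 𝔾, Subgroup.closure (T : Set 𝔾) = ⊤ ∧
      ∀ g ∈ T, (∃ s, ∃ x ∈ X, g = r.i s x) ∨ (∃ j, g = r.e j) ∨ g = r.z := by
  refine ⟨(Finset.univ ×ˢ X).image (fun q => r.i q.1 q.2) ∪ (Finset.univ.image r.e ∪ {r.z}),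
    r.gen _ ?_ ?_ ?_, ?_⟩
  · intro s a
    have ha : a ∈ Subgroup.closure (X : Set A) := by rw [hX]; trivial
    have : Subgroup.closure (X : Set A) ≤ Subgroup.comap (r.i s) (Subgroup.closure
      (((Finset.univ ×ˢ X).image (fun q : P.S × A => r.i q.1 q.2) ∪
        (Finset.univ.image r.e ∪ {r.z}) : Finset 𝔾) : Set 𝔾)) := by
      rw [Subgroup.closure_le]
      intro x hx
      apply Subgroup.subset_closure
      simp only [Finset.coe_union, Set.mem_union, Finset.mem_coe]
      left
      exact Finset.mem_image.2 ⟨(s, x), by simpa using hx, rfl⟩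
    exact this ha
  · intro j
    apply Subgroup.subset_closure
    simp
  · apply Subgroup.subset_closure
    simp
  · intro g hg
    simp only [Finset.mem_union, Finset.mem_image, Finset.mem_product, Finset.mem_univ, true_and,
      Finset.mem_singleton] at hg
    rcases hg with ⟨⟨s, x⟩, h, rfl⟩ | ⟨j, rfl⟩ | h
    · exact Or.inl ⟨s, x, h, rfl⟩
    · exact Or.inr (Or.inl ⟨j, rfl⟩)
    · exact Or.inr (Or.inr h)

theorem Rz.ce (r : Rz σ P 𝔾) (hφ : ∀ a, σ.pt φ a = a) (X : Finset A) (hX : Subgroup.closure (X : Set A) = ⊤) :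
    ∃ T : Finset 𝔾, Subgroup.closure (T : Set 𝔾) = ⊤ ∧
      CE (Cay (T : Set 𝔾)) (Step σ (P.dat φ) X) := by
  obtain ⟨T, hT, hT'⟩ := r.fg X hX
  obtain ⟨f, f1, f2, f3⟩ := r.exists_act φ
  let act : r.N φ P.s0 → 𝔾 → r.N φ P.s0 := fun m g => (f g).unop m
  have act_mul : ∀ m g h, act m (g * h) = act (act m g) h := fun m g h => by simp [act]
  have act_one : ∀ m, act m 1 = m := fun m => by simp [act]
  have act_i : ∀ m s a, act m (r.i s a) = (r.lk φ s).symm (r.mu φ s a (r.lk φ s m)) :=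
    fun m s a => by simp only [act, f1]; rfl
  have act_e : ∀ m j, act m (r.e j) = (r.lk φ (P.tgt j)).symm (r.st φ j (r.lk φ (P.src j) m)) :=
    fun m j => by simp only [act, f2]; rfl
  have act_z : ∀ m, act m r.z = r.lk φ P.s0 m := fun m => by simp only [act, f3]; rfl
  have act_inv : ∀ m m' g, act m g = m' → act m' g⁻¹ = m := by
    rintro m _ g rfl
    rw [← act_mul, mul_inv_cancel, act_one]
  let m0 : r.N φ P.s0 := ⟨⟨([], 1), trivial⟩, rfl⟩
  have pi : ∀ s (m : r.N φ s) a, r.p φ (r.mu φ s a m).1.1 = r.p φ m.1.1 * r.t s a := by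
    intro s m a
    have := r.p_mul φ m.1.1.1 m.1.1.2 a
    rw [m.2] at this
    exact this
  have hp : ∀ g m, r.p φ (act m g).1.1 = r.p φ m.1.1 * g := by
    have hsub := r.gen
      { carrier := {g | ∀ m, r.p φ (act m g).1.1 = r.p φ m.1.1 * g}
        mul_mem' := by
          intro a b ha hb m
          rw [act_mul, hb, ha, mul_assoc]
        one_mem' := by intro m; rw [act_one, mul_one]
        inv_mem' := by
          intro a ha m
          have := ha (act m a⁻¹)
          rw [← act_mul, inv_mul_cancel, act_one] at this
          rw [this]; group } ?_ ?_ ?_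
    · intro g
      have : g ∈ (⊤ : Subgroup 𝔾) := trivial
      rw [← hsub] at this
      exact this
    · intro s a m
      rw [act_i, r.p_lk' φ hφ, pi, r.p_lk φ hφ, Rz.t]; group
    · intro j m
      rw [act_e, r.p_lk' φ hφ, Rz.st, r.p_crE φ hφ, r.p_lk φ hφ]
      simp only [Rz.v]; group
    · intro m
      rw [act_z, r.p_lk φ hφ]
  have hcase : ∀ (ε : (P.dat φ).E) (s1 s : P.S) (hsrc : (P.dat φ).src ε = s1)
      (hs : (P.dat φ).tgt ε = s) (m : r.N φ s1), act ((r.lk φ s1).symm m) (r.z * r.v ε * r.z⁻¹) =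
        (r.lk φ s).symm (crE σ (P.dat φ) ε s1 s hsrc hs m) := by
    intro ε s1 s hsrc hs m
    rcases ε with ⟨j | t, _ | _⟩
    · subst hs; subst hsrc
      have : r.z * r.v (Sum.inl j, false) * r.z⁻¹ = (r.e j)⁻¹ := by simp only [Rz.v]; group
      rw [this]
      apply act_inv
      rw [act_e, Equiv.apply_symm_apply]
      congr 1
      exact Equiv.apply_symm_apply (r.st φ j) m
    · subst hs; subst hsrc
      have : r.z * r.v (Sum.inl j, true) * r.z⁻¹ = r.e j := by simp only [Rz.v]; group
      rw [this, act_e, Equiv.apply_symm_apply]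
      rfl
    · subst hs; subst hsrc
      have : r.z * r.v (Sum.inr t, false) * r.z⁻¹ = r.z⁻¹ := by simp only [Rz.v]; group
      rw [this]
      apply act_inv
      rw [act_z]
      exact Equiv.apply_symm_apply (r.lk φ P.s0) _
    · subst hs; subst hsrc
      have : r.z * r.v (Sum.inr t, true) * r.z⁻¹ = r.z := by simp only [Rz.v]; group
      rw [this, act_z]
      exact (Equiv.apply_symm_apply (r.lk φ P.s0) m).trans
        (Equiv.symm_apply_apply (r.lk φ t) m).symm
  have hback : ∀ (w : List (A × (P.dat φ).E)) (a : A) (s : P.S) (hw : Valid σ (P.dat φ) w)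
      (hs : typ (P.dat φ) w = s),
      act m0 (r.p φ (w, a) * r.z⁻¹) = (r.lk φ s).symm ⟨⟨(w, a), hw⟩, hs⟩ := by
    have hmul : ∀ (w : List (A × (P.dat φ).E)) (a b : A) (s : P.S) (hw : Valid σ (P.dat φ) w)
      (hs : typ (P.dat φ) w = s),
      act m0 (r.p φ (w, a) * r.z⁻¹) = (r.lk φ s).symm ⟨⟨(w, a), hw⟩, hs⟩ →
      act m0 (r.p φ (w, a * b) * r.z⁻¹) = (r.lk φ s).symm ⟨⟨(w, a * b), hw⟩, hs⟩ := by
      intro w a b s hw hs h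
      have : r.p φ (w, a * b) * r.z⁻¹ = r.p φ (w, a) * r.z⁻¹ * r.i s b := by
        rw [r.p_mul, hs, Rz.t]; group
      rw [this, act_mul, h, act_i, Equiv.apply_symm_apply]
      rfl
    have hone : ∀ (w : List (A × (P.dat φ).E)) (s : P.S) (hw : Valid σ (P.dat φ) w)
      (hs : typ (P.dat φ) w = s),
      act m0 (r.p φ (w, 1) * r.z⁻¹) = (r.lk φ s).symm ⟨⟨(w, 1), hw⟩, hs⟩ := by
      intro w
      induction w with
      | nil =>
        intro s hw hs
        have hs : P.s0 = s := hs
        subst hs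
        have h0 : r.p φ ([], 1) = 1 := by simp [Rz.p, Rz.pw, Rz.t]
        rw [h0, one_mul]
        apply act_inv
        rw [act_z, Equiv.apply_symm_apply]
      | cons q w ih =>
        intro s hw hs
        obtain ⟨j, ε⟩ := q
        have hsrc : (P.dat φ).src ε = typ (P.dat φ) w := hw.2.1
        have h1 := hmul w 1 j _ hw.1 rfl (ih _ hw.1 rfl)
        rw [one_mul] at h1
        have h2 := r.p_down φ hφ w j ε 1 hw (σ.pt_one _)
        rw [mul_one] at h2
        rw [h2]
        have h3 : (⟨⟨((j, ε) :: w, 1), hw⟩, hs⟩ : r.N φ s) =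
            crE σ (P.dat φ) ε _ s hsrc hs ⟨⟨(w, j), hw.1⟩, rfl⟩ := by
          rw [← Equiv.symm_apply_eq]
          apply Mt_ext
          show cr σ (P.dat φ) ((P.dat φ).rev ε) ((j, ε) :: w, 1) = _
          rw [cr, if_pos ⟨σ.pt_one _, ((P.dat φ).rev_rev ε).symm⟩, mul_one]
        rw [h3]
        have h4 : r.p φ (w, j) * r.v ε * r.z⁻¹ =
          (r.p φ (w, j) * r.z⁻¹) * (r.z * r.v ε * r.z⁻¹) := by group
        rw [h4, act_mul, h1]
        exact hcase ε _ s hsrc hs _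
    intro w a s hw hs
    have := hmul w 1 a s hw hs (hone w s hw hs)
    simpa using this
  obtain ⟨B, hB⟩ := near_gen hT
    ((Finset.univ ×ˢ X).image (fun q : P.S × A => r.t q.1 q.2) ∪ Finset.univ.image r.v)
  refine ⟨T, hT, fun g => (act m0 g).1, fun m => r.p φ m.1, B + 3, ?_, ?_, ?_, ?_⟩
  · rintro x y ⟨g, hg, rfl⟩
    have hst : ∀ (s s' : P.S) (h : r.N φ P.s0), Near (Step σ (P.dat φ) X) 1 h.1 (r.lk φ s h).1 :=
      fun s _ h => crE_near σ (P.dat φ) _ _ _ _ _ _ _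
    have hst' : ∀ s (h : r.N φ s), Near (Step σ (P.dat φ) X) 1 h.1 ((r.lk φ s).symm h).1 :=
      fun s h => crE_near' σ (P.dat φ) _ _ _ _ _ _ _
    show Near (Step σ (P.dat φ) X) (B + 3) (act m0 x).1 (act m0 (x * g)).1
    rw [act_mul]
    generalize act m0 x = m
    rcases hT' g hg with ⟨s, a, ha, rfl⟩ | ⟨j, rfl⟩ | rfl
    · rw [act_i]
      have e1 : Near (Step σ (P.dat φ) X) 1 (r.lk φ s m).1 (r.mu φ s a (r.lk φ s m)).1 :=
        near_raw (Near.one (StepR.mul _ _ a (r.lk φ s m).1.2 ha)) _ _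
      exact (((hst s s m).trans e1).trans (hst' s _)).mono (by omega)
    · rw [act_e]
      have e1 : Near (Step σ (P.dat φ) X) 1 (r.lk φ (P.src j) m).1
        (r.st φ j (r.lk φ (P.src j) m)).1 := crE_near σ (P.dat φ) _ _ _ _ _ _ _
      exact (((hst _ P.s0 m).trans e1).trans (hst' _ _)).mono (by omega)
    · rw [act_z]
      exact (hst _ P.s0 m).mono (by omega)
  · rintro ⟨m, hm⟩ ⟨m', hm'⟩ h
    unfold Step at h
    simp only at h
    cases h with
    | mul w a x h1 h2 =>
      simp only [r.p_mul]
      refine (hB _ ?_ _).mono (by omega)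
      rw [Finset.mem_union]
      left
      exact Finset.mem_image.2 ⟨(_, x), by simpa using h2, rfl⟩
    | down j ε w c h1 h2 =>
      simp only [r.p_down φ hφ w j ε c h1 h2]
      refine (hB _ ?_ _).mono (by omega)
      rw [Finset.mem_union]
      right
      exact Finset.mem_image.2 ⟨ε, Finset.mem_univ _, rfl⟩
  · intro g
    simp only [hp]
    have h0 : r.p φ m0.1.1 = 1 := by simp [m0, Rz.p, Rz.pw, Rz.t]
    rw [h0, one_mul]
    exact Near.refl _ _
  · rintro ⟨⟨w, a⟩, hw⟩
    have h1 := hback w a _ hw rfl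
    have h2 : act m0 (r.p φ (w, a)) = r.lk φ P.s0 ((r.lk φ (typ (P.dat φ) w)).symm
      ⟨⟨(w, a), hw⟩, rfl⟩) := by
      rw [← h1, ← act_z, ← act_mul]; congr 1; group
    simp only [h2]
    have e1 := crE_near' σ (P.dat φ) (Sum.inr (typ (P.dat φ) w), true) P.s0 _ rfl rfl
      ⟨⟨(w, a), hw⟩, rfl⟩ X
    have e2 := crE_near σ (P.dat φ) (Sum.inr P.s0, true) P.s0 P.s0 rfl rfl
      ((r.lk φ (typ (P.dat φ) w)).symm ⟨⟨(w, a), hw⟩, rfl⟩) X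
    exact (e1.trans e2).symm.mono (by omega)

/-- main consequence: everything realizing a full datum is coarsely the standard model. -/
theorem Rz.std (r : Rz σ P 𝔾) (hφ : ∀ a, σ.pt φ a = a) (X : Finset A) (hX : Subgroup.closure (X : Set A) = ⊤)
    (hfull : ∀ s τ, τ ≠ φ → ∃ j, P.fam j = τ ∧ (P.src j = s ∨ P.tgt j = s)) :
    ∃ T : Finset 𝔾, Subgroup.closure (T : Set 𝔾) = ⊤ ∧
      CE (Cay (T : Set 𝔾)) (Step σ (stdDat Fm) X) := by
  obtain ⟨T, hT, h⟩ := r.ce φ hφ X hX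
  refine ⟨T, hT, h.trans (GW ?_ hX)⟩
  intro s τ
  by_cases hτ : τ = φ
  · exact ⟨(Sum.inr s, false), rfl, hτ.symm⟩
  · obtain ⟨j, h1, h2 | h2⟩ := hfull s τ hτ
    · exact ⟨(Sum.inl j, true), h2, h1⟩
    · exact ⟨(Sum.inl j, false), h2, h1⟩

theorem Rz.ceg (r : Rz σ P 𝔾) {P' : PreDat Fm} {ℍ : Type} [Group ℍ] (r' : Rz σ P' ℍ) (hφ : ∀ a, σ.pt φ a = a)
    (hA : Group.FG A) (hfull : ∀ s τ, τ ≠ φ → ∃ j, P.fam j = τ ∧ (P.src j = s ∨ P.tgt j = s))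
    (hfull' : ∀ s τ, τ ≠ φ → ∃ j, P'.fam j = τ ∧ (P'.src j = s ∨ P'.tgt j = s)) :
    CEG 𝔾 ℍ := by
  obtain ⟨X, hX⟩ := hA.out
  obtain ⟨T, hT, h⟩ := r.std φ hφ X hX hfull
  obtain ⟨T', hT', h'⟩ := r'.std φ hφ X hX hfull'
  exact ⟨T, T', hT, hT', h.trans h'.symm⟩
end L

section stage1
open Classical
abbrev sig1 (A : Type) [Group A] (u : A) (hu : ∀ n : ℕ, 0 < n → u ^ n ≠ 1) : Sig A Unit where
  pt _ a := a
  h1 _ _ := rfl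
  h2 _ a := inv_mul_cancel a
  h3 _ a c h := by rw [h, mul_one]
  u _ := u
  ucomm _ c h := by rw [h, mul_one, one_mul]
  upt _ _ := rfl
  une _ n h := hu n h

abbrev pre1 (X : Type) [Fintype X] (x0 : X) : PreDat Unit where
  S := Unit
  J := {x : X // x ≠ x0}
  fS := inferInstance
  fJ := inferInstance
  s0 := ()
  src _ := ()
  tgt _ := ()
  fam _ := ()

open Monoid in
def rz1 (A : Type) [Group A] (u : A) (hu : ∀ n : ℕ, 0 < n → u ^ n ≠ 1) (X : Type) [Fintype X]
    (x0 : X) : Rz (sig1 A u hu) (pre1 X x0) (Coprod A (FreeGroup X)) where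
  i _ := Coprod.inl
  e j := Coprod.inr (FreeGroup.of j.1)
  z := Coprod.inr (FreeGroup.of x0)
  rel j c h := by
    have h' : c = 1 := h
    subst h'; simp
  gen H h1 h2 h3 := by
    rw [eq_top_iff, ← Coprod.range_inl_sup_range_inr, sup_le_iff]
    constructor
    · rintro _ ⟨a, rfl⟩; exact h1 () a
    · have : FreeGroup.lift (fun x : X => (Coprod.inr (FreeGroup.of x) : Coprod A (FreeGroup X))) =
          Coprod.inr := by ext; simp
      rw [← this, FreeGroup.range_lift_eq_closure, Subgroup.closure_le]
      rintro _ ⟨x, rfl⟩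
      by_cases hx : x = x0
      · subst hx; exact h3
      · exact h2 ⟨x, hx⟩
  lift K _ i' e' z' _ := by
    refine ⟨Coprod.lift (i' ()) (FreeGroup.lift fun x => if h : x = x0 then z' else e' ⟨x, h⟩),
      ?_, ?_, ?_⟩
    · intro s a; simp
    · rintro ⟨x, hx⟩; simp [hx]
    · simp

theorem stage1 (A : Type) [Group A] (hA : Group.FG A) (u : A) (hu : ∀ n : ℕ, 0 < n → u ^ n ≠ 1)
    (X : Type) [Fintype X] (x0 : X) :
    CEG (Monoid.Coprod A (FreeGroup Unit)) (Monoid.Coprod A (FreeGroup X)) :=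
  (rz1 A u hu Unit ()).ceg () (rz1 A u hu X x0) (fun _ => rfl) hA
    (fun _ τ h => absurd rfl h) (fun _ τ h => absurd rfl h)
end stage1

/-- the peripheral group `ℤ × ℤ`. -/
abbrev Z2 : Type := Multiplicative ℤ × Multiplicative ℤ
abbrev X2 : Z2 := (Multiplicative.ofAdd 1, 1)
abbrev Y2 : Z2 := (1, Multiplicative.ofAdd 1)

theorem z2_eq (c : Z2) : c = X2 ^ c.1.toAdd * Y2 ^ c.2.toAdd := by
  ext <;> simp [← ofAdd_zsmul]

abbrev sig2 : Sig Z2 (Fin 3) where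
  pt τ a := if τ = 0 then (a.1, 1) else if τ = 1 then (1, a.2) else a
  h1 τ a := by split_ifs <;> simp
  h2 τ a := by split_ifs <;> simp
  h3 τ a c h := by
    split_ifs at h ⊢ <;> simp_all
  u τ := if τ = 1 then Y2 else X2
  ucomm _ c _ := mul_comm _ _
  upt τ n := by
    fin_cases τ <;> simp
  une τ n hn h := by
    have : n ≠ 0 := by omega
    fin_cases τ <;> simp [Prod.ext_iff, ← ofAdd_nsmul, ← ofAdd_zero] at h <;>
    omega

theorem Z2_fg : Group.FG Z2 := inferInstance

/-- Commuting pair gives a hom from `Z2`. -/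
def z2hom {K : Type*} [Group K] (a b : K) (h : a * b = b * a) : Z2 →* K :=
  MonoidHom.mk' (fun c => a ^ c.1.toAdd * b ^ c.2.toAdd) (by
    intro c d
    have hc : Commute a b := h
    simp only [Prod.fst_mul, Prod.snd_mul, toAdd_mul, zpow_add]
    have := (hc.zpow_zpow d.1.toAdd c.2.toAdd).eq
    simp only [mul_assoc]
    rw [← mul_assoc (b ^ _) (a ^ _), ← this]; simp only [mul_assoc])

section
variable {K : Type*} [Group K]
@[simp] theorem z2hom_X (a b : K) (h) : z2hom a b h X2 = a := by simp [z2hom]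
@[simp] theorem z2hom_Y (a b : K) (h) : z2hom a b h Y2 = b := by simp [z2hom]

theorem z2hom_ext {f g : Z2 →* K} (hx : f X2 = g X2) (hy : f Y2 = g Y2) : f = g := by
  ext c
  rw [z2_eq c]; simp only [map_mul, map_zpow, hx, hy]

theorem z2_mem (H : Subgroup K) (f : Z2 →* K) (hx : f X2 ∈ H) (hy : f Y2 ∈ H) (c) : f c ∈ H := by
  rw [z2_eq c]; simp only [map_mul, map_zpow]
  exact H.mul_mem (H.zpow_mem hx _) (H.zpow_mem hy _)

/-- relations for a strip of family `τ` reduce to one generator. -/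
theorem rel2 (τ : Fin 3) (f g : Z2 →* K) (e : K)
    (h0 : τ = 0 → f Y2 * e = e * g Y2) (h1 : τ = 1 → f X2 * e = e * g X2) :
    ∀ c, sig2.pt τ c = 1 → f c * e = e * g c := by
  have key : ∀ v : Z2, f v * e = e * g v → ∀ n : ℤ, f (v ^ n) * e = e * g (v ^ n) := by
    intro v hv n
    have h2 : f v = e * g v * e⁻¹ := by rw [← hv]; group
    rw [map_zpow, map_zpow, h2]
    have := conj_zpow (i := n) (a := e) (b := g v)
    rw [this]; group
  intro c hc
  fin_cases τ
  · have : c.1 = 1 := by simpa [Prod.ext_iff] using hc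
    have hh := z2_eq c
    rw [this] at hh
    rw [hh]; simpa using key _ (h0 rfl) c.2.toAdd
  · have : c.2 = 1 := by simpa [Prod.ext_iff] using hc
    have hh := z2_eq c
    rw [this] at hh
    rw [hh]; simpa using key _ (h1 rfl) c.1.toAdd
  · have : c = 1 := by simpa using hc
    subst this; simp

/-- Conversely. -/
theorem rel2Y (f g : Z2 →* K) (e : K) (h : ∀ c, sig2.pt 0 c = 1 → f c * e = e * g c) :
    f Y2 * e = e * g Y2 := h _ (by simp)
theorem rel2X (f g : Z2 →* K) (e : K) (h : ∀ c, sig2.pt 1 c = 1 → f c * e = e * g c) :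
    f X2 * e = e * g X2 := h _ (by simp)
end

/-- A finite tree of diameter at least three, rooted at an interior edge. -/
structure Rooted {W : Type} (T : SimpleGraph W) where
  ρ : W
  u0 : W
  par : W → W
  d : W → ℕ
  adj : ∀ v w, T.Adj v w → w = par v ∨ v = par w
  adjpar : ∀ v, T.Adj v (par v)
  dρ : d ρ = 0
  dpar : ∀ v, v ≠ ρ → d (par v) + 1 = d v
  parρ : par ρ = u0
  paru0 : par u0 = ρ
  Iρ : ∃ w, w ≠ ρ ∧ w ≠ u0 ∧ par w = ρ
  Iu0 : ∃ w, w ≠ ρ ∧ w ≠ u0 ∧ par w = u0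

theorem exists_rooted {W : Type} (T : SimpleGraph W) (hT : T.IsTree)
    (hdiam : ∃ u v : W, 3 ≤ T.dist u v) : Nonempty (Rooted T) := by
  classical
  obtain ⟨u, v, huv⟩ := hdiam
  obtain ⟨p, hp⟩ := (hT.connected u v).exists_walk_length_eq_dist
  have hadj : ∀ i, i < 3 → T.Adj (p.getVert i) (p.getVert (i + 1)) :=
    fun i hi => p.adj_getVert_succ (by omega)
  have hpath : p.IsPath := p.isPath_of_length_eq_dist hp
  have hinj : ∀ i j, i ≤ 3 → j ≤ 3 → p.getVert i = p.getVert j → i = j := by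
    intro i j hi hj h
    exact hpath.getVert_injOn (by simp; omega) (by simp; omega) h
  have a0 := hadj 0 (by omega)
  have a1 := hadj 1 (by omega)
  have a2 := hadj 2 (by omega)
  simp only [zero_add, Nat.reduceAdd] at a0 a1 a2
  have n02 : p.getVert 0 ≠ p.getVert 2 := fun h => absurd (hinj _ _ (by omega) (by omega) h) (by omega)
  have n13 : p.getVert 1 ≠ p.getVert 3 := fun h => absurd (hinj _ _ (by omega) (by omega) h) (by omega)
  generalize p.getVert 0 = w1 at *
  generalize p.getVert 1 = ρ at *
  generalize p.getVert 2 = u0 at *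
  generalize p.getVert 3 = w2 at *
  choose q hq using fun w => (hT.existsUnique_path ρ w).exists
  have hcon : ∀ v w, (h : T.Adj v w) → v ∈ (q w).support → q w = (q v).concat h :=
    fun v w h hv => hT.isAcyclic.path_concat (hq v) (hq w) h hv
  have hpen : ∀ v w, (h : T.Adj v w) → v ∈ (q w).support → (q w).penultimate = v := by
    intro v w h hv
    rw [hcon v w h hv]; simp
  have hnil : ∀ v, v ≠ ρ → ¬ (q v).Nil := fun v hv => SimpleGraph.Walk.not_nil_of_ne (Ne.symm hv)
  have hadjp : ∀ v, v ≠ ρ → T.Adj (q v).penultimate v := fun v hv =>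
    (q v).adj_penultimate (hnil v hv)
  have hmemp : ∀ v, (q v).penultimate ∈ (q v).support := fun v => (q v).getVert_mem_support _
  have hqρ : (q ρ).length = 0 := by
    have := (hq ρ)
    rw [SimpleGraph.Walk.isPath_iff_nil] at this
    exact SimpleGraph.Walk.nil_iff_length_eq.1 this
  have ppar : ∀ v w, T.Adj v w → (w ≠ ρ ∧ (q w).penultimate = v) ∨ (v ≠ ρ ∧ (q v).penultimate = w) := by
    intro v w h
    by_cases hv : v ∈ (q w).support
    · refine Or.inl ⟨?_, hpen _ _ h hv⟩
      rintro rfl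
      have := congrArg SimpleGraph.Walk.length (hcon _ _ h hv)
      rw [hqρ] at this; simp at this
    · have hw := hT.isAcyclic.mem_support_of_ne_mem_support_of_adj_of_isPath (hq v) (hq w) h hv
      refine Or.inr ⟨?_, hpen _ _ h.symm hw⟩
      rintro rfl
      have := congrArg SimpleGraph.Walk.length (hcon _ _ h.symm hw)
      rw [hqρ] at this; simp at this
  have hu0 : (q u0).penultimate = ρ := hpen _ _ a1 (SimpleGraph.Walk.start_mem_support _)
  have hu0ρ : u0 ≠ ρ := a1.ne'
  let par : W → W := fun v => if v = ρ then u0 else (q v).penultimate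
  have parne : ∀ v, v ≠ ρ → par v = (q v).penultimate := fun v hv => if_neg hv
  have parρ : par ρ = u0 := if_pos rfl
  have padj : ∀ v w, T.Adj v w → w = par v ∨ v = par w := by
    intro v w h
    rcases ppar v w h with ⟨h1, h2⟩ | ⟨h1, h2⟩
    · right; rw [parne _ h1, h2]
    · left; rw [parne _ h1, h2]
  refine ⟨⟨ρ, u0, par, fun v => (q v).length, padj, ?_, hqρ, ?_, parρ, ?_, ?_, ?_⟩⟩
  · intro v
    by_cases hv : v = ρ
    · subst hv; rw [parρ]; exact a1
    · rw [parne v hv]; exact (hadjp v hv).symm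
  · intro v hv
    rw [parne v hv]
    have := congrArg SimpleGraph.Walk.length (hcon _ _ (hadjp v hv) (hmemp v))
    rw [this]; simp
  · rw [parne _ hu0ρ, hu0]
  · refine ⟨w1, a0.ne, n02, ?_⟩
    rcases padj _ _ a0 with h | h
    · exact h.symm
    · rw [parρ] at h; exact absurd h n02
  · refine ⟨w2, n13.symm, a2.ne', ?_⟩
    rcases padj _ _ a2 with h | h
    · rw [parne _ hu0ρ, hu0] at h; exact absurd h.symm n13
    · exact h.symm

/-- coloured generators of `Z2`. -/
def D2c (c : Bool) : Z2 := if c then X2 else Y2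
def zz {K : Type*} [Group K] (c : Bool) (a b : K) (h : a * b = b * a) : Z2 →* K :=
  match c with
  | true => z2hom a b h
  | false => z2hom b a h.symm
section
variable {K : Type*} [Group K]
theorem zz_a (c : Bool) (a b : K) (h) : zz c a b h (D2c c) = a := by
  cases c <;> simp [zz, D2c]
theorem zz_b (c : Bool) (a b : K) (h) : zz c a b h (D2c !c) = b := by
  cases c <;> simp [zz, D2c]
theorem zz_ext (c : Bool) {f g : Z2 →* K} (h1 : f (D2c c) = g (D2c c))
    (h2 : f (D2c !c) = g (D2c !c)) : f = g := by
  cases c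
  · exact z2hom_ext h2 h1
  · exact z2hom_ext h1 h2
theorem zz_mem (c : Bool) (H : Subgroup K) (f : Z2 →* K) (h1 : f (D2c c) ∈ H)
    (h2 : f (D2c !c) ∈ H) : ∀ a, f a ∈ H := by
  cases c
  · exact z2_mem H f h2 h1
  · exact z2_mem H f h1 h2
def famc (c : Bool) : Fin 3 := if c then 1 else 0
theorem rel_famc (c : Bool) (f g : Z2 →* K) (e : K) (h : f (D2c c) * e = e * g (D2c c)) :
    ∀ a, sig2.pt (famc c) a = 1 → f a * e = e * g a := by
  cases c
  · exact rel2 _ f g e (fun _ => h) (fun h' => absurd h' (by simp [famc]))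
  · exact rel2 _ f g e (fun h' => absurd h' (by simp [famc])) (fun _ => h)
theorem famc_rel (c : Bool) (f g : Z2 →* K) (e : K)
    (h : ∀ a, sig2.pt (famc c) a = 1 → f a * e = e * g a) : f (D2c c) * e = e * g (D2c c) :=
  h _ (by cases c <;> simp [famc, D2c])
end

section tree
open Classical Monoid
variable {W : Type} [Fintype W] {T : SimpleGraph W} (R : Rooted T)

namespace Rooted
def I (v : W) : Prop := ∃ w, w ≠ R.ρ ∧ w ≠ R.u0 ∧ R.par w = v
def col (v : W) : Bool := decide (Even (R.d v))

theorem u0ne : R.u0 ≠ R.ρ := by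
  have := R.adjpar R.ρ
  rw [R.parρ] at this
  exact this.ne'

theorem col_par (v : W) : R.col (R.par v) = !R.col v := by
  have hu := R.dpar _ R.u0ne
  rw [R.paru0, R.dρ] at hu
  by_cases hv : v = R.ρ
  · subst hv; rw [R.parρ]; simp [col, R.dρ, ← hu]
  · simp [col, ← R.dpar v hv, Nat.even_add_one, -Nat.not_even_iff_odd]

abbrev S : Type := {v : W // R.I v ∧ v ≠ R.ρ}
abbrev J : Type := {v : W // v ≠ R.ρ ∧ v ≠ R.u0}
abbrev s0 : R.S := ⟨R.u0, R.Iu0, R.u0ne⟩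

/-- the type containing the vertex `v`. -/
def t (v : W) : R.S := if h : R.I v ∧ v ≠ R.ρ then ⟨v, h⟩ else R.s0
theorem t_S (s : R.S) : R.t s.1 = s := by rw [t, dif_pos s.2]
theorem t_ρ : R.t R.ρ = R.s0 := by rw [t, dif_neg]; simp
theorem t_u0 : R.t R.u0 = R.s0 := R.t_S R.s0

abbrev pre : PreDat (Fin 3) where
  S := R.S
  J := R.J
  fS := inferInstance
  fJ := inferInstance
  s0 := R.s0
  src j := R.t (R.par j.1)
  tgt j := if R.I j.1 then R.t j.1 else R.t (R.par j.1)
  fam j := famc (R.col (R.par j.1))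

theorem pre_full : ∀ s τ, τ ≠ (2 : Fin 3) →
    ∃ j, R.pre.fam j = τ ∧ (R.pre.src j = s ∨ R.pre.tgt j = s) := by
  intro s τ hτ
  have key : ∀ c : Bool, ∃ j, R.pre.fam j = famc c ∧ (R.pre.src j = s ∨ R.pre.tgt j = s) := by
    intro c
    by_cases hc : c = R.col s.1
    · obtain ⟨w, h1, h2, h3⟩ := s.2.1
      refine ⟨⟨w, h1, h2⟩, ?_, Or.inl ?_⟩
      · simp only [h3, hc]
      · simp only [h3]; exact R.t_S s
    · have hc : c = !R.col s.1 := by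
        revert hc; cases c <;> cases R.col s.1 <;> simp
      by_cases hs : s = R.s0
      · subst hs
        obtain ⟨w, h1, h2, h3⟩ := R.Iρ
        refine ⟨⟨w, h1, h2⟩, ?_, Or.inl ?_⟩
        · simp only [h3, hc]
          rw [← R.col_par, R.paru0]
        · simp only [h3]; exact R.t_ρ
      · refine ⟨⟨s.1, s.2.2, fun h => hs (Subtype.ext h)⟩, ?_, Or.inr ?_⟩
        · simp only [hc, R.col_par]
        · simp only [if_pos s.2.1, R.t_S]
  fin_cases τ
  · exact key false
  · exact key true
  · exact absurd rfl hτ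

abbrev GG : Type := Coprod (RAAG T) (FreeGroup (R.S))
def g (v : W) : R.GG := Coprod.inl (raagOf T v)
def τ (v : W) : R.GG := Coprod.inr (FreeGroup.of (R.t v))

theorem raag_comm {v w : W} (h : T.Adj v w) : raagOf T v * raagOf T w = raagOf T w * raagOf T v := by
  have h1 : (QuotientGroup.mk (FreeGroup.of v * FreeGroup.of w * (FreeGroup.of v)⁻¹ * (FreeGroup.of w)⁻¹)
    : RAAG T) = 1 := (QuotientGroup.eq_one_iff _).2 (Subgroup.subset_normalClosure ⟨v, w, h, rfl⟩)
  have h2 : raagOf T v * raagOf T w * (raagOf T v)⁻¹ * (raagOf T w)⁻¹ = 1 := h1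
  calc _ = (raagOf T v * raagOf T w * (raagOf T v)⁻¹ * (raagOf T w)⁻¹) * (raagOf T w * raagOf T v) := by group
    _ = _ := by rw [h2, one_mul]

theorem g_comm (v : W) : R.g v * R.g (R.par v) = R.g (R.par v) * R.g v := by
  unfold g
  rw [← map_mul, ← map_mul, raag_comm (R.adjpar v)]

def ii (s : R.S) : Z2 →* R.GG :=
  zz (R.col s.1) ((R.τ s.1)⁻¹ * R.g s.1 * R.τ s.1) ((R.τ s.1)⁻¹ * R.g (R.par s.1) * R.τ s.1) (by
    have := R.g_comm s.1
    calc _ = (R.τ s.1)⁻¹ * (R.g s.1 * R.g (R.par s.1)) * R.τ s.1 := by group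
      _ = _ := by rw [this]; group)
theorem ii_a (s : R.S) : R.ii s (D2c (R.col s.1)) = (R.τ s.1)⁻¹ * R.g s.1 * R.τ s.1 := zz_a _ _ _ _
theorem ii_b (s : R.S) : R.ii s (D2c (R.col (R.par s.1))) = (R.τ s.1)⁻¹ * R.g (R.par s.1) * R.τ s.1 := by
  rw [col_par]; exact zz_b _ _ _ _

theorem τ_ρ : R.τ R.ρ = R.τ R.u0 := by rw [τ, τ, t_ρ, t_u0]
theorem ii_t (v : W) (hv : R.I v) : R.ii (R.t v) (D2c (R.col v)) = (R.τ v)⁻¹ * R.g v * R.τ v := by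
  by_cases h : v = R.ρ
  · subst h
    have := R.ii_b R.s0
    rw [t_ρ, τ_ρ]
    simpa only [R.paru0] using this
  · have := R.ii_a ⟨v, hv, h⟩
    have h2 : R.t v = ⟨v, hv, h⟩ := R.t_S ⟨v, hv, h⟩
    rw [h2]; exact this

def ee (j : R.J) : R.GG := if R.I j.1 then (R.τ (R.par j.1))⁻¹ * R.τ j.1 else
  (R.τ (R.par j.1))⁻¹ * R.g j.1 * R.τ (R.par j.1)

theorem Ipar (j : R.J) : R.I (R.par j.1) := ⟨j.1, j.2.1, j.2.2, rfl⟩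

theorem rel' (j : R.J) (c : Z2) (hc : sig2.pt (R.pre.fam j) c = 1) :
    R.ii (R.pre.src j) c * R.ee j = R.ee j * R.ii (R.pre.tgt j) c := by
  refine rel_famc _ _ _ _ ?_ c hc
  by_cases h : R.I j.1
  · simp only [ee, if_pos h]
    rw [R.ii_t _ (R.Ipar j)]
    have := R.ii_b ⟨j.1, h, j.2.1⟩
    rw [← R.t_S ⟨j.1, h, j.2.1⟩] at this
    simp only [R.t_S ⟨j.1, h, j.2.1⟩] at this
    have h2 := R.t_S ⟨j.1, h, j.2.1⟩
    simp only at h2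
    rw [h2, this]; group
  · simp only [ee, if_neg h]
    rw [R.ii_t _ (R.Ipar j)]
    have := R.g_comm j.1
    calc _ = (R.τ (R.par j.1))⁻¹ * (R.g (R.par j.1) * R.g j.1) * R.τ (R.par j.1) := by group
      _ = _ := by rw [← this]; group

theorem t_not (v : W) (h : ¬ R.I v) : R.t v = R.s0 := by
  rw [t, dif_neg]; exact fun h' => h h'.1

theorem gen' (H : Subgroup R.GG) (h1 : ∀ s a, R.ii s a ∈ H) (h2 : ∀ j, R.ee j ∈ H)
    (h3 : R.τ R.u0 ∈ H) : H = ⊤ := by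
  have hτ : ∀ n v, R.d v = n → R.τ v ∈ H := by
    intro n
    induction n with
    | zero =>
      intro v hv
      by_cases h : v = R.ρ
      · subst h; rw [τ_ρ]; exact h3
      · have := R.dpar v h; omega
    | succ n ih =>
      intro v hv
      by_cases h : R.I v
      · by_cases h' : v = R.u0
        · subst h'; exact h3
        have hρ : v ≠ R.ρ := by rintro rfl; rw [R.dρ] at hv; omega
        have hp := ih (R.par v) (by have := R.dpar v hρ; omega)
        have := h2 ⟨v, hρ, h'⟩
        simp only [ee, if_pos h] at this
        have := H.mul_mem hp this
        rwa [mul_inv_cancel_left] at this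
      · have : R.τ v = R.τ R.u0 := by rw [τ, τ, R.t_not v h, t_u0]
        rw [this]; exact h3
  have hconj : ∀ a b : R.GG, b ∈ H → b⁻¹ * a * b ∈ H → a ∈ H := by
    intro a b hb h
    have := H.mul_mem (H.mul_mem hb h) (H.inv_mem hb)
    simpa [mul_assoc] using this
  have hg : ∀ v, R.g v ∈ H := by
    intro v
    by_cases h : R.I v
    · have := h1 (R.t v) (D2c (R.col v))
      rw [R.ii_t v h] at this
      exact hconj _ _ (hτ _ v rfl) this
    · have hρ : v ≠ R.ρ := by rintro rfl; exact h R.Iρ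
      have hu : v ≠ R.u0 := by rintro rfl; exact h R.Iu0
      have := h2 ⟨v, hρ, hu⟩
      simp only [ee, if_neg h] at this
      exact hconj _ _ (hτ _ _ rfl) this
  rw [eq_top_iff, ← Coprod.range_inl_sup_range_inr, sup_le_iff]
  constructor
  · rw [MonoidHom.range_eq_map, Subgroup.map_le_iff_le_comap]
    have : Subgroup.closure (Set.range (raagOf T)) = ⊤ := PresentedGroup.closure_range_of (raagRels T)
    rw [← this, Subgroup.closure_le]
    rintro _ ⟨v, rfl⟩
    exact hg v
  · rw [MonoidHom.range_eq_map, Subgroup.map_le_iff_le_comap, ← FreeGroup.closure_range_of,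
      Subgroup.closure_le]
    rintro _ ⟨s, rfl⟩
    have := hτ _ s.1 rfl
    rwa [τ, t_S] at this

section lift
variable {K : Type} [Group K] (i' : R.S → Z2 →* K) (e' : R.J → K) (z' : K)
  (hr : ∀ (j : R.J) c, sig2.pt (R.pre.fam j) c = 1 → i' (R.pre.src j) c * e' j = e' j * i' (R.pre.tgt j) c)

def tF : ℕ → W → K
  | 0, _ => z'
  | n + 1, v => if h : v ≠ R.ρ ∧ v ≠ R.u0 then tF n (R.par v) * e' ⟨v, h⟩ else z'
def tt (v : W) : K := R.tF e' z' (R.d v) v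
theorem tt_ρ : R.tt e' z' R.ρ = z' := by simp [tt, R.dρ, tF]
theorem tt_u0 : R.tt e' z' R.u0 = z' := by
  have := R.dpar _ R.u0ne
  rw [tt, ← this]; simp [tF]
theorem tt_j (j : R.J) : R.tt e' z' j.1 = R.tt e' z' (R.par j.1) * e' j := by
  have := R.dpar _ j.2.1
  rw [tt, ← this, tF, dif_pos j.2]; rfl

def gg (v : W) : K := if h : R.I v then R.tt e' z' v * i' (R.t v) (D2c (R.col v)) * (R.tt e' z' v)⁻¹ else
  R.tt e' z' (R.par v) * e' ⟨v, fun h' => h (h' ▸ R.Iρ), fun h' => h (h' ▸ R.Iu0)⟩ * (R.tt e' z' (R.par v))⁻¹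

theorem t_J (j : R.J) (h : R.I j.1) : R.t j.1 = ⟨j.1, h, j.2.1⟩ := R.t_S ⟨j.1, h, j.2.1⟩

theorem gg_par (s : R.S)
    (hr : ∀ (j : R.J) c, sig2.pt (R.pre.fam j) c = 1 → i' (R.pre.src j) c * e' j = e' j * i' (R.pre.tgt j) c) :
    R.gg i' e' z' (R.par s.1) =
    R.tt e' z' s.1 * i' s (D2c (R.col (R.par s.1))) * (R.tt e' z' s.1)⁻¹ := by
  by_cases hs : s = R.s0
  · subst hs
    rw [R.paru0, gg, dif_pos (show R.I R.ρ from R.Iρ), tt_ρ, tt_u0, t_ρ]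
  · let j : R.J := ⟨s.1, s.2.2, fun h => hs (Subtype.ext h)⟩
    have h1 := famc_rel _ _ _ _ (hr j)
    simp only [if_pos s.2.1, j, R.t_S] at h1
    have h2 := R.tt_j e' z' j
    simp only [j] at h2
    rw [gg, dif_pos (R.Ipar j), h2]
    calc _ = R.tt e' z' (R.par s.1) * (i' (R.t (R.par s.1)) (D2c (R.col (R.par s.1))) * e' j) * (e' j)⁻¹ * (R.tt e' z' (R.par s.1))⁻¹ := by group
      _ = _ := by simp only [j]; rw [h1]; group

theorem gg_self (s : R.S) : R.gg i' e' z' s.1 =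
    R.tt e' z' s.1 * i' s (D2c (R.col s.1)) * (R.tt e' z' s.1)⁻¹ := by
  rw [gg, dif_pos s.2.1, t_S]

theorem gg_comm (v : W)
    (hr : ∀ (j : R.J) c, sig2.pt (R.pre.fam j) c = 1 → i' (R.pre.src j) c * e' j = e' j * i' (R.pre.tgt j) c) :
    R.gg i' e' z' v * R.gg i' e' z' (R.par v) = R.gg i' e' z' (R.par v) * R.gg i' e' z' v := by
  have hS : ∀ s : R.S, R.gg i' e' z' s.1 * R.gg i' e' z' (R.par s.1) =
      R.gg i' e' z' (R.par s.1) * R.gg i' e' z' s.1 := by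
    intro s
    rw [R.gg_par i' e' z' s hr, R.gg_self]
    generalize R.tt e' z' s.1 = q
    have : i' s (D2c (R.col s.1)) * i' s (D2c (R.col (R.par s.1))) =
      i' s (D2c (R.col (R.par s.1))) * i' s (D2c (R.col s.1)) := by
      rw [← map_mul, ← map_mul, mul_comm]
    calc _ = q * (i' s (D2c (R.col s.1)) * i' s (D2c (R.col (R.par s.1)))) * q⁻¹ := by group
      _ = _ := by rw [this]; group
  by_cases h : R.I v
  · by_cases hv : v = R.ρ
    · subst hv
      have := hS R.s0
      rw [R.paru0] at this
      rw [R.parρ]; exact this.symm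
    · exact hS ⟨v, h, hv⟩
  · let j : R.J := ⟨v, fun h' => h (h' ▸ R.Iρ), fun h' => h (h' ▸ R.Iu0)⟩
    have h1 := famc_rel _ _ _ _ (hr j)
    simp only [j, if_neg h] at h1
    rw [gg, dif_neg h, gg, dif_pos (R.Ipar j)]
    change i' (R.t (R.par v)) (D2c (R.col (R.par v))) * e' j = e' j * _ at h1
    change R.tt e' z' (R.par v) * e' j * _ * _ = _ * (R.tt e' z' (R.par v) * e' j * _)
    generalize R.tt e' z' (R.par v) = q
    calc _ = q * (e' j * i' (R.t (R.par v)) (D2c (R.col (R.par v)))) * q⁻¹ := by group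
      _ = _ := by rw [← h1]; group
end lift

theorem lift' (K : Type) [Group K] (i' : R.S → Z2 →* K) (e' : R.J → K) (z' : K)
  (hr : ∀ (j : R.J) c, sig2.pt (R.pre.fam j) c = 1 → i' (R.pre.src j) c * e' j = e' j * i' (R.pre.tgt j) c) :
    ∃ f : R.GG →* K, (∀ s a, f (R.ii s a) = i' s a) ∧ (∀ j, f (R.ee j) = e' j) ∧ f (R.τ R.u0) = z' := by
  have hrel : ∀ r ∈ raagRels T, FreeGroup.lift (R.gg i' e' z') r = 1 := by
    rintro _ ⟨v, w, hvw, rfl⟩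
    have : R.gg i' e' z' v * R.gg i' e' z' w = R.gg i' e' z' w * R.gg i' e' z' v := by
      rcases R.adj v w hvw with rfl | rfl
      · exact R.gg_comm i' e' z' _ hr
      · exact (R.gg_comm i' e' z' _ hr).symm
    simp only [map_mul, map_inv, FreeGroup.lift_apply_of, this]; group
  let f1 : RAAG T →* K := PresentedGroup.toGroup hrel
  have hf1 : ∀ v, f1 (raagOf T v) = R.gg i' e' z' v := fun v => PresentedGroup.toGroup.of hrel
  let f : R.GG →* K := Coprod.lift f1 (FreeGroup.lift fun s : R.S => R.tt e' z' s.1)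
  have hg : ∀ v, f (R.g v) = R.gg i' e' z' v := fun v => by
    rw [← hf1]; exact Coprod.lift_apply_inl _ _ _
  have hτ0 : ∀ s : R.S, f (R.τ s.1) = R.tt e' z' s.1 := fun s => by
    simp only [f, τ, t_S]; simp
  have hτ : ∀ v, R.I v → f (R.τ v) = R.tt e' z' v := fun v hv => by
    by_cases h : v = R.ρ
    · subst h; rw [τ_ρ, tt_ρ, ← R.tt_u0 e' z']; exact hτ0 R.s0
    · exact hτ0 ⟨v, hv, h⟩
  refine ⟨f, ?_, ?_, ?_⟩
  · intro s a
    have : f.comp (R.ii s) = i' s := by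
      apply zz_ext (R.col s.1)
      · rw [MonoidHom.comp_apply, ii_a]
        simp only [map_mul, map_inv, hg, hτ0, gg_self]; group
      · rw [← col_par, MonoidHom.comp_apply, ii_b]
        simp only [map_mul, map_inv, hg, hτ0, R.gg_par i' e' z' s hr]; group
    rw [← this]; rfl
  · intro j
    by_cases h : R.I j.1
    · simp only [ee, if_pos h, map_mul, map_inv]
      rw [hτ _ (R.Ipar j), hτ _ h, tt_j, inv_mul_cancel_left]
    · simp only [ee, if_neg h, map_mul, map_inv]
      rw [hτ _ (R.Ipar j), hg, gg, dif_neg h]; group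
  · rw [hτ _ R.Iu0, tt_u0]

def rz : Rz sig2 R.pre R.GG where
  i := R.ii
  e := R.ee
  z := R.τ R.u0
  rel := R.rel'
  gen := R.gen'
  lift := R.lift'
end Rooted

theorem raag_fg : Group.FG (RAAG T) := by
  refine Group.fg_iff.2 ⟨Set.range (raagOf T), PresentedGroup.closure_range_of (raagRels T),
    Set.finite_range _⟩

theorem raag_inf (v : W) : ∀ n : ℕ, 0 < n → raagOf T v ^ n ≠ 1 := by
  intro n hn h
  have hrel : ∀ r ∈ raagRels T, FreeGroup.lift (fun _ : W => Multiplicative.ofAdd (1:ℤ)) r = 1 := by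
    rintro _ ⟨v, w, hvw, rfl⟩
    simp
  let f1 : RAAG T →* Multiplicative ℤ := PresentedGroup.toGroup hrel
  have hf1 : f1 (raagOf T v) = Multiplicative.ofAdd (1:ℤ) := PresentedGroup.toGroup.of hrel
  have := congrArg f1 h
  rw [map_pow, hf1, map_one f1, ← ofAdd_nsmul, ← ofAdd_zero] at this
  have := Multiplicative.ofAdd.injective this
  simp at this
  omega

theorem tree_side (R : Rooted T) :
    CEG (R.GG) (Coprod (RAAG T) (FreeGroup Unit)) :=
  (stage1 (RAAG T) raag_fg _ (raag_inf R.ρ) R.S R.s0).symm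
end tree

section topo
open CategoryTheory
variable {V : Type} [DecidableEq V] {Γ : SimpleGraph V}

/-- `a` and `b` are vertices of a common closed cell of `D₂`. -/
def Nr (Γ : SimpleGraph V) (a b : V × V) : Prop :=
  IsClosedCell Γ a.1 b.1 ∧ IsClosedCell Γ a.2 b.2 ∧ a.1 ≠ a.2 ∧ a.1 ≠ b.2 ∧ b.1 ≠ a.2 ∧ b.1 ≠ b.2

theorem Nr.symm {a b : V × V} (h : Nr Γ a b) : Nr Γ b a := by
  obtain ⟨h1, h2, h3, h4, h5, h6⟩ := h
  exact ⟨h1.imp Eq.symm SimpleGraph.Adj.symm, h2.imp Eq.symm SimpleGraph.Adj.symm, h6, h5, h4, h3⟩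

theorem Nr.self {a : V × V} (h : a.1 ≠ a.2) : Nr Γ a a := ⟨Or.inl rfl, Or.inl rfl, h, h, h, h⟩

theorem cellPt_pos {u v w : V} {t : ℝ} (h : 0 < cellPt u v t w) : w = u ∨ w = v := by
  by_contra hc
  push Not at hc
  simp [cellPt, hc.1, hc.2] at h

theorem cellPt_mid {u v a b : V} (ha : a = u ∨ a = v) (hb : b = u ∨ b = v) :
    ∃ s ∈ Set.Icc (0:ℝ) 1, cellPt a b (1/2) = cellPt u v s := by
  rcases ha with rfl | rfl <;> rcases hb with rfl | rfl
  · exact ⟨1, by simp, by funext w; simp only [cellPt]; split_ifs <;> norm_num⟩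
  · exact ⟨1/2, by constructor <;> norm_num, rfl⟩
  · exact ⟨1/2, by constructor <;> norm_num, by
      funext w; simp only [cellPt]; split_ifs <;> norm_num⟩
  · exact ⟨0, by simp, by funext w; simp only [cellPt]; split_ifs <;> norm_num⟩

theorem cellPt_comb (u v : V) (s t x y : ℝ) (h : x + y = 1) :
    x • cellPt u v s + y • cellPt u v t = cellPt u v (x * s + y * t) := by
  funext w
  simp only [cellPt, Pi.add_apply, Pi.smul_apply, smul_eq_mul]
  have : y = 1 - x := by linarith
  subst this
  split_ifs <;> ring

theorem cellPt_mid_pos (a b : V) : 0 < cellPt a b (1/2) a ∧ 0 < cellPt a b (1/2) b := by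
  constructor <;> simp only [cellPt] <;> split_ifs <;> norm_num at *

theorem cell_or {u v a b : V} (h : IsClosedCell Γ u v) (ha : a = u ∨ a = v) (hb : b = u ∨ b = v) :
    IsClosedCell Γ a b := by
  rcases h with rfl | h
  · rcases ha with rfl | rfl <;> rcases hb with rfl | rfl <;> exact Or.inl rfl
  · rcases ha with rfl | rfl <;> rcases hb with rfl | rfl
    · exact Or.inl rfl
    · exact Or.inr h
    · exact Or.inr h.symm
    · exact Or.inl rfl

variable (Γ) in
abbrev DD : Type := ↥(D2Config Γ)

variable (Γ) in
def UU (a b : V × V) : Set (DD Γ) :=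
  {p | (0 < p.1.1 a.1 ∧ 0 < p.1.1 b.1) ∧ (0 < p.1.2 a.2 ∧ 0 < p.1.2 b.2)}

def mid (a b : V × V) : (V → ℝ) × (V → ℝ) := (cellPt a.1 b.1 (1/2), cellPt a.2 b.2 (1/2))

theorem mid_mem {a b : V × V} (h : Nr Γ a b) : mid a b ∈ D2Config Γ :=
  ⟨a.1, b.1, a.2, b.2, h.1, h.2.1, h.2.2.1, h.2.2.2.1, h.2.2.2.2.1, h.2.2.2.2.2, 1/2, 1/2,
    by constructor <;> norm_num, by constructor <;> norm_num, rfl⟩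

theorem Nr_of_mem {a b : V × V} {p : DD Γ} (h : p ∈ UU Γ a b) : Nr Γ a b := by
  obtain ⟨p, u, v, u', v', h1, h2, h3, h4, h5, h6, t, t', ht, ht', rfl⟩ := p
  obtain ⟨⟨k1, k2⟩, k3, k4⟩ := h
  have k1 := cellPt_pos k1
  have k2 := cellPt_pos k2
  have k3 := cellPt_pos k3
  have k4 := cellPt_pos k4
  refine ⟨cell_or h1 k1 k2, cell_or h2 k3 k4, ?_, ?_, ?_, ?_⟩ <;> grind

theorem UU_star {a b : V × V} (h : Nr Γ a b) :
    StarConvex ℝ (mid a b) (Subtype.val '' UU Γ a b) := by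
  rintro _ ⟨⟨p, hp⟩, hU, rfl⟩ x y hx hy hxy
  have hp' := hp
  obtain ⟨u, v, u', v', h1, h2, h3, h4, h5, h6, t, t', ht, ht', rfl⟩ := hp'
  have hU' := hU
  obtain ⟨⟨k1, k2⟩, k3, k4⟩ := hU'
  simp only at k1 k2 k3 k4
  obtain ⟨s, hs, e1⟩ := cellPt_mid (cellPt_pos k1) (cellPt_pos k2)
  obtain ⟨s', hs', e2⟩ := cellPt_mid (cellPt_pos k3) (cellPt_pos k4)
  have key : ∀ s t : ℝ, s ∈ Set.Icc (0:ℝ) 1 → t ∈ Set.Icc (0:ℝ) 1 → x * s + y * t ∈ Set.Icc (0:ℝ) 1 :=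
    fun s t hs ht => convex_Icc (0:ℝ) 1 hs ht hx hy hxy
  have hpos : ∀ α β : ℝ, 0 < α → 0 < β → 0 < x * α + y * β := by
    intro α β hα hβ
    rcases hx.lt_or_eq with hx | rfl
    · have := mul_pos hx hα
      have := mul_nonneg hy hβ.le
      linarith
    · have : y = 1 := by linarith
      subst this; simpa using hβ
  have m1 := cellPt_mid_pos a.1 b.1
  have m2 := cellPt_mid_pos a.2 b.2
  refine ⟨⟨x • mid a b + y • (cellPt u v t, cellPt u' v' t'),
    u, v, u', v', h1, h2, h3, h4, h5, h6, x * s + y * t, x * s' + y * t', key _ _ hs ht,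
    key _ _ hs' ht', ?_⟩, ?_, rfl⟩
  · simp only [mid, Prod.smul_mk, Prod.mk_add_mk]
    rw [e1, e2, cellPt_comb _ _ _ _ _ _ hxy, cellPt_comb _ _ _ _ _ _ hxy]
  · exact ⟨⟨hpos _ _ m1.1 k1, hpos _ _ m1.2 k2⟩, hpos _ _ m2.1 k3, hpos _ _ m2.2 k4⟩

def midp {a b : V × V} (h : Nr Γ a b) : DD Γ := ⟨mid a b, mid_mem h⟩
theorem midp_mem {a b : V × V} (h : Nr Γ a b) : midp h ∈ UU Γ a b :=
  ⟨cellPt_mid_pos a.1 b.1, cellPt_mid_pos a.2 b.2⟩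

theorem UU_contr {a b : V × V} (h : Nr Γ a b) : ContractibleSpace (UU Γ a b) := by
  have : ContractibleSpace (Subtype.val '' UU Γ a b) :=
    (UU_star h).contractibleSpace ⟨_, _, midp_mem h, rfl⟩
  exact (Topology.IsEmbedding.subtypeVal.homeomorphImage (UU Γ a b)).contractibleSpace_iff.2 this

theorem UU_open (a b : V × V) : IsOpen (UU Γ a b) := by
  have h1 : ∀ w : V, Continuous fun p : DD Γ => p.1.1 w := fun w => by fun_prop
  have h2 : ∀ w : V, Continuous fun p : DD Γ => p.1.2 w := fun w => by fun_prop
  exact ((isOpen_lt continuous_const (h1 _)).inter (isOpen_lt continuous_const (h1 _))).inter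
    ((isOpen_lt continuous_const (h2 _)).inter (isOpen_lt continuous_const (h2 _)))

theorem cellPt_cover (u v : V) (t : ℝ) (ht : t ∈ Set.Icc (0:ℝ) 1) : ∃ a, 0 < cellPt u v t a := by
  rcases ht.1.lt_or_eq with h | rfl
  · refine ⟨u, ?_⟩
    simp only [cellPt]; split_ifs
    · linarith
    · linarith [ht.2]
    · linarith [ht.2]
    · linarith [ht.2]
  · exact ⟨v, by simp [cellPt]⟩

theorem UU_cover (p : DD Γ) : ∃ a, p ∈ UU Γ a a := by
  obtain ⟨p, u, v, u', v', h1, h2, h3, h4, h5, h6, t, t', ht, ht', rfl⟩ := p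
  obtain ⟨a, ha⟩ := cellPt_cover u v t ht
  obtain ⟨a', ha'⟩ := cellPt_cover u' v' t' ht'
  exact ⟨(a, a'), ⟨ha, ha⟩, ha', ha'⟩

theorem UU_inter {a b : V × V} : UU Γ a b = UU Γ a a ∩ UU Γ b b := by
  ext p; simp only [UU, Set.mem_inter_iff, Set.mem_setOf_eq]; tauto
end topo

section cov
open CategoryTheory Topology

/-- A good open cover with marked points. -/
structure GC (X : Type) [TopologicalSpace X] (ι : Type) where
  U : ι → Set X
  op : ∀ i, IsOpen (U i)
  idx : X → ι
  hidx : ∀ x, x ∈ U (idx x)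
  pt : ι → X
  hpt : ∀ i, pt i ∈ U i
  idx_pt : ∀ i, idx (pt i) = i
  sc : ∀ i (x y : X) (γ γ' : Path x y), (∀ t, γ t ∈ U i) → (∀ t, γ' t ∈ U i) →
    Path.Homotopic.Quotient.mk γ = Path.Homotopic.Quotient.mk γ'
  pc : ∀ i j (x y : X), x ∈ U i ∩ U j → y ∈ U i ∩ U j → ∃ γ : Path x y, ∀ t, γ t ∈ U i ∩ U j

namespace GC
variable {X : Type} [TopologicalSpace X] {ι : Type} (G : GC X ι)

abbrev fg (x : X) : FundamentalGroupoid X := FundamentalGroupoid.mk x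

theorem path_ind (P : ∀ x y : X, Path.Homotopic.Quotient x y → Prop)
    (htr : ∀ x y z f g, P x y f → P y z g → P x z (f.trans g))
    (hloc : ∀ i x y (γ : Path x y), (∀ t, γ t ∈ G.U i) → P x y (Path.Homotopic.Quotient.mk γ))
    {x y : X} (f : Path.Homotopic.Quotient x y) : P x y f := by
  induction f using Path.Homotopic.Quotient.ind with | mk γ =>
  obtain ⟨t, ht0, hmon, ⟨m, hm⟩, hs⟩ := exists_monotone_Icc_subset_open_cover_unitInterval
    (c := fun i => γ ⁻¹' G.U i) (fun i => (G.op i).preimage γ.continuous)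
    (fun s _ => Set.mem_iUnion.2 ⟨G.idx (γ s), G.hidx _⟩)
  have key : ∀ n, P _ _ (Path.Homotopic.Quotient.mk (γ.subpath 0 (t n))) := by
    intro n
    induction n with
    | zero =>
      apply hloc (G.idx (γ 0))
      intro s
      have : γ.subpath 0 (t 0) s ∈ Set.range (γ.subpath 0 (t 0)) := ⟨s, rfl⟩
      rw [Path.range_subpath_of_le _ _ _ (by rw [ht0])] at this
      obtain ⟨r, hr, he⟩ := this
      rw [← he]
      rw [ht0] at hr
      have : r = 0 := le_antisymm hr.2 hr.1
      rw [this]; exact G.hidx _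
    | succ n ih =>
      have h1 : P _ _ (Path.Homotopic.Quotient.mk (γ.subpath (t n) (t (n+1)))) := by
        obtain ⟨i, hi⟩ := hs n
        apply hloc i
        intro s
        have : γ.subpath (t n) (t (n+1)) s ∈ Set.range (γ.subpath (t n) (t (n+1))) := ⟨s, rfl⟩
        rw [Path.range_subpath_of_le _ _ _ (hmon (Nat.le_succ n))] at this
        obtain ⟨r, hr, he⟩ := this
        rw [← he]
        exact hi hr
      have := htr _ _ _ _ _ ih h1
      rw [← Path.Homotopic.Quotient.mk_trans] at this
      rwa [Path.Homotopic.Quotient.eq.2 ⟨Path.Homotopy.subpathTransSubpath γ 0 (t n) (t (n+1))⟩] at this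
  have := key m
  rw [hm m le_rfl] at this
  have h2 : ∀ (a b : X) (ha : a = x) (hb : b = y) (δ : Path a b), δ = γ.cast ha hb →
      P a b (Path.Homotopic.Quotient.mk δ) → P x y (Path.Homotopic.Quotient.mk γ) := by
    intro a b ha hb δ hδ h
    subst ha hb hδ
    exact h
  exact h2 _ _ γ.source γ.target _ (Path.subpath_zero_one γ) this

/-- cocycles on a good cover -/
structure TC (K : Type) [Group K] where
  t : ι → ι → K
  tri : ∀ i j l, (G.U i ∩ G.U j ∩ G.U l).Nonempty → t i j * t j l = t i l

variable {G} {K : Type} [Group K]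
theorem TC.self (c : G.TC K) (i : ι) (h : (G.U i).Nonempty) : c.t i i = 1 := by
  have := c.tri i i i (by simpa using h)
  simpa using this
theorem TC.inv (c : G.TC K) (i j : ι) (h : (G.U i ∩ G.U j).Nonempty) : c.t i j * c.t j i = 1 := by
  obtain ⟨x, hx⟩ := h
  rw [c.tri i j i ⟨x, hx, hx.1⟩, c.self i ⟨x, hx.1⟩]

def TC.core (c : G.TC K) [TopologicalSpace K] [DiscreteTopology K] : FiberBundleCore ι X K where
  baseSet := G.U
  isOpen_baseSet := G.op
  indexAt := G.idx
  mem_baseSet_at := G.hidx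
  coordChange i j _ k := k * c.t i j
  coordChange_self i x hx v := by rw [c.self i ⟨x, hx⟩, mul_one]
  continuousOn_coordChange i j := by
    apply Continuous.continuousOn
    exact (continuous_of_discreteTopology (f := fun k : K => k * c.t i j)).comp continuous_snd
  coordChange_comp i j k x hx v := by rw [mul_assoc, c.tri i j k ⟨x, hx⟩]

theorem TC.kappa (c : G.TC K) : ∃ κ : ∀ x y : X, Path.Homotopic.Quotient x y → K,
    (∀ x y z f g, κ x z (f.trans g) = κ x y f * κ y z g) ∧
    (∀ i x y (γ : Path x y), (∀ t, γ t ∈ G.U i) →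
      κ x y (Path.Homotopic.Quotient.mk γ) = c.t (G.idx x) i * c.t i (G.idx y)) := by
  let _ : TopologicalSpace K := ⊥
  have _ : DiscreteTopology K := ⟨rfl⟩
  let Z := c.core
  have cov : IsCoveringMap Z.proj := FiberBundle.isCoveringMap (F := K) (E := Z.Fiber)
  let val : ∀ {x : X}, Z.proj ⁻¹' {x} → K := fun e => e.1.2
  have hM : ∀ i x y (γ : Path x y), (∀ t, γ t ∈ G.U i) → ∀ e : Z.proj ⁻¹' {x},
      val (cov.monodromy (Path.Homotopic.Quotient.mk γ) e) =
        val e * (c.t (G.idx x) i * c.t i (G.idx y)) := by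
    rintro i x y γ hγ ⟨⟨x', k⟩, hx⟩
    obtain rfl : x' = x := hx
    change K at k
    let Γ : C(unitInterval, Z.TotalSpace) :=
      ⟨fun s => (Z.localTriv i).toOpenPartialHomeomorph.symm (γ s, k * c.t (G.idx x') i), by
        refine ContinuousOn.comp_continuous (Z.localTriv i).toOpenPartialHomeomorph.continuousOn_symm
          (by fun_prop) ?_
        intro s
        exact (Z.mem_localTriv_target i _).2 (hγ s)⟩
    have hΓ : ∀ s, Γ s = ⟨γ s, k * c.t (G.idx x') i * c.t i (G.idx (γ s))⟩ := fun s =>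
      Z.localTriv_symm_apply i _
    have hx0 : x' ∈ G.U i := by simpa using hγ 0
    have h0 : Γ 0 = ⟨x', k⟩ := by
      rw [hΓ]
      have : ∀ z : X, z = x' → (⟨z, k * c.t (G.idx x') i * c.t i (G.idx z)⟩ : Z.TotalSpace) = ⟨x', k⟩ := by
        rintro z rfl
        rw [mul_assoc, c.inv _ _ ⟨z, G.hidx z, hx0⟩, mul_one]
      exact this _ γ.source
    have h1 := (cov.eq_liftPath_iff' (γ := (γ : C(unitInterval, X))) (e := (⟨x', k⟩ : Z.TotalSpace)) (Γ := Γ) γ.source).2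
      ⟨by ext s; simp [hΓ, FiberBundleCore.proj], h0⟩
    change (cov.liftPath (γ : C(unitInterval, X)) _ _ 1).2 = _
    rw [← h1, hΓ]
    change k * c.t (G.idx x') i * c.t i (G.idx (γ 1)) = k * _
    rw [γ.target, mul_assoc]
  have hex : ∀ x y (f : Path.Homotopic.Quotient x y), ∃ κ, ∀ e, val (cov.monodromy f e) = val e * κ := by
    intro x y f
    refine G.path_ind (fun x y f => ∃ κ, ∀ e, val (cov.monodromy f e) = val e * κ) ?_ ?_ f
    · rintro x y z f g ⟨a, ha⟩ ⟨b, hb⟩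
      exact ⟨a * b, fun e => by rw [cov.monodromy_trans_apply, hb, ha, mul_assoc]⟩
    · intro i x y γ hγ
      exact ⟨_, hM i x y γ hγ⟩
  choose κ hκ using hex
  let e0 : ∀ x : X, Z.proj ⁻¹' {x} := fun x => ⟨⟨x, (1 : K)⟩, rfl⟩
  have huniq : ∀ x y f k, (∀ e, val (cov.monodromy f e) = val e * k) → κ x y f = k := by
    intro x y f k h
    have := (hκ x y f (e0 x)).symm.trans (h (e0 x))
    exact mul_left_cancel this
  refine ⟨κ, ?_, ?_⟩
  · intro x y z f g
    apply huniq
    intro e; rw [cov.monodromy_trans_apply, hκ, hκ, mul_assoc]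
  · intro i x y γ hγ
    exact huniq _ _ _ _ (hM i x y γ hγ)
end GC
end cov

section star
open CategoryTheory Topology

/-- breadth first ranks -/
theorem exists_rank {ι : Type} (R : ι → ι → Prop) (i0 : ι) (h : ∀ a, Relation.ReflTransGen R i0 a) :
    ∃ (rk : ι → ℕ) (par : ι → ι), ∀ a, a ≠ i0 → R (par a) a ∧ rk (par a) < rk a := by
  classical
  let L : ℕ → Set ι := fun n => Nat.rec {i0} (fun _ s => {b | ∃ a ∈ s, R a b}) n
  have hL : ∀ a, ∃ n, a ∈ L n := by
    intro a
    induction h a with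
    | refl => exact ⟨0, rfl⟩
    | tail _ h2 ih => obtain ⟨n, hn⟩ := ih; exact ⟨n + 1, _, hn, h2⟩
  let rk : ι → ℕ := fun a => sInf {n | a ∈ L n}
  have key : ∀ a, ∃ b, a ≠ i0 → R b a ∧ rk b < rk a := by
    intro a
    by_cases ha : a = i0
    · exact ⟨a, fun h => absurd ha h⟩
    have h1 : sInf {n | a ∈ L n} ∈ {n | a ∈ L n} := Nat.sInf_mem (hL a)
    change a ∈ L (rk a) at h1
    rcases hn : rk a with _ | n
    · rw [hn] at h1; exact absurd h1 ha
    · rw [hn] at h1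
      obtain ⟨b, hb, hR⟩ := h1
      exact ⟨b, fun _ => ⟨hR, Nat.lt_succ_of_le (Nat.sInf_le hb)⟩⟩
  choose par hpar using key
  exact ⟨rk, par, hpar⟩

namespace GC
variable {X : Type} [TopologicalSpace X] {ι : Type} (G : GC X ι)

def J (i : ι) {x y : X} (hx : x ∈ G.U i) (hy : y ∈ G.U i) : fg x ⟶ fg y :=
  Path.Homotopic.Quotient.mk (G.pc i i x y ⟨hx, hx⟩ ⟨hy, hy⟩).choose

theorem J_eq (i : ι) {x y : X} (hx : x ∈ G.U i) (hy : y ∈ G.U i) (γ : Path x y)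
    (h : ∀ t, γ t ∈ G.U i) : G.J i hx hy = Path.Homotopic.Quotient.mk γ :=
  G.sc i x y _ _ (fun t => ((G.pc i i x y ⟨hx, hx⟩ ⟨hy, hy⟩).choose_spec t).1) h

theorem J_ex (i : ι) {x y : X} (hx : x ∈ G.U i) (hy : y ∈ G.U i) : ∃ γ : Path x y,
    (∀ t, γ t ∈ G.U i) ∧ G.J i hx hy = Path.Homotopic.Quotient.mk γ :=
  ⟨_, fun t => ((G.pc i i x y ⟨hx, hx⟩ ⟨hy, hy⟩).choose_spec t).1, rfl⟩

theorem J_comp (i : ι) {x y z : X} (hx : x ∈ G.U i) (hy : y ∈ G.U i) (hz : z ∈ G.U i) :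
    G.J i hx hy ≫ G.J i hy hz = G.J i hx hz := by
  obtain ⟨γ, hγ, e⟩ := G.J_ex i hx hy
  obtain ⟨γ', hγ', e'⟩ := G.J_ex i hy hz
  rw [e, e']
  refine ((G.J_eq i hx hz (γ.trans γ') ?_).trans ?_).symm
  · intro t
    rw [Path.trans_apply]; split_ifs
    · exact hγ _
    · exact hγ' _
  · rfl

theorem J_self (i : ι) {x : X} (hx : x ∈ G.U i) : G.J i hx hx = 𝟙 _ :=
  G.J_eq i hx hx (Path.refl x) (fun _ => hx)

theorem J_two (i j : ι) {x y : X} (hx : x ∈ G.U i) (hy : y ∈ G.U i) (hx' : x ∈ G.U j) (hy' : y ∈ G.U j) :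
    G.J i hx hy = G.J j hx' hy' := by
  obtain ⟨γ, hγ⟩ := G.pc i j x y ⟨hx, hx'⟩ ⟨hy, hy'⟩
  rw [G.J_eq i hx hy γ fun t => (hγ t).1, G.J_eq j hx' hy' γ fun t => (hγ t).2]

def T (i j : ι) (h : (G.U i ∩ G.U j).Nonempty) : fg (G.pt i) ⟶ fg (G.pt j) :=
  G.J i (G.hpt i) h.choose_spec.1 ≫ G.J j h.choose_spec.2 (G.hpt j)

theorem T_eq (i j : ι) (h : (G.U i ∩ G.U j).Nonempty) {m : X} (h1 : m ∈ G.U i) (h2 : m ∈ G.U j) :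
    G.T i j h = G.J i (G.hpt i) h1 ≫ G.J j h2 (G.hpt j) := by
  rw [T, ← G.J_comp i (G.hpt i) h1 h.choose_spec.1, Category.assoc,
    G.J_two i j h1 h.choose_spec.1 h2 h.choose_spec.2, G.J_comp]

theorem T_tri (i j l : ι) (h : (G.U i ∩ G.U j ∩ G.U l).Nonempty) :
    G.T i j (h.mono fun _ h => h.1) ≫ G.T j l (h.mono fun _ h => ⟨h.1.2, h.2⟩) =
      G.T i l (h.mono fun _ h => ⟨h.1.1, h.2⟩) := by
  obtain ⟨m, ⟨h1, h2⟩, h3⟩ := h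
  rw [G.T_eq i j _ h1 h2, G.T_eq j l _ h2 h3, G.T_eq i l _ h1 h3, Category.assoc,
    ← Category.assoc (G.J j h2 _), G.J_comp, G.J_self, Category.id_comp]

variable {G}
structure Star (G : GC X ι) (R : ι → ι → Prop) (i0 : ι) where
  q : G.TC (FundamentalGroup X (G.pt i0))
  gen : ∀ H : Subgroup (FundamentalGroup X (G.pt i0)),
    (∀ i j, (G.U i ∩ G.U j).Nonempty → q.t i j ∈ H) → H = ⊤
  lift : ∀ (K : Type) [Group K] (c : G.TC K), ∃ (φ : FundamentalGroup X (G.pt i0) →* K) (h : ι → K),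
    ∀ i j, (G.U i ∩ G.U j).Nonempty → φ (q.t i j) = h i * c.t i j * (h j)⁻¹
  conn : ∀ Q : ι → Prop, Q i0 → (∀ a b, R a b → q.t a b = 1 → Q a → Q b) → ∀ a, Q a
  joined : ∀ x : X, Nonempty (Path x (G.pt i0))

section
variable (R : ι → ι → Prop) (i0 : ι) (hR : ∀ a b, R a b → (G.U a ∩ G.U b).Nonempty)
  (rk : ι → ℕ) (par : ι → ι) (hp : ∀ a, a ≠ i0 → R (par a) a ∧ rk (par a) < rk a)

open Classical in
def PP (a : ι) : fg (G.pt i0) ⟶ fg (G.pt a) :=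
  if h : a = i0 then eqToHom (by rw [h]) else
    PP (par a) ≫ G.T (par a) a (hR _ _ (hp a h).1)
  termination_by rk a
  decreasing_by exact (hp a h).2

def qq : G.TC (FundamentalGroup X (G.pt i0)) where
  t i j := open Classical in if h : (G.U j ∩ G.U i).Nonempty then
    (PP R i0 hR rk par hp j ≫ G.T j i h ≫ Groupoid.inv (PP R i0 hR rk par hp i) : fg (G.pt i0) ⟶ fg (G.pt i0)) else 1
  tri i j l h := by
    obtain ⟨m, ⟨h1, h2⟩, h3⟩ := h
    rw [dif_pos ⟨m, h2, h1⟩, dif_pos ⟨m, h3, h2⟩, dif_pos ⟨m, h3, h1⟩]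
    have := G.T_tri l j i ⟨m, ⟨h3, h2⟩, h1⟩
    rw [← this, End.mul_def]
    simp

theorem star_exists (R : ι → ι → Prop) (i0 : ι) (hR : ∀ a b, R a b → (G.U a ∩ G.U b).Nonempty)
    (hconn : ∀ a, Relation.ReflTransGen R i0 a) : Nonempty (Star G R i0) := by
  classical
  obtain ⟨rk, par, hp⟩ := exists_rank R i0 hconn
  let P := PP R i0 hR rk par hp
  have hP0 : P i0 = 𝟙 _ := by simp only [P]; rw [PP, dif_pos rfl]; rfl
  have hPa : ∀ a (h : a ≠ i0), P a = P (par a) ≫ G.T (par a) a (hR _ _ (hp a h).1) := by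
    intro a h; simp only [P]; rw [PP, dif_neg h]
  let q := qq R i0 hR rk par hp
  have hq : ∀ i j (h : (G.U j ∩ G.U i).Nonempty), q.t i j =
    (P j ≫ G.T j i h ≫ Groupoid.inv (P i) : fg (G.pt i0) ⟶ fg (G.pt i0)) := fun i j h => dif_pos h
  have h5 : ∀ a {w : FundamentalGroupoid X} (r : fg (G.pt a) ⟶ w), Groupoid.inv (P a) ≫ P a ≫ r = r := by
    intro a w r; rw [← Category.assoc, Groupoid.inv_comp, Category.id_comp]
  refine ⟨⟨q, ?_, ?_, ?_, ?_⟩⟩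
  · intro H hH
    rw [eq_top_iff]
    rintro f -
    have key := G.path_ind (fun x y (f : fg x ⟶ fg y) => ∀ i j (hx : x ∈ G.U i) (hy : y ∈ G.U j),
      (P i ≫ G.J i (G.hpt i) hx ≫ f ≫ G.J j hy (G.hpt j) ≫ Groupoid.inv (P j) :
        fg (G.pt i0) ⟶ fg (G.pt i0)) ∈ H) ?_ ?_ f i0 i0 (G.hpt i0) (G.hpt i0)
    · simpa [hP0, G.J_self] using key
    · intro x y z f g hf hg i j hx hz
      have h1 := hf i (G.idx y) hx (G.hidx y)
      have h2 := hg (G.idx y) j (G.hidx y) hz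
      have h3 := H.mul_mem h2 h1
      rw [End.mul_def] at h3
      refine Set.mem_of_eq_of_mem (s := (H : Set (FundamentalGroup X (G.pt i0)))) ?_ h3
      have : G.J (G.idx y) (G.hidx y) (G.hpt _) ≫ G.J (G.idx y) (G.hpt _) (G.hidx y) = 𝟙 _ := by
        rw [G.J_comp, G.J_self]
      have h4 : ∀ {w : FundamentalGroupoid X} (r : fg y ⟶ w), G.J (G.idx y) (G.hidx y) (G.hpt _) ≫ G.J (G.idx y) (G.hpt _) (G.hidx y) ≫ r = r := by
        intro w r; rw [← Category.assoc, this, Category.id_comp]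
      simp only [Category.assoc, h5, h4]
      change P i ≫ G.J i _ hx ≫ (f ≫ g) ≫ _ = _
      rw [Category.assoc]
    · intro l x y γ hγ i j hx hy
      have hxl : x ∈ G.U l := by simpa using hγ 0
      have hyl : y ∈ G.U l := by simpa using hγ 1
      rw [← G.J_eq l hxl hyl γ hγ]
      have h1 := hH l i ⟨x, hxl, hx⟩
      have h2 := hH j l ⟨y, hy, hyl⟩
      have h3 := H.mul_mem h2 h1
      have n1 : (G.U i ∩ G.U l).Nonempty := ⟨x, hx, hxl⟩
      have n2 : (G.U l ∩ G.U j).Nonempty := ⟨y, hyl, hy⟩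
      rw [hq l i n1, hq j l n2, G.T_eq i l _ hx hxl, G.T_eq l j _ hyl hy,
        End.mul_def] at h3
      refine Set.mem_of_eq_of_mem (s := (H : Set (FundamentalGroup X (G.pt i0)))) ?_ h3
      have h4 : ∀ {w : FundamentalGroupoid X} (r : fg y ⟶ w), G.J l hxl (G.hpt _) ≫ G.J l (G.hpt _) hyl ≫ r = G.J l hxl hyl ≫ r := by
        intro w r; rw [← Category.assoc, G.J_comp]
      simp only [Category.assoc, h5, h4]
  · intro K _ c
    obtain ⟨κ, hκ, hκ'⟩ := c.kappa
    have hκc : ∀ {x y z : X} (f : fg x ⟶ fg y) (g : fg y ⟶ fg z), κ x z (f ≫ g) = κ x y f * κ y z g :=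
      fun f g => hκ _ _ _ f g
    have hκ1 : ∀ x, κ x x (𝟙 (fg x)) = 1 := by
      intro x
      have := hκc (𝟙 (fg x)) (𝟙 (fg x))
      rw [Category.comp_id] at this
      simpa using this
    have hκi : ∀ {x y : X} (f : fg x ⟶ fg y), κ y x (Groupoid.inv f) = (κ x y f)⁻¹ := by
      intro x y f
      rw [eq_inv_iff_mul_eq_one, ← hκc, Groupoid.inv_comp, hκ1]
    have hJ : ∀ i {x y : X} (hx : x ∈ G.U i) (hy : y ∈ G.U i), κ x y (G.J i hx hy) =
        c.t (G.idx x) i * c.t i (G.idx y) := by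
      intro i x y hx hy
      obtain ⟨γ, hγ, e⟩ := G.J_ex i hx hy
      rw [e]; exact hκ' i x y γ hγ
    have hT : ∀ i j h, κ _ _ (G.T i j h) = c.t i j := by
      intro i j h
      obtain ⟨m, h1, h2⟩ := id h
      rw [G.T_eq i j h h1 h2, hκc, hJ, hJ, G.idx_pt, G.idx_pt, c.self i ⟨m, h1⟩, c.self j ⟨m, h2⟩,
        one_mul, mul_one]
      exact c.tri _ _ _ ⟨m, ⟨h1, G.hidx m⟩, h2⟩
    let φ : FundamentalGroup X (G.pt i0) →* K :=
      MonoidHom.mk' (fun f => (κ _ _ f)⁻¹) (by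
        intro a b
        rw [End.mul_def]
        exact (congrArg (·⁻¹) (hκc b a)).trans (mul_inv_rev _ _))
    refine ⟨φ, fun i => κ _ _ (P i), ?_⟩
    intro i j h
    have h' : (G.U j ∩ G.U i).Nonempty := by rwa [Set.inter_comm]
    change (κ _ _ (q.t i j))⁻¹ = _
    rw [hq i j h', hκc, hκc, hT, hκi, ← mul_inv_eq_one]
    have := eq_inv_of_mul_eq_one_left (c.inv i j h)
    rw [this]; group
  · intro Q h0 hstep
    have : ∀ n a, rk a = n → Q a := by
      intro n
      induction n using Nat.strong_induction_on with | _ n ih =>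
      rintro a rfl
      by_cases ha : a = i0
      · rw [ha]; exact h0
      obtain ⟨h1, h2⟩ := hp a ha
      refine hstep _ a h1 ?_ (ih _ h2 _ rfl)
      have hn := hR _ _ h1
      have hn' : (G.U a ∩ G.U (par a)).Nonempty := by rwa [Set.inter_comm]
      rw [hq _ _ hn', hPa a ha, Category.assoc, ← Category.assoc (G.T (par a) a _)]
      obtain ⟨m, h1, h2⟩ := hn
      rw [G.T_tri (par a) a (par a) ⟨m, ⟨h1, h2⟩, h1⟩, G.T_eq (par a) (par a) _ h1 h1, G.J_comp, G.J_self,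
        Category.id_comp, Groupoid.comp_inv]
      rfl
    exact fun a => this _ a rfl
  · intro x
    have f : fg x ⟶ fg (G.pt i0) := G.J (G.idx x) (G.hidx x) (G.hpt _) ≫ Groupoid.inv (P (G.idx x))
    change Path.Homotopic.Quotient x (G.pt i0) at f
    induction f using Path.Homotopic.Quotient.ind with | mk γ => exact ⟨γ⟩
end
end GC
end star

section topo2
open CategoryTheory Topology
variable {V : Type} [DecidableEq V] {Γ : SimpleGraph V}

theorem UU_ex (Γ : SimpleGraph V) (p : DD Γ) : ∃ a : {a : V × V // a.1 ≠ a.2}, p ∈ UU Γ a.1 a.1 := by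
  obtain ⟨a, ha⟩ := UU_cover p
  exact ⟨⟨a, (Nr_of_mem ha).2.2.1⟩, ha⟩

theorem UU_uniq {a b : V × V} (h : Nr Γ a a) (hb : midp h ∈ UU Γ b b) : b = a := by
  obtain ⟨⟨h1, _⟩, h2, _⟩ := hb
  have h1 := cellPt_pos h1
  have h2 := cellPt_pos h2
  simp only [or_self] at h1 h2
  exact Prod.ext h1 h2

def gc (Γ : SimpleGraph V) : GC (DD Γ) {a : V × V // a.1 ≠ a.2} where
  U i := UU Γ i.1 i.1
  op i := UU_open _ _
  idx p := (UU_ex Γ p).choose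
  hidx p := (UU_ex Γ p).choose_spec
  pt i := midp (Nr.self i.2)
  hpt i := midp_mem _
  idx_pt i := Subtype.ext (UU_uniq _ (UU_ex Γ (midp (Nr.self i.2))).choose_spec)
  sc i x y γ γ' h h' := by
    have := UU_contr (Nr.self (Γ := Γ) i.2)
    have hx : x ∈ UU Γ i.1 i.1 := by simpa using h 0
    have hy : y ∈ UU Γ i.1 i.1 := by simpa using h 1
    let δ : Path (⟨x, hx⟩ : UU Γ i.1 i.1) ⟨y, hy⟩ :=
      ⟨⟨fun t => ⟨γ t, h t⟩, by fun_prop⟩, by simp, by simp⟩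
    let δ' : Path (⟨x, hx⟩ : UU Γ i.1 i.1) ⟨y, hy⟩ :=
      ⟨⟨fun t => ⟨γ' t, h' t⟩, by fun_prop⟩, by simp, by simp⟩
    have e := SimplyConnectedSpace.paths_homotopic δ δ'
    have e2 := e.map ⟨Subtype.val, continuous_subtype_val⟩
    exact Path.Homotopic.Quotient.eq.2 e2
  pc i j x y hx hy := by
    have e : UU Γ i.1 i.1 ∩ UU Γ j.1 j.1 = UU Γ i.1 j.1 := UU_inter.symm
    rw [e] at hx hy ⊢
    have := UU_contr (Nr_of_mem hx)
    obtain ⟨δ⟩ := PathConnectedSpace.joined (⟨x, hx⟩ : UU Γ i.1 j.1) ⟨y, hy⟩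
    exact ⟨δ.map continuous_subtype_val, fun t => (δ t).2⟩

theorem gc_inter (i j : {a : V × V // a.1 ≠ a.2}) :
    ((gc Γ).U i ∩ (gc Γ).U j).Nonempty ↔ Nr Γ i.1 j.1 := by
  have e : (gc Γ).U i ∩ (gc Γ).U j = UU Γ i.1 j.1 := UU_inter.symm
  rw [e]
  exact ⟨fun ⟨x, hx⟩ => Nr_of_mem hx, fun h => ⟨_, midp_mem h⟩⟩

theorem gc_tri (i j l : {a : V × V // a.1 ≠ a.2}) (h : ((gc Γ).U i ∩ (gc Γ).U j ∩ (gc Γ).U l).Nonempty) :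
    Nr Γ i.1 j.1 ∧ Nr Γ j.1 l.1 ∧ Nr Γ i.1 l.1 ∧ (i.1.1 = j.1.1 ∨ j.1.1 = l.1.1 ∨ i.1.1 = l.1.1) ∧
      (i.1.2 = j.1.2 ∨ j.1.2 = l.1.2 ∨ i.1.2 = l.1.2) := by
  obtain ⟨p, ⟨h1, h2⟩, h3⟩ := h
  refine ⟨(gc_inter i j).1 ⟨p, h1, h2⟩, (gc_inter j l).1 ⟨p, h2, h3⟩, (gc_inter i l).1 ⟨p, h1, h3⟩, ?_⟩
  have h1 : p ∈ UU Γ i.1 i.1 := h1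
  have h2 : p ∈ UU Γ j.1 j.1 := h2
  have h3 : p ∈ UU Γ l.1 l.1 := h3
  obtain ⟨p, hp⟩ := p
  have hp' := hp
  obtain ⟨u, v, u', v', -, -, -, -, -, -, t, t', -, -, rfl⟩ := hp'
  have a1 := cellPt_pos h1.1.1
  have a2 := cellPt_pos h2.1.1
  have a3 := cellPt_pos h3.1.1
  have b1 := cellPt_pos h1.2.1
  have b2 := cellPt_pos h2.2.1
  have b3 := cellPt_pos h3.2.1
  grind

theorem gc_tri' (i j l : {a : V × V // a.1 ≠ a.2}) (h : Nr Γ i.1 l.1) (h1 : j.1.1 = i.1.1 ∨ j.1.1 = l.1.1)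
    (h2 : j.1.2 = i.1.2 ∨ j.1.2 = l.1.2) : ((gc Γ).U i ∩ (gc Γ).U j ∩ (gc Γ).U l).Nonempty := by
  have hm := midp_mem h
  refine ⟨midp h, ⟨⟨⟨hm.1.1, hm.1.1⟩, hm.2.1, hm.2.1⟩, ?_⟩, ⟨hm.1.2, hm.1.2⟩, hm.2.2, hm.2.2⟩
  have a1 : 0 < (midp h).1.1 j.1.1 := by
    rcases h1 with h1 | h1 <;> rw [h1]
    exacts [hm.1.1, hm.1.2]
  have a2 : 0 < (midp h).1.2 j.1.2 := by
    rcases h2 with h1 | h1 <;> rw [h1]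
    exacts [hm.2.1, hm.2.2]
  exact ⟨⟨a1, a1⟩, a2, a2⟩

structure Coc (Γ : SimpleGraph V) (K : Type) [Group K] where
  c1 : V → V → V → K
  c2 : V → V → V → K
  self1 : ∀ u x, c1 u u x = 1
  self2 : ∀ x u, c2 x u u = 1
  inv1 : ∀ u v x, Γ.Adj u v → x ≠ u → x ≠ v → c1 u v x * c1 v u x = 1
  inv2 : ∀ x u v, Γ.Adj u v → x ≠ u → x ≠ v → c2 x u v * c2 x v u = 1
  sq : ∀ u v u' v', Γ.Adj u v → Γ.Adj u' v' → u ≠ u' → u ≠ v' → v ≠ u' → v ≠ v' →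
    c1 u v u' * c2 v u' v' = c2 u u' v' * c1 u v v'

namespace Coc
variable {K : Type} [Group K] (c : Coc Γ K)
theorem e1 {u v w x : V} (h1 : IsClosedCell Γ u v) (h3 : IsClosedCell Γ v w)
    (h : u = v ∨ v = w ∨ u = w) (hu : x ≠ u) (hv : x ≠ v) (hw : x ≠ w) :
    c.c1 u v x * c.c1 v w x = c.c1 u w x := by
  rcases h with rfl | rfl | rfl
  · rw [c.self1, one_mul]
  · rw [c.self1, mul_one]
  · rcases h1 with rfl | h1
    · simp [c.self1]
    · rw [c.inv1 _ _ _ h1 hu hv, c.self1]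

theorem e2 {u v w x : V} (h1 : IsClosedCell Γ u v) (h3 : IsClosedCell Γ v w)
    (h : u = v ∨ v = w ∨ u = w) (hu : x ≠ u) (hv : x ≠ v) (hw : x ≠ w) :
    c.c2 x u v * c.c2 x v w = c.c2 x u w := by
  rcases h with rfl | rfl | rfl
  · rw [c.self2, one_mul]
  · rw [c.self2, mul_one]
  · rcases h1 with rfl | h1
    · simp [c.self2]
    · rw [c.inv2 _ _ _ h1 hu hv, c.self2]

theorem sq' {u v u' v' : V} (h1 : IsClosedCell Γ u v) (h2 : IsClosedCell Γ u' v') (h3 : u ≠ u') (h4 : u ≠ v')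
    (h5 : v ≠ u') (h6 : v ≠ v') : c.c1 u v u' * c.c2 v u' v' = c.c2 u u' v' * c.c1 u v v' := by
  rcases h1 with rfl | h1
  · simp [c.self1]
  · rcases h2 with rfl | h2
    · simp [c.self2]
    · exact c.sq u v u' v' h1 h2 h3 h4 h5 h6

def tc : (gc Γ).TC K where
  t a b := c.c1 a.1.1 b.1.1 a.1.2 * c.c2 b.1.1 a.1.2 b.1.2
  tri a b d h := by
    obtain ⟨n1, n2, n3, p1, p2⟩ := gc_tri a b d h
    have s := c.sq' n2.1 n1.2.1 n1.2.2.2.2.1 n2.2.2.1 n3.2.2.2.2.1 n2.2.2.2.2.1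
    have f1 := c.e1 n1.1 n2.1 p1 n1.2.2.1.symm n1.2.2.2.2.1.symm n3.2.2.2.2.1.symm
    have f2 := c.e2 n1.2.1 n2.2.1 p2 n3.2.2.2.2.1 n2.2.2.2.2.1 n2.2.2.2.2.2
    rw [← f1, ← f2]
    simp only [mul_assoc]
    rw [← mul_assoc (c.c2 _ _ _), ← s]; simp only [mul_assoc]

open Classical in
def ofTC (q : (gc Γ).TC K) : Coc Γ K where
  c1 u v x := if h : u ≠ x ∧ v ≠ x then q.t ⟨(u, x), h.1⟩ ⟨(v, x), h.2⟩ else 1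
  c2 x u v := if h : x ≠ u ∧ x ≠ v then q.t ⟨(x, u), h.1⟩ ⟨(x, v), h.2⟩ else 1
  self1 u x := by
    split_ifs with h
    · exact q.self _ ⟨_, (gc Γ).hpt _⟩
    · rfl
  self2 x u := by
    split_ifs with h
    · exact q.self _ ⟨_, (gc Γ).hpt _⟩
    · rfl
  inv1 u v x h hu hv := by
    rw [dif_pos ⟨hu.symm, hv.symm⟩, dif_pos ⟨hv.symm, hu.symm⟩]
    exact q.inv _ _ ((gc_inter _ _).2 ⟨Or.inr h, Or.inl rfl, hu.symm, hu.symm, hv.symm, hv.symm⟩)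
  inv2 x u v h hu hv := by
    rw [dif_pos ⟨hu, hv⟩, dif_pos ⟨hv, hu⟩]
    exact q.inv _ _ ((gc_inter _ _).2 ⟨Or.inl rfl, Or.inr h, hu, hv, hu, hv⟩)
  sq u v u' v' h1 h2 h3 h4 h5 h6 := by
    rw [dif_pos ⟨h3, h5⟩, dif_pos ⟨h5, h6⟩, dif_pos ⟨h3, h4⟩, dif_pos ⟨h4, h6⟩]
    have hn : Nr Γ (u, u') (v, v') := ⟨Or.inr h1, Or.inr h2, h3, h4, h5, h6⟩
    rw [q.tri, q.tri]
    · exact gc_tri' _ _ _ hn (Or.inl rfl) (Or.inr rfl)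
    · exact gc_tri' _ _ _ hn (Or.inr rfl) (Or.inl rfl)

theorem ofTC_t (q : (gc Γ).TC K) (a b) (h : Nr Γ a.1 b.1) : (ofTC q).tc.t a b = q.t a b := by
  simp only [tc, ofTC]
  rw [dif_pos ⟨h.2.2.1, h.2.2.2.2.1⟩, dif_pos ⟨h.2.2.2.2.1, h.2.2.2.2.2⟩, q.tri]
  exact gc_tri' _ _ _ h (Or.inr rfl) (Or.inl rfl)
end Coc

/-- `π` is presented by the edges of `D₂`, relative to a base vertex and a set of bad edges. -/
structure D2S (Γ : SimpleGraph V) (bad : V → V → V → Prop) (v0 : V × V) (π : Type) [Group π] where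
  q : Coc Γ π
  gen : ∀ H : Subgroup π, (∀ u v x, Γ.Adj u v → x ≠ u → x ≠ v → q.c1 u v x ∈ H) →
    (∀ x u v, Γ.Adj u v → x ≠ u → x ≠ v → q.c2 x u v ∈ H) → H = ⊤
  lift : ∀ (K : Type) [Group K] (c : Coc Γ K), ∃ (φ : π →* K) (h : V × V → K),
    (∀ u v x, Γ.Adj u v → x ≠ u → x ≠ v → φ (q.c1 u v x) = h (u, x) * c.c1 u v x * (h (v, x))⁻¹) ∧
    (∀ x u v, Γ.Adj u v → x ≠ u → x ≠ v → φ (q.c2 x u v) = h (x, u) * c.c2 x u v * (h (x, v))⁻¹)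
  conn : ∀ Q : V × V → Prop, Q v0 →
    (∀ u v x, Γ.Adj u v → x ≠ u → x ≠ v → ¬ bad u v x → q.c1 u v x = 1 → Q (u, x) → Q (v, x)) →
    (∀ x u v, Γ.Adj u v → x ≠ u → x ≠ v → q.c2 x u v = 1 → Q (x, u) → Q (x, v)) →
    ∀ a : V × V, a.1 ≠ a.2 → Q a

theorem d2s_exists (Γ : SimpleGraph V) (bad : V → V → V → Prop) (v0 : V × V) (h0 : v0.1 ≠ v0.2)
    (hconn : ∀ Q : V × V → Prop, Q v0 →
    (∀ u v x, Γ.Adj u v → x ≠ u → x ≠ v → ¬ bad u v x → Q (u, x) → Q (v, x)) →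
    (∀ x u v, Γ.Adj u v → x ≠ u → x ≠ v → Q (x, u) → Q (x, v)) →
    ∀ a : V × V, a.1 ≠ a.2 → Q a) (x : DD Γ) :
    Nonempty (D2S Γ bad v0 (FundamentalGroup (DD Γ) x)) := by
  let R : {a : V × V // a.1 ≠ a.2} → {a : V × V // a.1 ≠ a.2} → Prop := fun a b =>
    (∃ u v x, Γ.Adj u v ∧ x ≠ u ∧ x ≠ v ∧ ¬ bad u v x ∧ a.1 = (u, x) ∧ b.1 = (v, x)) ∨
    (∃ x u v, Γ.Adj u v ∧ x ≠ u ∧ x ≠ v ∧ a.1 = (x, u) ∧ b.1 = (x, v))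
  have hn1 : ∀ u v x, Γ.Adj u v → x ≠ u → x ≠ v → Nr Γ (u, x) (v, x) := fun u v x h hu hv =>
    ⟨Or.inr h, Or.inl rfl, hu.symm, hu.symm, hv.symm, hv.symm⟩
  have hn2 : ∀ x u v, Γ.Adj u v → x ≠ u → x ≠ v → Nr Γ (x, u) (x, v) := fun x u v h hu hv =>
    ⟨Or.inl rfl, Or.inr h, hu, hv, hu, hv⟩
  have hR : ∀ a b, R a b → ((gc Γ).U a ∩ (gc Γ).U b).Nonempty := by
    rintro ⟨a, ha⟩ ⟨b, hb⟩ (⟨u, v, x, h, hu, hv, -, rfl, rfl⟩ | ⟨x, u, v, h, hu, hv, rfl, rfl⟩)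
    · exact (gc_inter _ _).2 (hn1 u v x h hu hv)
    · exact (gc_inter _ _).2 (hn2 x u v h hu hv)
  have hc : ∀ a, Relation.ReflTransGen R ⟨v0, h0⟩ a := by
    have := hconn (fun a => ∀ ha : a.1 ≠ a.2, Relation.ReflTransGen R ⟨v0, h0⟩ ⟨a, ha⟩)
      (fun _ => .refl)
      (fun u v x h hu hv hb hQ ha => (hQ hu.symm).tail (Or.inl ⟨u, v, x, h, hu, hv, hb, rfl, rfl⟩))
      (fun x u v h hu hv hQ ha => (hQ hu).tail (Or.inr ⟨x, u, v, h, hu, hv, rfl, rfl⟩))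
    exact fun a => this a.1 a.2 a.2
  obtain ⟨S⟩ := GC.star_exists R ⟨v0, h0⟩ hR hc
  suffices Nonempty (D2S Γ bad v0 (FundamentalGroup (DD Γ) ((gc Γ).pt ⟨v0, h0⟩))) by
    obtain ⟨D⟩ := this
    obtain ⟨p⟩ := S.joined x
    let e := FundamentalGroup.fundamentalGroupMulEquivOfPath p
    refine ⟨⟨⟨fun u v x => e.symm (D.q.c1 u v x), fun u v x => e.symm (D.q.c2 u v x), ?_, ?_, ?_, ?_, ?_⟩, ?_, ?_, ?_⟩⟩
    · intro u x; rw [D.q.self1, map_one]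
    · intro u x; rw [D.q.self2, map_one]
    · intro u v x h1 h2 h3; rw [← map_mul, D.q.inv1 u v x h1 h2 h3, map_one]
    · intro u v x h1 h2 h3; rw [← map_mul, D.q.inv2 u v x h1 h2 h3, map_one]
    · intro u v u' v' h1 h2 h3 h4 h5 h6
      rw [← map_mul, ← map_mul, D.q.sq u v u' v' h1 h2 h3 h4 h5 h6]
    · intro H h1 h2
      have := D.gen (H.comap e.symm.toMonoidHom) h1 h2
      rw [eq_top_iff]
      intro g _
      have hg : e g ∈ H.comap e.symm.toMonoidHom := by rw [this]; trivial
      simpa using hg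
    · intro K _ c
      obtain ⟨φ, h, h1, h2⟩ := D.lift K c
      exact ⟨φ.comp e.toMonoidHom, h, fun u v x a b d => by simpa using h1 u v x a b d,
        fun u v x a b d => by simpa using h2 u v x a b d⟩
    · intro Q hQ h1 h2
      exact D.conn Q hQ (fun u v x a b d f g => h1 u v x a b d f (by change e.symm _ = 1; rw [g, map_one]))
        (fun u v x a b d g => h2 u v x a b d (by change e.symm _ = 1; rw [g, map_one]))
  have hq1 : ∀ u v x, x ≠ u → (hv : x ≠ v) → (hu : x ≠ u) → (Coc.ofTC S.q).c1 u v x = S.q.t ⟨(u, x), hu.symm⟩ ⟨(v, x), hv.symm⟩ :=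
    fun u v x _ hv hu => dif_pos ⟨hu.symm, hv.symm⟩
  have hq2 : ∀ x u v, (hu : x ≠ u) → (hv : x ≠ v) → (Coc.ofTC S.q).c2 x u v = S.q.t ⟨(x, u), hu⟩ ⟨(x, v), hv⟩ :=
    fun x u v hu hv => dif_pos ⟨hu, hv⟩
  refine ⟨⟨Coc.ofTC S.q, ?_, ?_, ?_⟩⟩
  · intro H h1 h2
    apply S.gen
    intro i j hij
    have hn := (gc_inter i j).1 hij
    rw [← Coc.ofTC_t _ _ _ hn]
    refine H.mul_mem ?_ ?_
    · rcases hn.1 with h | h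
      · rw [h, Coc.self1]; exact H.one_mem
      · exact h1 _ _ _ h hn.2.2.1.symm hn.2.2.2.2.1.symm
    · rcases hn.2.1 with h | h
      · rw [h, Coc.self2]; exact H.one_mem
      · exact h2 _ _ _ h hn.2.2.2.2.1 hn.2.2.2.2.2
  · intro K _ c
    obtain ⟨φ, h, hφ⟩ := S.lift K c.tc
    classical
    let h' : V × V → K := fun a => if ha : a.1 ≠ a.2 then h ⟨a, ha⟩ else 1
    have hh : ∀ a (ha : a.1 ≠ a.2), h' a = h ⟨a, ha⟩ := fun a ha => dif_pos ha
    refine ⟨φ, h', ?_, ?_⟩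
    · intro u v x ha hu hv
      rw [hq1 u v x hu hv hu, hφ _ _ ((gc_inter _ _).2 (hn1 u v x ha hu hv)), hh _ hu.symm, hh _ hv.symm]
      simp only [Coc.tc, c.self2, mul_one]
    · intro x u v ha hu hv
      rw [hq2 x u v hu hv, hφ _ _ ((gc_inter _ _).2 (hn2 x u v ha hu hv)), hh _ hu, hh _ hv]
      simp only [Coc.tc, c.self1, one_mul]
  · intro Q hQ h1 h2 a ha
    refine S.conn (fun a => Q a.1) hQ ?_ ⟨a, ha⟩
    rintro ⟨a, ha⟩ ⟨b, hb⟩ (⟨u, v, x, h, hu, hv, hbad, rfl, rfl⟩ | ⟨x, u, v, h, hu, hv, rfl, rfl⟩) hq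
    · exact h1 u v x h hu hv hbad ((hq1 u v x hu hv hu).trans hq)
    · exact h2 x u v h hu hv ((hq2 x u v hu hv).trans hq)
end topo2

section ok
variable {k : ℕ}

abbrev oC : OkV k := Sum.inl ()
abbrev oP (i : Fin k) (r : Fin 3) : OkV k := Sum.inr (i, r)

theorem adj_s (i : Fin k) : (OkGraph k).Adj oC (oP i 0) := by
  simp [OkGraph, SimpleGraph.fromRel_adj, OkRel]
theorem adj_t (i : Fin k) {r r' : Fin 3} (h : r ≠ r') : (OkGraph k).Adj (oP i r) (oP i r') := by
  simp [OkGraph, SimpleGraph.fromRel_adj, OkRel, h]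

theorem adj_cases {u v : OkV k} (h : (OkGraph k).Adj u v) :
    (∃ i, u = oC ∧ v = oP i 0) ∨ (∃ i, u = oP i 0 ∧ v = oC) ∨
      ∃ i r r', r ≠ r' ∧ u = oP i r ∧ v = oP i r' := by
  simp only [OkGraph, SimpleGraph.fromRel_adj] at h
  rcases u with ⟨⟩ | ⟨i, r⟩ <;> rcases v with ⟨⟩ | ⟨j, q⟩
  · simp at h
  · simp only [OkRel, or_false] at h
    exact Or.inl ⟨j, rfl, by rw [h.2]⟩
  · simp only [OkRel, false_or] at h
    exact Or.inr (Or.inl ⟨i, by rw [h.2], rfl⟩)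
  · simp only [OkRel] at h
    right; right
    obtain ⟨-, ⟨rfl, h⟩ | ⟨rfl, h⟩⟩ := h
    · exact ⟨_, _, _, h, rfl, rfl⟩
    · exact ⟨_, _, _, h.symm, rfl, rfl⟩

section
variable {K : Type} [Group K]

/-- general cocycles on `D₂(𝒪_k)`. -/
def okCoc (sp1 : Fin k → OkV k → K) (tr1 : Fin k → OkV k → Fin 3 → Fin 3 → K)
    (sp2 : Fin k → OkV k → K) (tr2 : Fin k → OkV k → Fin 3 → Fin 3 → K)
    (s1 : ∀ i y r, tr1 i y r r = 1) (s2 : ∀ i y r, tr2 i y r r = 1)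
    (i1 : ∀ i y r r', tr1 i y r r' * tr1 i y r' r = 1) (i2 : ∀ i y r r', tr2 i y r r' * tr2 i y r' r = 1)
    (tt : ∀ i j r r' q q', i ≠ j → tr1 i (oP j q) r r' * tr2 j (oP i r') q q' =
      tr2 j (oP i r) q q' * tr1 i (oP j q') r r')
    (st : ∀ i j q q', q ≠ q' → oP i 0 ≠ oP j q → oP i 0 ≠ oP j q' → sp1 i (oP j q) * tr2 j (oP i 0) q q' =
      tr2 j oC q q' * sp1 i (oP j q'))
    (ts : ∀ i j r r', r ≠ r' → oP i r ≠ oP j 0 → oP i r' ≠ oP j 0 → tr1 i oC r r' * sp2 j (oP i r') =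
      sp2 j (oP i r) * tr1 i (oP j 0) r r') : Coc (OkGraph k) K where
  c1 u v y := match u, v with
    | Sum.inl _, Sum.inl _ => 1
    | Sum.inl _, Sum.inr i => sp1 i.1 y
    | Sum.inr i, Sum.inl _ => (sp1 i.1 y)⁻¹
    | Sum.inr i, Sum.inr j => tr1 i.1 y i.2 j.2
  c2 y u v := match u, v with
    | Sum.inl _, Sum.inl _ => 1
    | Sum.inl _, Sum.inr i => sp2 i.1 y
    | Sum.inr i, Sum.inl _ => (sp2 i.1 y)⁻¹
    | Sum.inr i, Sum.inr j => tr2 i.1 y i.2 j.2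
  self1 u x := by rcases u with _ | _ <;> simp [s1]
  self2 u x := by rcases x with _ | _ <;> simp [s2]
  inv1 u v x h _ _ := by
    obtain ⟨i, rfl, rfl⟩ | ⟨i, rfl, rfl⟩ | ⟨i, r, r', hr, rfl, rfl⟩ := adj_cases h <;> simp [i1]
  inv2 x u v h _ _ := by
    obtain ⟨i, rfl, rfl⟩ | ⟨i, rfl, rfl⟩ | ⟨i, r, r', hr, rfl, rfl⟩ := adj_cases h <;> simp [i2]
  sq u v u' v' h h' h3 h4 h5 h6 := by
    obtain ⟨i, rfl, rfl⟩ | ⟨i, rfl, rfl⟩ | ⟨i, r, r', hr, rfl, rfl⟩ := adj_cases h <;>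
    obtain ⟨j, rfl, rfl⟩ | ⟨j, rfl, rfl⟩ | ⟨j, q, q', hq, rfl, rfl⟩ := adj_cases h'
    · exact absurd rfl h3
    · exact absurd rfl h4
    · exact st i j q q' hq h5 h6
    · exact absurd rfl h5
    · exact absurd rfl h6
    · have := st i j q q' hq h3 h4
      rw [inv_mul_eq_iff_eq_mul, ← mul_assoc, this, mul_assoc, mul_inv_cancel, mul_one]
    · exact ts i j r r' hr h4 h6
    · have := ts i j r r' hr h3 h5
      rw [mul_inv_eq_iff_eq_mul, mul_assoc, this, inv_mul_cancel_left]
    · apply tt i j r r' q q'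
      rintro rfl
      simp only [ne_eq, Sum.inr.injEq, Prod.mk.injEq, true_and] at h3 h4 h5 h6
      omega

def tw (x : K) (r r' : Fin 3) : K := if r = 0 ∧ r' = 1 then x else if r = 1 ∧ r' = 0 then x⁻¹ else 1

theorem tw_self (x : K) (r) : tw x r r = 1 := by
  unfold tw; split_ifs <;> first | rfl | omega
theorem tw_inv (x : K) (r r') : tw x r r' * tw x r' r = 1 := by
  fin_cases r <;> fin_cases r' <;> simp [tw]
theorem tw_conj {x y e : K} (h : x * e = e * y) (r r') : tw x r r' * e = e * tw y r r' := by
  unfold tw; split_ifs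
  · exact h
  · rw [inv_mul_eq_iff_eq_mul, ← mul_assoc, h, mul_inv_cancel_right]
  · simp
theorem tw_comm {x y : K} (h : x * y = y * x) (r r' q q') : tw x r r' * tw y q q' = tw y q q' * tw x r r' :=
  tw_conj (tw_conj h.symm q q').symm r r'
theorem tw_12 (x : K) {r r' : Fin 3} (h : r ≠ 0) (h' : r' ≠ 0) : tw x r r' = 1 := by
  unfold tw; rw [if_neg (by simp [h]), if_neg (by simp [h'])]

/-- the standard data -/
structure OD (w : Fin k → Fin k) (K : Type) [Group K] where
  (X Y e f : Fin k → Fin k → K)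
  (δ l : Fin k → K)
  xy : ∀ i j, i ≠ j → X i j * Y i j = Y i j * X i j
  re : ∀ i j, i ≠ j → i ≠ w j → Y (w j) j * e i j = e i j * Y i j
  rf : ∀ i j, i ≠ j → j ≠ w i → X i (w i) * f i j = f i j * X i j

variable {w : Fin k → Fin k} (d : OD w K)
def OD.sp1 (i : Fin k) : OkV k → K
  | Sum.inl _ => 1
  | Sum.inr j => if j.1 = i then (d.δ i)⁻¹ else if i = w j.1 then 1 else d.e i j.1
def OD.tr1 (i : Fin k) : OkV k → Fin 3 → Fin 3 → K
  | Sum.inl _ => tw (d.X i (w i))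
  | Sum.inr j => if j.1 = i then (if j.2 = 2 then tw (d.l i) else fun _ _ => 1) else tw (d.X i j.1)
def OD.sp2 (j : Fin k) : OkV k → K
  | Sum.inl _ => 1
  | Sum.inr i => if i.1 = j ∨ j = w i.1 then 1 else d.f i.1 j
def OD.tr2 (j : Fin k) : OkV k → Fin 3 → Fin 3 → K
  | Sum.inl _ => tw (d.Y (w j) j)
  | Sum.inr i => if i.1 = j then fun _ _ => 1 else tw (d.Y i.1 j)

def OD.std : Coc (OkGraph k) K := okCoc d.sp1 d.tr1 d.sp2 d.tr2
  (by intro i y r; rcases y with _ | _ <;> simp only [OD.tr1] <;> (try split_ifs) <;> simp [tw_self])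
  (by intro i y r; rcases y with _ | _ <;> simp only [OD.tr2] <;> (try split_ifs) <;> simp [tw_self])
  (by intro i y r r'; rcases y with _ | _ <;> simp only [OD.tr1] <;> (try split_ifs) <;> simp [tw_inv])
  (by intro i y r r'; rcases y with _ | _ <;> simp only [OD.tr2] <;> (try split_ifs) <;> simp [tw_inv])
  (by
    intro i j r r' q q' h
    simp only [OD.tr1, OD.tr2, if_neg h, if_neg h.symm]
    exact tw_comm (d.xy i j h) _ _ _ _)
  (by
    intro i j q q' hq h h'
    simp only [OD.sp1, OD.tr2]
    by_cases hij : j = i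
    · subst hij
      simp only [ne_eq, Sum.inr.injEq, Prod.mk.injEq, true_and] at h h'
      simp [tw_12 _ (Ne.symm h) (Ne.symm h')]
    · rw [if_neg hij, if_neg (Ne.symm hij)]
      split_ifs with h1
      · subst h1; simp
      · exact (tw_conj (d.re i j (Ne.symm hij) h1) _ _).symm)
  (by
    intro i j q q' hq h h'
    simp only [OD.sp2, OD.tr1]
    by_cases hij : i = j
    · subst hij
      simp only [ne_eq, Sum.inr.injEq, Prod.mk.injEq, true_and] at h h'
      simp [tw_12 _ h h']
    · rw [if_neg (Ne.symm hij)]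
      split_ifs with h1
      · simp [h1.resolve_left hij]
      · simp only [not_or] at h1
        exact (tw_conj (d.rf i j hij h1.2) _ _))
end
end ok

section rig
variable {k : ℕ} (w : Fin k → Fin k)

/-- tree edges, first coordinate moves -/
inductive TE1 : OkV k → OkV k → OkV k → Prop
  | a (i j : Fin k) : i ≠ j → TE1 (oP i 0) (oP i 2) (oP j 0)
  | b (i j : Fin k) : i ≠ j → TE1 (oP i 2) (oP i 1) (oP j 0)
  | c (j : Fin k) (q : Fin 3) : TE1 (oP (w j) 0) oC (oP j q)
  | d (i : Fin k) : TE1 (oP i 2) (oP i 0) (oP i 1)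

/-- tree edges, second coordinate moves -/
inductive TE2 : OkV k → OkV k → OkV k → Prop
  | a (i j : Fin k) (r : Fin 3) : i ≠ j → TE2 (oP i r) (oP j 0) (oP j 2)
  | b (i j : Fin k) (r : Fin 3) : i ≠ j → TE2 (oP i r) (oP j 2) (oP j 1)
  | c (i : Fin k) (r : Fin 3) : TE2 (oP i r) (oP (w i) 0) oC
  | d (i : Fin k) (r : Fin 3) : r ≠ 0 → TE2 (oP i r) oC (oP i 0)
  | e (i : Fin k) : TE2 (oP i 2) (oP i 0) (oP i 1)
  | f (i : Fin k) : TE2 (oP i 0) (oP i 1) (oP i 2)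
  | g (i : Fin k) : TE2 (oP i 1) (oP i 0) (oP i 2)

theorem te1_ok (hw : ∀ j, w j ≠ j) {u v x : OkV k} (h : TE1 w u v x) :
    (OkGraph k).Adj u v ∧ x ≠ u ∧ x ≠ v := by
  cases h with
  | a i j h => exact ⟨adj_t i (by decide), by simp [h.symm], by simp⟩
  | b i j h => exact ⟨adj_t i (by decide), by simp, by simp⟩
  | c j q => exact ⟨(adj_s _).symm, by simp [(hw j).symm], by simp⟩
  | d i => exact ⟨adj_t i (by decide), by simp, by simp⟩
theorem te2_ok (hw : ∀ j, w j ≠ j) {u v x : OkV k} (h : TE2 w x u v) :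
    (OkGraph k).Adj u v ∧ x ≠ u ∧ x ≠ v := by
  cases h with
  | a i j r h => exact ⟨adj_t j (by decide), by simp [h], by simp [h]⟩
  | b i j r h => exact ⟨adj_t j (by decide), by simp [h], by simp [h]⟩
  | c i r => exact ⟨(adj_s _).symm, by simp [(hw i).symm], by simp⟩
  | d i r h => exact ⟨adj_s _, by simp, by simp [h]⟩
  | e i => exact ⟨adj_t i (by decide), by simp, by simp⟩
  | f i => exact ⟨adj_t i (by decide), by simp, by simp⟩
  | g i => exact ⟨adj_t i (by decide), by simp, by simp⟩

/-- induction along the forest -/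
theorem forest (hw : ∀ j, w j ≠ j) (Q : OkV k × OkV k → Prop) (h0 : ∀ i j, i ≠ j → Q (oP i 0, oP j 0))
    (h1 : ∀ u v x, TE1 w u v x → Q (u, x) → Q (v, x)) (h2 : ∀ x u v, TE2 w x u v → Q (x, u) → Q (x, v)) :
    ∀ a : OkV k × OkV k, a.1 ≠ a.2 → Q a := by
  have A : ∀ i j r, i ≠ j → Q (oP i r, oP j 0) := by
    intro i j r h
    have z0 := h0 i j h
    have z2 := h1 _ _ _ (.a i j h) z0
    have z1 := h1 _ _ _ (.b i j h) z2
    fin_cases r <;> assumption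
  have B : ∀ i j r q, i ≠ j → Q (oP i r, oP j q) := by
    intro i j r q h
    have z0 := A i j r h
    have z2 := h2 _ _ _ (.a i j r h) z0
    have z1 := h2 _ _ _ (.b i j r h) z2
    fin_cases q <;> assumption
  have C : ∀ i r, Q (oP i r, oC) := fun i r => h2 _ _ _ (.c i r) (A i (w i) r (hw i).symm)
  have h20 := fun i => h2 _ _ _ (.d i 2 (by decide)) (C i 2)
  have h10 := fun i => h2 _ _ _ (.d i 1 (by decide)) (C i 1)
  have h21 := fun i => h2 _ _ _ (.e i) (h20 i)
  have h01 := fun i => h1 _ _ _ (.d i) (h21 i)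
  have h02 := fun i => h2 _ _ _ (.f i) (h01 i)
  have h12 := fun i => h2 _ _ _ (.g i) (h10 i)
  rintro ⟨⟨⟩ | ⟨i, r⟩, ⟨⟩ | ⟨j, q⟩⟩ ha
  · exact absurd rfl ha
  · exact h1 _ _ _ (.c j q) (B _ j 0 q (hw j))
  · exact C i r
  · by_cases h : i = j
    · subst h
      have hrq : r ≠ q := by rintro rfl; exact ha rfl
      fin_cases r <;> fin_cases q <;> first | exact absurd rfl hrq | solve_by_elim
    · exact B i j r q h

variable {K : Type} [Group K]

structure TT (g : Coc (OkGraph k) K) : Prop where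
  t1 : ∀ u v x, TE1 w u v x → g.c1 u v x = 1
  t2 : ∀ x u v, TE2 w x u v → g.c2 x u v = 1

theorem OD.std_tt {w : Fin k → Fin k} (hw : ∀ j, w j ≠ j) (d : OD w K) : TT w d.std where
  t1 u v x h := by
    cases h with
    | a i j h => simp [OD.std, okCoc, OD.tr1, h.symm, tw]
    | b i j h => simp [OD.std, okCoc, OD.tr1, h.symm, tw]
    | c j q => simp [OD.std, okCoc, OD.sp1, (hw j).symm]
    | d i => simp [OD.std, okCoc, OD.tr1]
  t2 x u v h := by
    cases h with
    | a i j r h => simp [OD.std, okCoc, OD.tr2, h, tw]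
    | b i j r h => simp [OD.std, okCoc, OD.tr2, h, tw]
    | c i r => simp [OD.std, okCoc, OD.sp2]
    | d i r h => simp [OD.std, okCoc, OD.sp2]
    | e i => simp [OD.std, okCoc, OD.tr2]
    | f i => simp [OD.std, okCoc, OD.tr2]
    | g i => simp [OD.std, okCoc, OD.tr2]

theorem tw_02 (x : K) : tw x 0 2 = 1 := by simp [tw]
theorem tw_21 (x : K) : tw x 2 1 = 1 := by simp [tw]

namespace TT
variable {w} (hw : ∀ j, w j ≠ j) {g : Coc (OkGraph k) K} (t : TT w g)
include hw t

theorem fill {f : Fin 3 → Fin 3 → K} (h0 : ∀ r, f r r = 1) (hi : ∀ r r', r ≠ r' → f r r' * f r' r = 1)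
    (h2 : f 0 2 = 1) (h1 : f 2 1 = 1) (r r') : f r r' = tw (f 0 1) r r' := by
  have a := hi 0 2 (by decide)
  have b := hi 2 1 (by decide)
  have c := hi 0 1 (by decide)
  rw [h2, one_mul] at a
  rw [h1, one_mul] at b
  have c' := eq_inv_of_mul_eq_one_right c
  fin_cases r <;> fin_cases r' <;> simp [tw, h0, a, b, h1, h2, c']

theorem fl1 (i : Fin k) (y : OkV k) (hy : ∀ r, y ≠ oP i r) (h2 : g.c1 (oP i 0) (oP i 2) y = 1)
    (h1 : g.c1 (oP i 2) (oP i 1) y = 1) (r r') :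
    g.c1 (oP i r) (oP i r') y = tw (g.c1 (oP i 0) (oP i 1) y) r r' :=
  t.fill hw (f := fun r r' => g.c1 (oP i r) (oP i r') y) (fun r => g.self1 _ _)
    (fun r r' h => g.inv1 _ _ _ (adj_t i h) (hy _) (hy _)) h2 h1 r r'
theorem fl2 (i : Fin k) (y : OkV k) (hy : ∀ r, y ≠ oP i r) (h2 : g.c2 y (oP i 0) (oP i 2) = 1)
    (h1 : g.c2 y (oP i 2) (oP i 1) = 1) (r r') :
    g.c2 y (oP i r) (oP i r') = tw (g.c2 y (oP i 0) (oP i 1)) r r' :=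
  t.fill hw (f := fun r r' => g.c2 y (oP i r) (oP i r')) (fun r => g.self2 _ _)
    (fun r r' h => g.inv2 _ _ _ (adj_t i h) (hy _) (hy _)) h2 h1 r r'

theorem tr1_0 {i j : Fin k} (h : i ≠ j) (r r') :
    g.c1 (oP i r) (oP i r') (oP j 0) = tw (g.c1 (oP i 0) (oP i 1) (oP j 0)) r r' :=
  t.fl1 hw i _ (by simp [h.symm]) (t.t1 _ _ _ (.a i j h)) (t.t1 _ _ _ (.b i j h)) r r'
theorem tr2_r {i j : Fin k} (h : i ≠ j) (r q q') :
    g.c2 (oP i r) (oP j q) (oP j q') = tw (g.c2 (oP i r) (oP j 0) (oP j 1)) q q' :=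
  t.fl2 hw j _ (by simp [h]) (t.t2 _ _ _ (.a i j r h)) (t.t2 _ _ _ (.b i j r h)) q q'

theorem sqt {i j : Fin k} (h : i ≠ j) (r r' q q') (hr : r ≠ r') (hq : q ≠ q') :
    g.c1 (oP i r) (oP i r') (oP j q) * g.c2 (oP i r') (oP j q) (oP j q') =
      g.c2 (oP i r) (oP j q) (oP j q') * g.c1 (oP i r) (oP i r') (oP j q') :=
  g.sq _ _ _ _ (adj_t i hr) (adj_t j hq) (by simp [h]) (by simp [h]) (by simp [h]) (by simp [h])

theorem tr1 {i j : Fin k} (h : i ≠ j) (q r r') :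
    g.c1 (oP i r) (oP i r') (oP j q) = tw (g.c1 (oP i 0) (oP i 1) (oP j 0)) r r' := by
  rw [← t.tr1_0 hw h]
  by_cases hr : r = r'
  · subst hr; simp [g.self1]
  have a := t.sqt hw h r r' 0 2 hr (by decide)
  have b := t.sqt hw h r r' 2 1 hr (by decide)
  rw [t.t2 _ _ _ (.a i j r h), t.t2 _ _ _ (.a i j r' h), one_mul, mul_one] at a
  rw [t.t2 _ _ _ (.b i j r h), t.t2 _ _ _ (.b i j r' h), one_mul, mul_one] at b
  fin_cases q
  · rfl
  · exact (a.trans b).symm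
  · exact a.symm

theorem tr2 {i j : Fin k} (h : i ≠ j) (r q q') :
    g.c2 (oP i r) (oP j q) (oP j q') = tw (g.c2 (oP i 0) (oP j 0) (oP j 1)) q q' := by
  rw [t.tr2_r hw h]
  congr 1
  have a := t.sqt hw h 0 2 0 1 (by decide) (by decide)
  have b := t.sqt hw h 2 1 0 1 (by decide) (by decide)
  rw [t.tr1 hw h 0, t.tr1 hw h 1, tw_02, one_mul, mul_one] at a
  rw [t.tr1 hw h 0, t.tr1 hw h 1, tw_21, one_mul, mul_one] at b
  fin_cases r
  · rfl
  · exact b.trans a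
  · exact a

theorem xy {i j : Fin k} (h : i ≠ j) : g.c1 (oP i 0) (oP i 1) (oP j 0) * g.c2 (oP i 0) (oP j 0) (oP j 1) =
    g.c2 (oP i 0) (oP j 0) (oP j 1) * g.c1 (oP i 0) (oP i 1) (oP j 0) := by
  have a := t.sqt hw h 0 1 0 1 (by decide) (by decide)
  rw [t.tr2 hw h 1, t.tr1 hw h 1] at a
  exact a

theorem tr2C (j : Fin k) (q q') :
    g.c2 oC (oP j q) (oP j q') = tw (g.c2 (oP (w j) 0) (oP j 0) (oP j 1)) q q' := by
  by_cases hq : q = q'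
  · subst hq; simp [g.self2, tw_self]
  rw [← t.tr2 hw (hw j) 0]
  have a := g.sq _ _ _ _ (adj_s (w j)).symm (adj_t j hq) (by simp [hw j]) (by simp [hw j]) (by simp) (by simp)
  rwa [t.t1 _ _ _ (.c j q), t.t1 _ _ _ (.c j q'), one_mul, mul_one] at a

theorem tr1C (i : Fin k) (r r') :
    g.c1 (oP i r) (oP i r') oC = tw (g.c1 (oP i 0) (oP i 1) (oP (w i) 0)) r r' := by
  by_cases hr : r = r'
  · subst hr; simp [g.self1, tw_self]
  rw [← t.tr1 hw (hw i).symm 0]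
  have a := g.sq _ _ _ _ (adj_t i hr) (adj_s (w i)).symm (by simp [(hw i).symm]) (by simp) (by simp [(hw i).symm]) (by simp)
  rw [t.t2 _ _ _ (.c i r), t.t2 _ _ _ (.c i r'), one_mul, mul_one] at a
  exact a.symm

theorem sp1s {i j : Fin k} (h : i ≠ j) {q q' : Fin 3} (hq : q ≠ q') :
    g.c1 oC (oP i 0) (oP j q) * g.c2 (oP i 0) (oP j q) (oP j q') = g.c2 oC (oP j q) (oP j q') *
      g.c1 oC (oP i 0) (oP j q') :=
  g.sq _ _ _ _ (adj_s i) (adj_t j hq) (by simp) (by simp) (by simp [h]) (by simp [h])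
theorem sp2s {i j : Fin k} (h : i ≠ j) {q q' : Fin 3} (hq : q ≠ q') :
    g.c1 (oP i q) (oP i q') oC * g.c2 (oP i q') oC (oP j 0) = g.c2 (oP i q) oC (oP j 0) *
      g.c1 (oP i q) (oP i q') (oP j 0) :=
  g.sq _ _ _ _ (adj_t i hq) (adj_s j) (by simp) (by simp [h]) (by simp) (by simp [h])

theorem sp1 {i j : Fin k} (h : i ≠ j) (q) : g.c1 oC (oP i 0) (oP j q) = g.c1 oC (oP i 0) (oP j 0) := by
  have a := t.sp1s hw h (q := 0) (q' := 2) (by decide)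
  have b := t.sp1s hw h (q := 2) (q' := 1) (by decide)
  rw [t.tr2 hw h, t.tr2C hw, tw_02, tw_02, one_mul, mul_one] at a
  rw [t.tr2 hw h, t.tr2C hw, tw_21, tw_21, one_mul, mul_one] at b
  fin_cases q
  · rfl
  · exact (a.trans b).symm
  · exact a.symm
theorem sp2 {i j : Fin k} (h : i ≠ j) (r) : g.c2 (oP i r) oC (oP j 0) = g.c2 (oP i 0) oC (oP j 0) := by
  have a := t.sp2s hw h (q := 0) (q' := 2) (by decide)
  have b := t.sp2s hw h (q := 2) (q' := 1) (by decide)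
  rw [t.tr1 hw h, t.tr1C hw, tw_02, tw_02, one_mul, mul_one] at a
  rw [t.tr1 hw h, t.tr1C hw, tw_21, tw_21, one_mul, mul_one] at b
  fin_cases r
  · rfl
  · exact b.trans a
  · exact a
theorem re {i j : Fin k} (h : i ≠ j) : g.c2 (oP (w j) 0) (oP j 0) (oP j 1) * g.c1 oC (oP i 0) (oP j 0) =
    g.c1 oC (oP i 0) (oP j 0) * g.c2 (oP i 0) (oP j 0) (oP j 1) := by
  have a := t.sp1s hw h (q := 0) (q' := 1) (by decide)
  rw [t.sp1 hw h 1, t.tr2C hw] at a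
  exact a.symm
theorem rf {i j : Fin k} (h : i ≠ j) : g.c1 (oP i 0) (oP i 1) (oP (w i) 0) * g.c2 (oP i 0) oC (oP j 0) =
    g.c2 (oP i 0) oC (oP j 0) * g.c1 (oP i 0) (oP i 1) (oP j 0) := by
  have a := t.sp2s hw h (q := 0) (q' := 1) (by decide)
  rw [t.sp2 hw h 1, t.tr1C hw] at a
  exact a

/-- the data of a normalized cocycle -/
def data : OD w K where
  X i j := g.c1 (oP i 0) (oP i 1) (oP j 0)
  Y i j := g.c2 (oP i 0) (oP j 0) (oP j 1)
  e i j := g.c1 oC (oP i 0) (oP j 0)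
  f i j := g.c2 (oP i 0) oC (oP j 0)
  δ i := (g.c1 oC (oP i 0) (oP i 1))⁻¹
  l i := g.c1 (oP i 0) (oP i 1) (oP i 2)
  xy i j h := t.xy hw h
  re i j h _ := t.re hw h
  rf i j h _ := t.rf hw h

theorem dl (i : Fin k) : g.c1 oC (oP i 0) (oP i 2) = g.c1 oC (oP i 0) (oP i 1) := by
  have a := g.sq oC (oP i 0) (oP i 1) (oP i 2) (adj_s i) (adj_t i (by decide)) (by simp) (by simp) (by simp) (by simp)
  rw [t.t2 _ _ _ (.f i), t.tr2C hw, tw_12 _ (by decide) (by decide), one_mul, mul_one] at a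
  exact a.symm

theorem hx (i : Fin k) : g.c1 (oP i 1) (oP i 2) (oP i 0) = 1 := by
  have a := g.sq (oP i 1) (oP i 2) oC (oP i 0) (adj_t i (by decide)) (adj_s i) (by simp) (by simp) (by simp) (by simp)
  rw [t.t2 _ _ _ (.d i 1 (by decide)), t.t2 _ _ _ (.d i 2 (by decide)), t.tr1C hw, tw_12 _ (by decide) (by decide), one_mul, one_mul] at a
  exact a.symm

theorem rv1 {u v x : OkV k} (h : (OkGraph k).Adj u v) (h1 : x ≠ u) (h2 : x ≠ v) :
    g.c1 v u x = (g.c1 u v x)⁻¹ := eq_inv_of_mul_eq_one_right (g.inv1 _ _ _ h h1 h2)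
theorem rv2 {u v x : OkV k} (h : (OkGraph k).Adj u v) (h1 : x ≠ u) (h2 : x ≠ v) :
    g.c2 x v u = (g.c2 x u v)⁻¹ := eq_inv_of_mul_eq_one_right (g.inv2 _ _ _ h h1 h2)

theorem tri1 (i : Fin k) (r r' q) (h : r ≠ r') (h1 : q ≠ r) (h2 : q ≠ r') : 
    g.c1 (oP i r) (oP i r') (oP i q) = (if q = 2 then tw (g.c1 (oP i 0) (oP i 1) (oP i 2)) r r' else 1) := by
  have a := t.rv1 hw (adj_t i h) (x := oP i q) (by simp [h1]) (by simp [h2])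
  have b := t.hx hw i
  have c := t.t1 _ _ _ (.d i)
  fin_cases r <;> fin_cases r' <;> fin_cases q <;> simp at h h1 h2 a <;> simp [tw, a, b, c]
  all_goals simp_all
theorem tri2 (i : Fin k) (r r' q) (h : r ≠ r') (h1 : q ≠ r) (h2 : q ≠ r') : 
    g.c2 (oP i q) (oP i r) (oP i r') = 1 := by
  have a := t.rv2 hw (adj_t i h) (x := oP i q) (by simp [h1]) (by simp [h2])
  have b := t.t2 _ _ _ (.e i)
  have c := t.t2 _ _ _ (.f i)
  have d := t.t2 _ _ _ (.g i)
  fin_cases r <;> fin_cases r' <;> fin_cases q <;> simp at h h1 h2 a <;> simp_all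

theorem rigid1 {u v x : OkV k} (h : (OkGraph k).Adj u v) (h1 : x ≠ u) (h2 : x ≠ v) :
    g.c1 u v x = (t.data hw).std.c1 u v x := by
  have S : ∀ i, x ≠ oC → x ≠ oP i 0 → g.c1 oC (oP i 0) x = (t.data hw).std.c1 oC (oP i 0) x := by
    intro i hx hx'
    obtain _ | ⟨j, q⟩ := x
    · exact absurd rfl hx
    simp only [OD.std, okCoc, OD.sp1, data, inv_inv]
    split_ifs with e1 e2
    · subst e1
      fin_cases q
      · exact absurd rfl hx'
      · rfl
      · exact t.dl hw _
    · subst e2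
      have a := t.rv1 hw (u := oP (w j) 0) (v := oC) (x := oP j q) (adj_s _).symm (by simp [(hw j).symm]) (by simp)
      rw [a, t.t1 _ _ _ (.c j q), inv_one]
    · exact t.sp1 hw (Ne.symm e1) q
  obtain ⟨i, rfl, rfl⟩ | ⟨i, rfl, rfl⟩ | ⟨i, r, r', hr, rfl, rfl⟩ := adj_cases h
  · exact S i h1 h2
  · rw [t.rv1 hw (adj_s i) h2 h1, S i h2 h1]; rfl
  · obtain _ | ⟨j, q⟩ := x
    · exact t.tr1C hw i r r'
    · simp only [OD.std, okCoc, OD.tr1, data]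
      by_cases e1 : j = i
      · subst e1
        rw [if_pos rfl]
        rw [t.tri1 hw j r r' q hr (by rintro rfl; exact h1 rfl) (by rintro rfl; exact h2 rfl)]
        split_ifs <;> rfl
      · rw [if_neg e1]
        exact t.tr1 hw (Ne.symm e1) q r r'

theorem rigid2 {u v x : OkV k} (h : (OkGraph k).Adj u v) (h1 : x ≠ u) (h2 : x ≠ v) :
    g.c2 x u v = (t.data hw).std.c2 x u v := by
  have S : ∀ i, x ≠ oC → x ≠ oP i 0 → g.c2 x oC (oP i 0) = (t.data hw).std.c2 x oC (oP i 0) := by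
    intro i hx hx'
    obtain _ | ⟨j, q⟩ := x
    · exact absurd rfl hx
    simp only [OD.std, okCoc, OD.sp2, data]
    split_ifs with e1
    · obtain rfl | rfl := e1
      · exact t.t2 _ _ _ (.d j q (by rintro rfl; exact hx' rfl))
      · have a := t.rv2 hw (u := oP (w j) 0) (v := oC) (x := oP j q) (adj_s _).symm (by simp [(hw j).symm]) (by simp)
        rw [a, t.t2 _ _ _ (.c j q), inv_one]
    · simp only [not_or] at e1
      exact t.sp2 hw e1.1 q
  obtain ⟨i, rfl, rfl⟩ | ⟨i, rfl, rfl⟩ | ⟨i, r, r', hr, rfl, rfl⟩ := adj_cases h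
  · exact S i h1 h2
  · rw [t.rv2 hw (adj_s i) h2 h1, S i h2 h1]; rfl
  · obtain _ | ⟨j, q⟩ := x
    · exact t.tr2C hw i r r'
    · simp only [OD.std, okCoc, OD.tr2, data]
      by_cases e1 : j = i
      · subst e1
        rw [if_pos rfl]
        exact t.tri2 hw j r r' q hr (by rintro rfl; exact h1 rfl) (by rintro rfl; exact h2 rfl)
      · rw [if_neg e1]
        exact t.tr2 hw e1 q r r'
end TT

theorem tw_mem {H : Subgroup K} {x : K} (h : x ∈ H) (r r') : tw x r r' ∈ H := by
  unfold tw; split_ifs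
  exacts [h, H.inv_mem h, H.one_mem]

/-- all values of the standard cocycle lie in the subgroup generated by the data -/
theorem OD.std_mem {w : Fin k → Fin k} (hw : ∀ j, w j ≠ j) (d : OD w K) (H : Subgroup K)
    (hX : ∀ i j, i ≠ j → d.X i j ∈ H) (hY : ∀ i j, i ≠ j → d.Y i j ∈ H)
    (he : ∀ i j, i ≠ j → i ≠ w j → d.e i j ∈ H) (hf : ∀ i j, i ≠ j → j ≠ w i → d.f i j ∈ H)
    (hδ : ∀ i, d.δ i ∈ H) (hl : ∀ i, d.l i ∈ H) :
    (∀ u v x, (OkGraph k).Adj u v → d.std.c1 u v x ∈ H) ∧ (∀ x u v, (OkGraph k).Adj u v → d.std.c2 x u v ∈ H) := by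
  have A : ∀ i x, d.sp1 i x ∈ H := by
    rintro i (_ | ⟨j, q⟩)
    · exact H.one_mem
    · simp only [OD.sp1]; split_ifs with h1 h2
      exacts [H.inv_mem (hδ _), H.one_mem, he _ _ (Ne.symm h1) h2]
  have B : ∀ i x, d.sp2 i x ∈ H := by
    rintro i (_ | ⟨j, q⟩)
    · exact H.one_mem
    · simp only [OD.sp2]; split_ifs with h1
      · exact H.one_mem
      · simp only [not_or] at h1
        exact hf _ _ h1.1 h1.2
  constructor
  · intro u v x h
    obtain ⟨i, rfl, rfl⟩ | ⟨i, rfl, rfl⟩ | ⟨i, r, r', hr, rfl, rfl⟩ := adj_cases h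
    · exact A _ _
    · exact H.inv_mem (A _ _)
    · obtain _ | ⟨j, q⟩ := x
      · exact tw_mem (hX _ _ (hw i).symm) _ _
      · simp only [OD.std, okCoc, OD.tr1]
        split_ifs with h1 h2
        exacts [tw_mem (hl _) _ _, H.one_mem, tw_mem (hX _ _ (Ne.symm h1)) _ _]
  · intro x u v h
    obtain ⟨i, rfl, rfl⟩ | ⟨i, rfl, rfl⟩ | ⟨i, r, r', hr, rfl, rfl⟩ := adj_cases h
    · exact B _ _
    · exact H.inv_mem (B _ _)
    · obtain _ | ⟨j, q⟩ := x
      · exact tw_mem (hY _ _ (hw i)) _ _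
      · simp only [OD.std, okCoc, OD.tr2]
        split_ifs with h1
        exacts [H.one_mem, tw_mem (hY _ _ h1) _ _]
end rig

section gau
variable {V : Type} {Γ : SimpleGraph V} {K L : Type} [Group K] [Group L]

def Coc.map (q : Coc Γ K) (f : K →* L) : Coc Γ L where
  c1 u v x := f (q.c1 u v x)
  c2 x u v := f (q.c2 x u v)
  self1 u x := by rw [q.self1, map_one f]
  self2 u x := by rw [q.self2, map_one f]
  inv1 u v x h h1 h2 := by rw [← map_mul, q.inv1 _ _ _ h h1 h2, map_one f]
  inv2 u v x h h1 h2 := by rw [← map_mul, q.inv2 _ _ _ h h1 h2, map_one f]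
  sq u v u' v' a b c d e g := by rw [← map_mul, q.sq _ _ _ _ a b c d e g, map_mul]

def Coc.twist (q : Coc Γ K) (m : V × V → K) : Coc Γ K where
  c1 u v x := m (u, x) * q.c1 u v x * (m (v, x))⁻¹
  c2 x u v := m (x, u) * q.c2 x u v * (m (x, v))⁻¹
  self1 u x := by rw [q.self1]; group
  self2 u x := by rw [q.self2]; group
  inv1 u v x h h1 h2 := by
    have := q.inv1 _ _ _ h h1 h2
    calc _ = m (u, x) * (q.c1 u v x * q.c1 v u x) * (m (u, x))⁻¹ := by group
      _ = 1 := by rw [this]; group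
  inv2 x u v h h1 h2 := by
    have := q.inv2 _ _ _ h h1 h2
    calc _ = m (x, u) * (q.c2 x u v * q.c2 x v u) * (m (x, u))⁻¹ := by group
      _ = 1 := by rw [this]; group
  sq u v u' v' a b c d e g := by
    have := q.sq _ _ _ _ a b c d e g
    calc _ = m (u, u') * (q.c1 u v u' * q.c2 v u' v') * (m (v, v'))⁻¹ := by group
      _ = _ := by rw [this]; group

variable {k : ℕ} (w : Fin k → Fin k) (q : Coc (OkGraph k) K) (τ : Fin k → Fin k → K)

def pth (f : Fin 3 → Fin 3 → K) (r : Fin 3) : K := if r = 0 then 1 else if r = 2 then f 0 2 else f 0 2 * f 2 1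

def gMT (i j : Fin k) (r s : Fin 3) : K := (τ i j)⁻¹ * pth (fun a b => q.c1 (oP i a) (oP i b) (oP j 0)) r *
  pth (fun a b => q.c2 (oP i r) (oP j a) (oP j b)) s
def gMC (i : Fin k) (r : Fin 3) : K := gMT q τ i (w i) r 0 * q.c2 (oP i r) (oP (w i) 0) oC
def gMD (i : Fin k) (r : Fin 3) : K := gMC w q τ i r * q.c2 (oP i r) oC (oP i 0)
def gM2 (i : Fin k) : K := gMD w q τ i 2 * q.c2 (oP i 2) (oP i 0) (oP i 1)
def gM1 (i : Fin k) : K := gM2 w q τ i * q.c1 (oP i 2) (oP i 0) (oP i 1)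
def gMH (i : Fin k) (r s : Fin 3) : K := if s = 0 then gMD w q τ i r else
  if r = 1 then gMD w q τ i 1 * q.c2 (oP i 1) (oP i 0) (oP i 2) else
  if r = 2 then gM2 w q τ i else if s = 1 then gM1 w q τ i else gM1 w q τ i * q.c2 (oP i 0) (oP i 1) (oP i 2)

def okGauge : OkV k × OkV k → K
  | (Sum.inl _, Sum.inl _) => 1
  | (Sum.inl _, Sum.inr j) => gMT q τ (w j.1) j.1 0 j.2 * q.c1 (oP (w j.1) 0) oC (oP j.1 j.2)
  | (Sum.inr i, Sum.inl _) => gMC w q τ i.1 i.2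
  | (Sum.inr i, Sum.inr j) => if i.1 = j.1 then gMH w q τ i.1 i.2 j.2 else gMT q τ i.1 j.1 i.2 j.2

theorem gauge_base {i j : Fin k} (h : i ≠ j) : okGauge w q τ (oP i 0, oP j 0) = (τ i j)⁻¹ := by
  simp [okGauge, h, gMT, pth]

theorem gauge_tt (hw : ∀ j, w j ≠ j) : TT w (q.twist (okGauge w q τ)) where
  t1 u v x h := by
    simp only [Coc.twist, mul_inv_eq_one]
    cases h with
    | a i j h => simp [okGauge, h, gMT, pth]
    | b i j h => simp [okGauge, h, gMT, pth, mul_assoc]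
    | c j q => simp [okGauge, hw j]
    | d i => simp [okGauge, gMH, gM1]
  t2 x u v h := by
    simp only [Coc.twist, mul_inv_eq_one]
    cases h with
    | a i j r h => simp [okGauge, h, gMT, pth]
    | b i j r h => simp [okGauge, h, gMT, pth, mul_assoc]
    | c i r => simp [okGauge, (hw i).symm, gMC]
    | d i r h => simp [okGauge, gMH, gMD]
    | e i => simp [okGauge, gMH, gM2]
    | f i => simp [okGauge, gMH]
    | g i => simp [okGauge, gMH]

/-- the bad edge -/
def bad (b : Fin k) (u v x : OkV k) : Prop :=
  (u = oP b 0 ∧ v = oP b 1 ∨ u = oP b 1 ∧ v = oP b 0) ∧ x = oP b 2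

theorem bad_no {b : Fin k} {u v u' v' : OkV k} (h : (OkGraph k).Adj u' v')
    (h1 : u ≠ u') (h2 : u ≠ v') (h3 : v ≠ u') (h4 : v ≠ v') : ¬ bad b u v u' ∧ ¬ bad b u v v' := by
  constructor
  · rintro ⟨h5, rfl⟩
    obtain ⟨j, e, rfl⟩ | ⟨j, e, rfl⟩ | ⟨j, r, r', hq, e, rfl⟩ := adj_cases h
    · simp at e
    · simp at e
    · simp only [Sum.inr.injEq, Prod.mk.injEq] at e
      obtain ⟨rfl, rfl⟩ := e
      fin_cases r' <;> grind
  · rintro ⟨h5, rfl⟩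
    obtain ⟨j, rfl, e⟩ | ⟨j, rfl, e⟩ | ⟨j, r, r', hq, rfl, e⟩ := adj_cases h
    · simp at e
    · simp at e
    · simp only [Sum.inr.injEq, Prod.mk.injEq] at e
      obtain ⟨rfl, rfl⟩ := e
      fin_cases r <;> grind

theorem te1_nb {b : Fin k} {u v x : OkV k} (h : TE1 w u v x) : ¬ bad b u v x := by
  cases h <;> simp [bad]

theorem ok_conn (hw : ∀ j, w j ≠ j) (hk : 3 ≤ k) (b : Fin k) {i0 j0 : Fin k} (h0 : i0 ≠ j0)
    (Q : OkV k × OkV k → Prop) (q0 : Q (oP i0 0, oP j0 0))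
    (q1 : ∀ u v x, (OkGraph k).Adj u v → x ≠ u → x ≠ v → ¬ bad b u v x → Q (u, x) → Q (v, x))
    (q2 : ∀ x u v, (OkGraph k).Adj u v → x ≠ u → x ≠ v → Q (x, u) → Q (x, v)) :
    ∀ a : OkV k × OkV k, a.1 ≠ a.2 → Q a := by
  have m1 : ∀ i i' j, i ≠ j → i' ≠ j → Q (oP i 0, oP j 0) → Q (oP i' 0, oP j 0) := by
    intro i i' j h h' a
    have a1 := q1 _ oC _ (adj_s i).symm (by simp [h.symm]) (by simp) (by simp [bad]) a
    exact q1 _ _ _ (adj_s i') (by simp) (by simp [h'.symm]) (by simp [bad]) a1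
  have m2 : ∀ i j j', i ≠ j → i ≠ j' → Q (oP i 0, oP j 0) → Q (oP i 0, oP j' 0) := by
    intro i j j' h h' a
    have a1 := q2 _ _ oC (adj_s j).symm (by simp [h]) (by simp) a
    exact q2 _ _ _ (adj_s j') (by simp) (by simp [h']) a1
  refine forest w hw Q ?_ (fun u v x h a => ?_) (fun x u v h a => ?_)
  · intro i j h
    by_cases e1 : i = j0
    · by_cases e2 : j = i0
      · subst e1 e2
        obtain ⟨c, hc⟩ := Finset.exists_mem_notMem_of_card_lt_card (s := {i, j}) (t := (Finset.univ : Finset (Fin k)))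
          (by rw [Finset.card_univ, Fintype.card_fin]; exact lt_of_le_of_lt Finset.card_le_two hk)
        simp only [Finset.mem_univ, Finset.mem_insert, Finset.mem_singleton, not_or, true_and] at hc
        exact m1 c i j hc.2 h (m2 c i j hc.1 hc.2 (m1 j c i h0 hc.1 q0))
      · exact m1 i0 i j (Ne.symm e2) h (m2 i0 j0 j h0 (Ne.symm e2) q0)
    · exact m2 i j0 j e1 h (m1 i0 i j0 h0 e1 q0)
  · obtain ⟨x1, x2, x3⟩ := te1_ok w hw h
    exact q1 _ _ _ x1 x2 x3 (te1_nb w h) a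
  · obtain ⟨x1, x2, x3⟩ := te2_ok w hw h
    exact q2 _ _ _ x1 x2 x3 a

open Classical in
def Coc.patch (b : Fin k) (z : K) : Coc (OkGraph k) K where
  c1 u v x := if u = oP b 0 ∧ v = oP b 1 ∧ x = oP b 2 then z else
    if u = oP b 1 ∧ v = oP b 0 ∧ x = oP b 2 then z⁻¹ else q.c1 u v x
  c2 := q.c2
  self1 u x := by
    rw [if_neg, if_neg, q.self1]
    · rintro ⟨rfl, h, -⟩; simp at h
    · rintro ⟨rfl, h, -⟩; simp at h
  self2 := q.self2
  inv1 u v x h h1 h2 := by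
    by_cases c1 : u = oP b 0 ∧ v = oP b 1 ∧ x = oP b 2
    · obtain ⟨rfl, rfl, rfl⟩ := c1; simp
    by_cases c2 : u = oP b 1 ∧ v = oP b 0 ∧ x = oP b 2
    · obtain ⟨rfl, rfl, rfl⟩ := c2; simp
    rw [if_neg c1, if_neg c2, if_neg (by tauto), if_neg (by tauto), q.inv1 _ _ _ h h1 h2]
  inv2 := q.inv2
  sq u v u' v' a h c d e g := by
    have := bad_no (b := b) h c d e g
    simp only [bad] at this
    rw [if_neg (by tauto), if_neg (by tauto), if_neg (by tauto), if_neg (by tauto)]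
    exact q.sq _ _ _ _ a h c d e g

theorem patch_nb {b : Fin k} {z : K} {u v x : OkV k} (h : ¬ bad b u v x) :
    (q.patch b z).c1 u v x = q.c1 u v x := by
  simp only [bad] at h
  simp only [Coc.patch]
  rw [if_neg (by tauto), if_neg (by tauto)]
theorem patch_b {b : Fin k} {z : K} : (q.patch b z).c1 (oP b 0) (oP b 1) (oP b 2) = z := by
  simp [Coc.patch]

section
variable {b : Fin k} {v0 : OkV k × OkV k} {π : Type} [Group π] (D : D2S (OkGraph k) (bad b) v0 π)
def D2S.t : π := D.q.c1 (oP b 0) (oP b 1) (oP b 2)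

theorem D2S.patch_lift (θ : π →* K) (z : K) : ∃ φ : π →* K,
    (∀ u v x, (OkGraph k).Adj u v → x ≠ u → x ≠ v → ¬ bad b u v x → φ (D.q.c1 u v x) = θ (D.q.c1 u v x)) ∧
    (∀ x u v, (OkGraph k).Adj u v → x ≠ u → x ≠ v → φ (D.q.c2 x u v) = θ (D.q.c2 x u v)) ∧ φ D.t = z := by
  obtain ⟨φ, h, p1, p2⟩ := D.lift K ((D.q.map θ).patch b z)
  have hc : ∀ a : OkV k × OkV k, a.1 ≠ a.2 → h a = h v0 := by
    refine D.conn (fun a => h a = h v0) rfl (fun u v x a1 a2 a3 a4 a5 a6 => ?_) (fun x u v a1 a2 a3 a5 a6 => ?_)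
    · have := p1 u v x a1 a2 a3
      rw [patch_nb _ a4] at this
      change φ (D.q.c1 u v x) = h (u, x) * θ (D.q.c1 u v x) * (h (v, x))⁻¹ at this
      rw [a5, map_one φ, map_one θ, mul_one] at this
      rw [← a6]
      exact (mul_inv_eq_one.1 this.symm).symm
    · have := p2 x u v a1 a2 a3
      change φ (D.q.c2 x u v) = h (x, u) * θ (D.q.c2 x u v) * (h (x, v))⁻¹ at this
      rw [a5, map_one φ, map_one θ, mul_one] at this
      rw [← a6]
      exact (mul_inv_eq_one.1 this.symm).symm
  refine ⟨(MulAut.conj (h v0)⁻¹).toMonoidHom.comp φ, fun u v x a1 a2 a3 a4 => ?_, fun x u v a1 a2 a3 => ?_, ?_⟩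
  · change (h v0)⁻¹ * φ _ * ((h v0)⁻¹)⁻¹ = _
    rw [p1 u v x a1 a2 a3, patch_nb _ a4, hc (u, x) a2.symm, hc (v, x) a3.symm]
    simp only [Coc.map]; group
  · change (h v0)⁻¹ * φ _ * ((h v0)⁻¹)⁻¹ = _
    rw [p2 x u v a1 a2 a3, hc (x, u) a2, hc (x, v) a3]
    simp only [Coc.map, Coc.patch]; group
  · change (h v0)⁻¹ * φ _ * ((h v0)⁻¹)⁻¹ = _
    rw [D2S.t, p1 _ _ _ (adj_t b (by decide)) (by simp) (by simp), patch_b, hc (oP b 0, oP b 2) (by simp), hc (oP b 1, oP b 2) (by simp)]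
    group

theorem D2S.hext {φ φ' : π →* K} 
    (h1 : ∀ u v x, (OkGraph k).Adj u v → x ≠ u → x ≠ v → ¬ bad b u v x → φ (D.q.c1 u v x) = φ' (D.q.c1 u v x))
    (h2 : ∀ x u v, (OkGraph k).Adj u v → x ≠ u → x ≠ v → φ (D.q.c2 x u v) = φ' (D.q.c2 x u v))
    (h3 : φ D.t = φ' D.t) : φ = φ' := by
  have := D.gen (φ.eqLocus φ') (fun u v x a1 a2 a3 => ?_) (fun x u v a1 a2 a3 => h2 x u v a1 a2 a3)
  · ext x
    have : x ∈ φ.eqLocus φ' := by rw [this]; trivial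
    exact this
  · by_cases hb : bad b u v x
    · obtain ⟨⟨rfl, rfl⟩ | ⟨rfl, rfl⟩, rfl⟩ := hb
      · exact h3
      · have := eq_inv_of_mul_eq_one_left (D.q.inv1 _ _ _ a1 a2 a3)
        rw [this]
        exact Subgroup.inv_mem _ h3
    · exact h1 u v x a1 a2 a3 hb
end
end gau

section st
variable {k : ℕ} {b : Fin k} {v0 : OkV k × OkV k} {π : Type} [Group π] (D : D2S (OkGraph k) (bad b) v0 π)
include D

theorem D2S.fg : Group.FG π := by
  rw [Group.fg_iff]
  refine ⟨Set.range (fun p : OkV k × OkV k × OkV k => D.q.c1 p.1 p.2.1 p.2.2) ∪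
    Set.range (fun p : OkV k × OkV k × OkV k => D.q.c2 p.1 p.2.1 p.2.2), ?_,
    (Set.finite_range _).union (Set.finite_range _)⟩
  exact D.gen _ (fun u v x _ _ _ => Subgroup.subset_closure (Or.inl ⟨(u, v, x), rfl⟩))
    (fun u v x _ _ _ => Subgroup.subset_closure (Or.inr ⟨(u, v, x), rfl⟩))

theorem D2S.split : ∃ ψ : π →* π, (∀ S : Type, Nonempty (Monoid.Coprod ψ.range (FreeGroup (Option S)) ≃*
      Monoid.Coprod π (FreeGroup S))) ∧ 
      ∀ u v x, (OkGraph k).Adj u v → x ≠ u → x ≠ v → ¬ bad b u v x → ψ (D.q.c1 u v x) = D.q.c1 u v x := by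
  obtain ⟨ψ, p1, p2, p3⟩ := D.patch_lift (MonoidHom.id π) 1
  refine ⟨ψ, fun S => ?_, p1⟩
  obtain ⟨α, a1, a2, a3⟩ := D.patch_lift
    ((Monoid.Coprod.inl : ψ.range →* Monoid.Coprod ψ.range (FreeGroup (Option S))).comp ψ.rangeRestrict)
    (Monoid.Coprod.inr (FreeGroup.of none))
  let F : Monoid.Coprod ψ.range (FreeGroup (Option S)) →* Monoid.Coprod π (FreeGroup S) :=
    Monoid.Coprod.lift (Monoid.Coprod.inl.comp ψ.range.subtype) (FreeGroup.lift (fun o => o.elim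
      (Monoid.Coprod.inl D.t) (fun s => Monoid.Coprod.inr (FreeGroup.of s))))
  let G : Monoid.Coprod π (FreeGroup S) →* Monoid.Coprod ψ.range (FreeGroup (Option S)) :=
    Monoid.Coprod.lift α (FreeGroup.lift (fun s => Monoid.Coprod.inr (FreeGroup.of (some s))))
  have hFl : ∀ x, F (Monoid.Coprod.inl x) = Monoid.Coprod.inl x.1 := fun x => by simp [F]
  have hGl : ∀ x, G (Monoid.Coprod.inl x) = α x := fun x => by simp [G]
  refine ⟨MonoidHom.toMulEquiv F G ?_ ?_⟩
  · apply Monoid.Coprod.hom_ext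
    · have key : α.comp ψ = (Monoid.Coprod.inl : ψ.range →* Monoid.Coprod ψ.range (FreeGroup (Option S))).comp ψ.rangeRestrict := by
        refine D.hext (fun u v x h1 h2 h3 h4 => ?_) (fun x u v h1 h2 h3 => ?_) ?_
        · rw [MonoidHom.comp_apply, p1 u v x h1 h2 h3 h4]; exact a1 u v x h1 h2 h3 h4
        · rw [MonoidHom.comp_apply, p2 x u v h1 h2 h3]; exact a2 x u v h1 h2 h3
        · have e : ψ.rangeRestrict D.t = 1 := Subtype.ext p3
          rw [MonoidHom.comp_apply, p3, MonoidHom.comp_apply, e, map_one α, map_one]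
      ext ⟨_, x, rfl⟩
      simp only [MonoidHom.comp_apply, hFl, hGl, MonoidHom.id_apply]
      exact DFunLike.congr_fun key x
    · ext o
      cases o with
      | none =>
        have : F (Monoid.Coprod.inr (FreeGroup.of none)) = Monoid.Coprod.inl D.t := by simp [F]
        simp only [MonoidHom.comp_apply, this, hGl, a3, MonoidHom.id_apply]
      | some s => simp [F, G]
  · apply Monoid.Coprod.hom_ext
    · refine D.hext (fun u v x h1 h2 h3 h4 => ?_) (fun x u v h1 h2 h3 => ?_) ?_
      · simp only [MonoidHom.comp_apply, hGl, MonoidHom.id_apply]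
        rw [a1 u v x h1 h2 h3 h4, MonoidHom.comp_apply, hFl]
        exact congrArg _ (p1 u v x h1 h2 h3 h4)
      · simp only [MonoidHom.comp_apply, hGl, MonoidHom.id_apply]
        rw [a2 x u v h1 h2 h3, MonoidHom.comp_apply, hFl]
        exact congrArg _ (p2 x u v h1 h2 h3)
      · simp only [MonoidHom.comp_apply, hGl, MonoidHom.id_apply]
        rw [a3]
        simp [F]
    · ext s
      simp [F, G]

theorem D2S.inf (w : Fin k → Fin k) {i j : Fin k} (h : i ≠ j) (n : ℕ) (hn : 0 < n) :
    (D.q.c1 (oP i 0) (oP i 1) (oP j 0) * D.q.c1 (oP i 1) (oP i 2) (oP j 0) *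
      D.q.c1 (oP i 2) (oP i 0) (oP j 0)) ^ n ≠ 1 := by
  let d : OD w (Multiplicative ℤ) :=
    { X := fun _ _ => Multiplicative.ofAdd 1, Y := fun _ _ => 1, e := fun _ _ => 1, f := fun _ _ => 1
      δ := fun _ => 1, l := fun _ => 1
      xy := fun _ _ _ => mul_comm _ _, re := fun _ _ _ _ => mul_comm _ _, rf := fun _ _ _ _ => mul_comm _ _ }
  obtain ⟨φ, g, p1, p2⟩ := D.lift _ d.std
  intro e
  have e' := congrArg φ e
  rw [map_one φ, map_pow φ, map_mul φ, map_mul φ, p1 _ _ _ (adj_t i (by decide)) (by simp [h.symm]) (by simp [h.symm]),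
    p1 _ _ _ (adj_t i (by decide)) (by simp [h.symm]) (by simp [h.symm]),
    p1 _ _ _ (adj_t i (by decide)) (by simp [h.symm]) (by simp [h.symm])] at e'
  have c1 : d.std.c1 (oP i 0) (oP i 1) (oP j 0) = Multiplicative.ofAdd 1 := by
    simp [OD.std, okCoc, OD.tr1, h.symm, tw, d]
  have c2 : d.std.c1 (oP i 1) (oP i 2) (oP j 0) = 1 := by
    simp [OD.std, okCoc, OD.tr1, h.symm, tw, d]
  have c3 : d.std.c1 (oP i 2) (oP i 0) (oP j 0) = 1 := by
    simp [OD.std, okCoc, OD.tr1, h.symm, tw, d]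
  rw [c1, c2, c3] at e'
  have e2 : ∀ x y z a : Multiplicative ℤ, x * a * y⁻¹ * (y * 1 * z⁻¹) * (z * 1 * x⁻¹) = a := by
    intro x y z a
    calc _ = x * a * x⁻¹ := by group
      _ = a := by rw [mul_comm x, mul_inv_cancel_right]
  rw [e2] at e'
  have := congrArg Multiplicative.toAdd e'
  simp at this
  omega

theorem D2S.ceg_free (w : Fin k → Fin k) {i j : Fin k} (h : i ≠ j) (S : Type) [Fintype S] :
    CEG π (Monoid.Coprod π (FreeGroup S)) := by
  obtain ⟨ψ, hS, hψ⟩ := D.split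
  have fgπ := D.fg
  have fgB : Group.FG ψ.range := inferInstance
  obtain ⟨e0⟩ := hS Empty
  obtain ⟨e1⟩ := hS S
  let u' := D.q.c1 (oP i 0) (oP i 1) (oP j 0) * D.q.c1 (oP i 1) (oP i 2) (oP j 0) *
      D.q.c1 (oP i 2) (oP i 0) (oP j 0)
  have hu' : ψ u' = u' := by
    simp only [u', map_mul]
    rw [hψ _ _ _ (adj_t i (by decide)) (by simp [h.symm]) (by simp [h.symm]) (by simp [bad]),
     hψ _ _ _ (adj_t i (by decide)) (by simp [h.symm]) (by simp [h.symm]) (by simp [bad]),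
     hψ _ _ _ (adj_t i (by decide)) (by simp [h.symm]) (by simp [h.symm]) (by simp [bad])]
  let u : ψ.range := ⟨u', u', hu'⟩
  have hu : ∀ n : ℕ, 0 < n → u ^ n ≠ 1 := fun n hn e => D.inf w h n hn (congrArg Subtype.val e)
  let eE : π ≃* Monoid.Coprod π (FreeGroup Empty) := MonoidHom.toMulEquiv Monoid.Coprod.inl
    (Monoid.Coprod.lift (MonoidHom.id π) (FreeGroup.lift Empty.elim))
    (by ext x; simp) (by
      apply Monoid.Coprod.hom_ext
      · ext x; simp
      · ext x; exact x.elim)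
  have c1 : CEG π (Monoid.Coprod ψ.range (FreeGroup (Option Empty))) := CEG.of_equiv (eE.trans e0.symm) fgπ
  have s1 := stage1 ψ.range fgB u hu (Option Empty) none
  have s2 := stage1 ψ.range fgB u hu (Option S) none
  refine (c1.trans (s1.symm.trans s2)).trans ?_
  obtain ⟨_, T', _, hT', _⟩ := s2
  exact CEG.of_equiv e1 ⟨⟨T', hT'⟩⟩
end st

section fin
variable {k : ℕ}

abbrev OS (k : ℕ) := {p : Fin k × Fin k // p.1 ≠ p.2}
abbrev OJ (w : Fin k → Fin k) := {p : Fin k × Fin k // p.1 ≠ p.2 ∧ p.1 ≠ w p.2} ⊕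
  {p : Fin k × Fin k // p.1 ≠ p.2 ∧ p.2 ≠ w p.1} ⊕ Fin k ⊕ Fin k

variable {w : Fin k → Fin k} (hw : ∀ j, w j ≠ j)

def okPre (s0 : OS k) : PreDat (Fin 3) where
  S := OS k
  J := OJ w
  fS := inferInstance
  fJ := inferInstance
  s0 := s0
  src
    | Sum.inl p => ⟨(w p.1.2, p.1.2), hw _⟩
    | Sum.inr (Sum.inl p) => ⟨(p.1.1, w p.1.1), (hw _).symm⟩
    | Sum.inr (Sum.inr (Sum.inl i)) => ⟨(i, w i), (hw _).symm⟩
    | Sum.inr (Sum.inr (Sum.inr i)) => ⟨(i, w i), (hw _).symm⟩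
  tgt
    | Sum.inl p => ⟨p.1, p.2.1⟩
    | Sum.inr (Sum.inl p) => ⟨p.1, p.2.1⟩
    | Sum.inr (Sum.inr (Sum.inl i)) => ⟨(w i, i), hw _⟩
    | Sum.inr (Sum.inr (Sum.inr i)) => ⟨(i, w i), (hw _).symm⟩
  fam
    | Sum.inl _ => 0
    | Sum.inr (Sum.inl _) => 1
    | Sum.inr (Sum.inr _) => 2

theorem third (hk : 3 ≤ k) (i j : Fin k) : ∃ c, c ≠ i ∧ c ≠ j := by
  obtain ⟨c, hc⟩ := Finset.exists_mem_notMem_of_card_lt_card (s := {i, j}) (t := (Finset.univ : Finset (Fin k)))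
    (by rw [Finset.card_univ, Fintype.card_fin]; exact lt_of_le_of_lt Finset.card_le_two hk)
  simp only [Finset.mem_univ, Finset.mem_insert, Finset.mem_singleton, not_or, true_and] at hc
  exact ⟨c, hc⟩

theorem okPre_full (hk : 3 ≤ k) (s0 : OS k) (s : (okPre hw s0).S) (τ : Fin 3) (hτ : τ ≠ 2) :
    ∃ j, (okPre hw s0).fam j = τ ∧ ((okPre hw s0).src j = s ∨ (okPre hw s0).tgt j = s) := by
  obtain ⟨⟨i, j⟩, h⟩ := s
  fin_cases τ
  · by_cases e : i = w j
    · subst e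
      obtain ⟨c, h1, h2⟩ := third hk j (w j)
      exact ⟨Sum.inl ⟨(c, j), h1, h2⟩, rfl, Or.inl rfl⟩
    · exact ⟨Sum.inl ⟨(i, j), h, e⟩, rfl, Or.inr rfl⟩
  · by_cases e : j = w i
    · subst e
      obtain ⟨c, h1, h2⟩ := third hk i (w i)
      exact ⟨Sum.inr (Sum.inl ⟨(i, c), h1.symm, h2⟩), rfl, Or.inl rfl⟩
    · exact ⟨Sum.inr (Sum.inl ⟨(i, j), h, e⟩), rfl, Or.inr rfl⟩
  · exact absurd rfl hτ

section
variable {K : Type} [Group K] (d : OD w K)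

def OD.ii (s : OS k) : Z2 →* K := z2hom (d.X s.1.1 s.1.2) (d.Y s.1.1 s.1.2) (d.xy _ _ s.2)
def OD.ee : OJ w → K
  | Sum.inl p => d.e p.1.1 p.1.2
  | Sum.inr (Sum.inl p) => d.f p.1.1 p.1.2
  | Sum.inr (Sum.inr (Sum.inl i)) => d.δ i
  | Sum.inr (Sum.inr (Sum.inr i)) => d.l i

theorem OD.rel (s0 : OS k) (j : (okPre hw s0).J) (c : Z2) (hc : sig2.pt ((okPre hw s0).fam j) c = 1) :
    d.ii ((okPre hw s0).src j) c * d.ee j = d.ee j * d.ii ((okPre hw s0).tgt j) c := by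
  refine rel2 _ _ _ _ ?_ ?_ c hc
  · rcases j with p | p | p | p
    · intro _
      simp only [OD.ii, z2hom_Y]
      exact d.re _ _ p.2.1 p.2.2
    all_goals intro h; simp [okPre] at h
  · rcases j with p | p | p | p
    · intro h; simp [okPre] at h
    · intro _
      simp only [OD.ii, z2hom_X]
      exact d.rf _ _ p.2.1 p.2.2
    all_goals intro h; simp [okPre] at h

/-- data from a realization -/
def OD.of (s0 : OS k) (i' : OS k → Z2 →* K) (e' : OJ w → K)
    (hr : ∀ j c, sig2.pt ((okPre hw s0).fam j) c = 1 → i' ((okPre hw s0).src j) c * e' j =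
      e' j * i' ((okPre hw s0).tgt j) c) : OD w K where
  X i j := if h : i ≠ j then i' ⟨(i, j), h⟩ X2 else 1
  Y i j := if h : i ≠ j then i' ⟨(i, j), h⟩ Y2 else 1
  e i j := if h : i ≠ j ∧ i ≠ w j then e' (Sum.inl ⟨(i, j), h⟩) else 1
  f i j := if h : i ≠ j ∧ j ≠ w i then e' (Sum.inr (Sum.inl ⟨(i, j), h⟩)) else 1
  δ i := e' (Sum.inr (Sum.inr (Sum.inl i)))
  l i := e' (Sum.inr (Sum.inr (Sum.inr i)))
  xy i j h := by
    rw [dif_pos h, dif_pos h, ← map_mul, ← map_mul, mul_comm]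
  re i j h h' := by
    rw [dif_pos h, dif_pos (hw j), dif_pos ⟨h, h'⟩]
    exact rel2Y _ _ _ (hr (Sum.inl ⟨(i, j), h, h'⟩))
  rf i j h h' := by
    rw [dif_pos h, dif_pos (hw i).symm, dif_pos ⟨h, h'⟩]
    exact rel2X _ _ _ (hr (Sum.inr (Sum.inl ⟨(i, j), h, h'⟩)))
end

variable {b : Fin k} {s0 : OS k} {π : Type} [Group π]
  (D : D2S (OkGraph k) (bad b) (oP s0.1.1 0, oP s0.1.2 0) π)

def okτ (i j : Fin k) : Monoid.Coprod π (FreeGroup (OS k)) :=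
  if h : i ≠ j then Monoid.Coprod.inr (FreeGroup.of ⟨(i, j), h⟩) else 1

def D2S.m : OkV k × OkV k → Monoid.Coprod π (FreeGroup (OS k)) :=
  okGauge w (D.q.map Monoid.Coprod.inl) okτ
def D2S.g : Coc (OkGraph k) (Monoid.Coprod π (FreeGroup (OS k))) :=
  (D.q.map Monoid.Coprod.inl).twist (D.m (w := w))
theorem D2S.m_base (s : OS k) : D.m (w := w) (oP s.1.1 0, oP s.1.2 0) = (Monoid.Coprod.inr (FreeGroup.of s))⁻¹ := by
  rw [D2S.m, gauge_base w _ _ s.2, okτ, dif_pos s.2]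
include hw in
theorem D2S.g_tt : TT w (D.g (w := w)) := gauge_tt w _ _ hw
def D2S.d : OD w (Monoid.Coprod π (FreeGroup (OS k))) := (D.g_tt hw).data hw

theorem D2S.gen' (H : Subgroup (Monoid.Coprod π (FreeGroup (OS k)))) (h1 : ∀ s a, (D.d hw).ii s a ∈ H)
    (h2 : ∀ j, (D.d hw).ee j ∈ H) (h3 : Monoid.Coprod.inr (FreeGroup.of s0) ∈ H) : H = ⊤ := by
  obtain ⟨g1, g2⟩ := (D.d hw).std_mem hw H 
    (fun i j h => by simpa [OD.ii] using h1 ⟨(i, j), h⟩ X2)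
    (fun i j h => by simpa [OD.ii] using h1 ⟨(i, j), h⟩ Y2)
    (fun i j h h' => h2 (Sum.inl ⟨(i, j), h, h'⟩))
    (fun i j h h' => h2 (Sum.inr (Sum.inl ⟨(i, j), h, h'⟩)))
    (fun i => h2 (Sum.inr (Sum.inr (Sum.inl i))))
    (fun i => h2 (Sum.inr (Sum.inr (Sum.inr i))))
  have G1 : ∀ u v x, (OkGraph k).Adj u v → x ≠ u → x ≠ v →
      D.m (w := w) (u, x) * Monoid.Coprod.inl (D.q.c1 u v x) * (D.m (w := w) (v, x))⁻¹ ∈ H := by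
    intro u v x a1 a2 a3
    have := (D.g_tt hw).rigid1 hw a1 a2 a3
    have h := g1 u v x a1
    rw [D2S.d, ← this] at h
    exact h
  have G2 : ∀ x u v, (OkGraph k).Adj u v → x ≠ u → x ≠ v →
      D.m (w := w) (x, u) * Monoid.Coprod.inl (D.q.c2 x u v) * (D.m (w := w) (x, v))⁻¹ ∈ H := by
    intro x u v a1 a2 a3
    have := (D.g_tt hw).rigid2 hw a1 a2 a3
    have h := g2 x u v a1
    rw [D2S.d, ← this] at h
    exact h
  have M : ∀ a : OkV k × OkV k, a.1 ≠ a.2 → D.m (w := w) a ∈ H := by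
    refine D.conn (fun a => D.m (w := w) a ∈ H) ?_ (fun u v x a1 a2 a3 a4 a5 a6 => ?_) (fun x u v a1 a2 a3 a5 a6 => ?_)
    · rw [D.m_base]; exact H.inv_mem h3
    · have := G1 u v x a1 a2 a3
      rw [a5, map_one, mul_one] at this
      have := H.mul_mem (H.inv_mem this) a6
      simpa using this
    · have := G2 x u v a1 a2 a3
      rw [a5, map_one, mul_one] at this
      have := H.mul_mem (H.inv_mem this) a6
      simpa using this
  have hq : H.comap Monoid.Coprod.inl = ⊤ := by
    refine D.gen _ (fun u v x a1 a2 a3 => ?_) (fun x u v a1 a2 a3 => ?_)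
    · have := H.mul_mem (H.mul_mem (H.inv_mem (M (u, x) a2.symm)) (G1 u v x a1 a2 a3)) (M (v, x) a3.symm)
      simpa [mul_assoc] using this
    · have := H.mul_mem (H.mul_mem (H.inv_mem (M (x, u) a2)) (G2 x u v a1 a2 a3)) (M (x, v) a3)
      simpa [mul_assoc] using this
  have hs : H.comap Monoid.Coprod.inr = ⊤ := by
    rw [eq_top_iff, ← FreeGroup.closure_range_of, Subgroup.closure_le]
    rintro _ ⟨s, rfl⟩
    have := M (oP s.1.1 0, oP s.1.2 0) (by simp [s.2])
    rw [D.m_base] at this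
    simpa using H.inv_mem this
  rw [eq_top_iff, ← Monoid.Coprod.range_inl_sup_range_inr, sup_le_iff]
  constructor
  · rintro _ ⟨x, rfl⟩
    have : x ∈ H.comap Monoid.Coprod.inl := by rw [hq]; trivial
    exact this
  · rintro _ ⟨x, rfl⟩
    have : x ∈ H.comap Monoid.Coprod.inr := by rw [hs]; trivial
    exact this

include hw in
theorem D2S.lift0 (K : Type) [Group K] (c : Coc (OkGraph k) K) (tc : TT w c) (z' : K) :
    ∃ f : Monoid.Coprod π (FreeGroup (OS k)) →* K,
      (∀ u v x, (OkGraph k).Adj u v → x ≠ u → x ≠ v → f ((D.g (w := w)).c1 u v x) = c.c1 u v x) ∧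
      (∀ x u v, (OkGraph k).Adj u v → x ≠ u → x ≠ v → f ((D.g (w := w)).c2 x u v) = c.c2 x u v) ∧
      f (Monoid.Coprod.inr (FreeGroup.of s0)) = z' := by
  obtain ⟨φ, h, p1, p2⟩ := D.lift K c
  obtain ⟨κ, hκ⟩ : ∃ κ, κ = z' * (h (oP s0.1.1 0, oP s0.1.2 0))⁻¹ := ⟨_, rfl⟩
  let f : Monoid.Coprod π (FreeGroup (OS k)) →* K := Monoid.Coprod.lift ((MulAut.conj κ).toMonoidHom.comp φ)
    (FreeGroup.lift (fun s => κ * h (oP s.1.1 0, oP s.1.2 0)))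
  have fl : ∀ x, f (Monoid.Coprod.inl x) = κ * φ x * κ⁻¹ := fun x => by simp [f]
  have fr : ∀ s, f (Monoid.Coprod.inr (FreeGroup.of s)) = κ * h (oP s.1.1 0, oP s.1.2 0) := fun s => by simp [f]
  let E : OkV k × OkV k → K := fun a => f (D.m (w := w) a) * κ * h a
  have F1 : ∀ u v x, (OkGraph k).Adj u v → x ≠ u → x ≠ v →
      f ((D.g (w := w)).c1 u v x) = E (u, x) * c.c1 u v x * (E (v, x))⁻¹ := by
    intro u v x a1 a2 a3
    change f (D.m (w := w) (u, x) * Monoid.Coprod.inl (D.q.c1 u v x) * (D.m (w := w) (v, x))⁻¹) = _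
    rw [map_mul, map_mul, map_inv, fl, p1 u v x a1 a2 a3]
    simp only [E]; group
  have F2 : ∀ x u v, (OkGraph k).Adj u v → x ≠ u → x ≠ v →
      f ((D.g (w := w)).c2 x u v) = E (x, u) * c.c2 x u v * (E (x, v))⁻¹ := by
    intro x u v a1 a2 a3
    change f (D.m (w := w) (x, u) * Monoid.Coprod.inl (D.q.c2 x u v) * (D.m (w := w) (x, v))⁻¹) = _
    rw [map_mul, map_mul, map_inv, fl, p2 x u v a1 a2 a3]
    simp only [E]; group
  have tg := D.g_tt hw
  have hE : ∀ a : OkV k × OkV k, a.1 ≠ a.2 → E a = 1 := by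
    refine forest w hw (fun a => E a = 1) (fun i j hij => ?_) (fun u v x a1 a2 => ?_) (fun x u v a1 a2 => ?_)
    · simp only [E]
      rw [D.m_base ⟨(i, j), hij⟩, map_inv, fr]; group
    · obtain ⟨b1, b2, b3⟩ := te1_ok w hw a1
      have := F1 u v x b1 b2 b3
      rw [tg.t1 _ _ _ a1, tc.t1 _ _ _ a1, map_one f, a2, mul_one, one_mul] at this
      exact inv_eq_one.1 this.symm
    · obtain ⟨b1, b2, b3⟩ := te2_ok w hw a1
      have := F2 x u v b1 b2 b3
      rw [tg.t2 _ _ _ a1, tc.t2 _ _ _ a1, map_one f, a2, mul_one, one_mul] at this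
      exact inv_eq_one.1 this.symm
  refine ⟨f, fun u v x a1 a2 a3 => ?_, fun x u v a1 a2 a3 => ?_, ?_⟩
  · rw [F1 u v x a1 a2 a3, hE (u, x) a2.symm, hE (v, x) a3.symm]; group
  · rw [F2 x u v a1 a2 a3, hE (x, u) a2, hE (x, v) a3]; group
  · rw [fr, hκ]; group

def D2S.rz : Rz sig2 (okPre hw s0) (Monoid.Coprod π (FreeGroup (OS k))) where
  i := (D.d hw).ii
  e := (D.d hw).ee
  z := Monoid.Coprod.inr (FreeGroup.of s0)
  rel := (D.d hw).rel hw s0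
  gen := D.gen' hw
  lift K _ i' e' z' hr := by
    obtain ⟨f, f1, f2, f3⟩ := D.lift0 hw K _ ((OD.of hw s0 i' e' hr).std_tt hw) z'
    refine ⟨f, ?_, ?_, f3⟩
    · rintro ⟨⟨i, j⟩, h⟩ a
      have h : i ≠ j := h
      have : f.comp ((D.d hw).ii ⟨(i, j), h⟩) = i' ⟨(i, j), h⟩ := by
        apply z2hom_ext
        · rw [MonoidHom.comp_apply, OD.ii, z2hom_X]
          refine (f1 (oP i 0) (oP i 1) (oP j 0) (adj_t i (by decide)) (by simp [h.symm]) (by simp)).trans ?_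
          simp [OD.std, okCoc, OD.tr1, h.symm, tw, OD.of, h]
        · rw [MonoidHom.comp_apply, OD.ii, z2hom_Y]
          refine (f2 (oP i 0) (oP j 0) (oP j 1) (adj_t j (by decide)) (by simp [h]) (by simp)).trans ?_
          simp [OD.std, okCoc, OD.tr2, tw, OD.of, h]
      exact DFunLike.congr_fun this a
    · rintro (⟨⟨i, j⟩, h, h'⟩ | ⟨⟨i, j⟩, h, h'⟩ | i | i)
      · simp only at h h'
        refine (f1 oC (oP i 0) (oP j 0) (adj_s i) (by simp) (by simp [h.symm])).trans ?_
        simp [OD.std, okCoc, OD.sp1, h.symm, h', OD.of, h]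
      · simp only at h h'
        refine (f2 (oP i 0) oC (oP j 0) (adj_s j) (by simp) (by simp [h])).trans ?_
        simp [OD.std, okCoc, OD.sp2, h', OD.of, h]
      · change f ((D.g (w := w)).c1 oC (oP i 0) (oP i 1))⁻¹ = _
        rw [map_inv, f1 oC (oP i 0) (oP i 1) (adj_s i) (by simp) (by simp)]
        simp [OD.std, okCoc, OD.sp1, OD.of]
      · refine (f1 (oP i 0) (oP i 1) (oP i 2) (adj_t i (by decide)) (by simp) (by simp)).trans ?_
        simp [OD.std, okCoc, OD.tr1, tw, OD.of]
end fin

/-- **Corollary (`PB₂(𝒪_k)` is quasi-isometric to `A(T) * ℤ`).** -/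
theorem Ok_braid_qi_raag_free_product (k : ℕ) (hk : 3 ≤ k)
    {W : Type} [Fintype W] (T : SimpleGraph W) (hT : T.IsTree)
    (hdiam : ∃ u v : W, 3 ≤ T.dist u v)
    (x : ↥(D2Config (OkGraph k))) :
    QuasiIsometricGroups (FundamentalGroup (↥(D2Config (OkGraph k))) x)
      (Monoid.Coprod (RAAG T) (FreeGroup Unit)) := by
  classical
  obtain ⟨R⟩ := exists_rooted T hT hdiam
  choose w hw hw' using fun j : Fin k => third hk j j
  let i0 : Fin k := ⟨0, by omega⟩
  let s0 : OS k := ⟨(w i0, i0), hw i0⟩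
  obtain ⟨D⟩ := d2s_exists (OkGraph k) (bad i0) (oP s0.1.1 0, oP s0.1.2 0) (by simpa using s0.2)
    (fun Q a b c => ok_conn w hw hk i0 s0.2 Q a b c) x
  have c1 := D.ceg_free w s0.2 (OS k)
  have c2 := (D.rz hw).ceg 2 R.rz (fun _ => rfl) Z2_fg (okPre_full hw hk s0) R.pre_full
  exact ((c1.trans c2).trans (tree_side R)).qi

end
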